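/- Let μ be a discrete growth rate with μ_{n+1}/μ_n ≤ θ for some θ ≥ 1, and 𝔸 = {A_n}_{n≥1} invertible linear operators on ℝ^d such that x_{n+1}=A_n x_n admits a μ-dichotomy and ‖Φ_A(m,k)‖ ≤ K(μ_m/μ_k)^a for m ≥ k, ‖Φ_A(m,k)‖ ≤ K(μ_k/μ_m)^a for m ≤ k, for some K, a > 0. Suppose the generalized spectrum Σ_{μD,𝔸} = [a_1,b_1] ∪ ⋯ ∪ [a_r,b_r] with 1 ≤ r ≤ d and a_1 ≤ b_1 < a_2 ≤ ⋯ < a_r ≤ b_r. Then for every ℓ ≥ 1 there exists t ≥ ℓ with the following property: if the non-resonance condition [a_i,b_i] ∩ [⟨a,q⟩, ⟨b,q⟩] = ∅ holds for all 1 ≤ i ≤ r and all q ∈ ℕ₀^r with 2 ≤ |q| ≤ t (where a=(a_1,…,a_r), b=(b_1,…,b_r), |q|=q_1+⋯+q_r), and (g_n)_{n≥1} ∈ 𝒪_μ^{t+2} with each A_n+g_n a homeomorphism of ℝ^d, then there are p, p̃ > 0, r ∈ (0,p), r̃ ∈ (0,p̃), and for each k ≥ 1 two C^ℓ diffeomorphisms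 h_k : B_r(0) → h_k(B_r(0)) ⊂ B_{p̃}(0) and h̄_k : B_{r̃}(0) → h̄_k(B_{r̃}(0)) ⊂ B_p(0) such that: (1) h̄_k(h_k(x))=x whenever x ∈ B_r(0) and h_k(x) ∈ B_{r̃}(0); (2) h_k(h̄_k(x))=x whenever x ∈ B_{r̃}(0) and h̄_k(x) ∈ B_r(0); (3) h̄_{k+1}(A_k x + g_k(x)) = A_k h_k(x) whenever x ∈ B_r(0) and A_k x + g_k(x) ∈ B_{r̃}(0); (4) h_k(x) → 0 and h̄_k(x) → 0 as x → 0, uniformly in k. -/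

import Mathlib

noncomputable section

open Filter Metric Set Topology

variable {X : Type*} [NormedAddCommGroup X] [NormedSpace ℝ X]

/-- A discrete growth rate: strictly increasing, `μ 0 = 1`, `μ n → ∞`. -/
def IsGrowthRate (μ : ℕ → ℝ) : Prop :=
  StrictMono μ ∧ μ 0 = 1 ∧ Filter.Tendsto μ Filter.atTop Filter.atTop

/-- The piecewise linear extension `μ̃` of a growth rate. -/
def tildeExt (μ : ℕ → ℝ) (t : ℝ) : ℝ :=
  μ ⌊t⌋₊ + (t - (⌊t⌋₊ : ℝ)) * (μ (⌊t⌋₊ + 1) - μ ⌊t⌋₊)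

/-- `⌊μ̃⁻¹ t⌋`, i.e. the largest `n` with `μ n ≤ t` (for `t ≥ 1`). -/
def floorInvTilde (μ : ℕ → ℝ) (t : ℝ) : ℕ := sSup {n : ℕ | μ n ≤ t}

/-- `⌊μ̃⁻¹ (η (k-1))⌋ + 1`. -/
def idxQ (μ η : ℕ → ℝ) (k : ℕ) : ℕ := floorInvTilde μ (η (k - 1)) + 1

def evolFwd (A : ℕ → X →L[ℝ] X) (k : ℕ) : ℕ → X →L[ℝ] X
  | 0 => ContinuousLinearMap.id ℝ X
  | n + 1 => (A (k + n)).comp (evolFwd A k n)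

/-- The evolution family `Φ_A(m,k) = A_{m-1} ∘ ⋯ ∘ A_k` for `m ≥ k`. -/
def evol (A : ℕ → X →L[ℝ] X) (m k : ℕ) : X →L[ℝ] X := evolFwd A k (m - k)

def evolFwdE (A : ℕ → X ≃L[ℝ] X) (k : ℕ) : ℕ → X ≃L[ℝ] X
  | 0 => ContinuousLinearEquiv.refl ℝ X
  | n + 1 => (evolFwdE A k n).trans (A (k + n))

/-- Two-sided evolution family of a sequence of invertible operators:
`Φ_A(m,k) = A_{m-1}⋯A_k` for `m > k`, `Id` for `m = k`, `A_m⁻¹⋯A_{k-1}⁻¹` for `m < k`. -/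
def evolEquiv (A : ℕ → X ≃L[ℝ] X) (m k : ℕ) : X ≃L[ℝ] X :=
  if k ≤ m then evolFwdE A k (m - k) else (evolFwdE A m (k - m)).symm

def evolE (A : ℕ → X ≃L[ℝ] X) (m k : ℕ) : X →L[ℝ] X := (evolEquiv A m k : X →L[ℝ] X)

/-- The time-rescaled sequence `Q_n^{μ,η} = Φ_A(⌊μ̃⁻¹(η n)⌋+1, ⌊μ̃⁻¹(η (n-1))⌋+1)`. -/
def Qseq (A : ℕ → X →L[ℝ] X) (μ η : ℕ → ℝ) (n : ℕ) : X →L[ℝ] X :=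
  evol A (idxQ μ η (n + 1)) (idxQ μ η n)

def QseqE (A : ℕ → X ≃L[ℝ] X) (μ η : ℕ → ℝ) (n : ℕ) : X ≃L[ℝ] X :=
  evolEquiv A (idxQ μ η (n + 1)) (idxQ μ η n)

/-- A sequence of norms on `X`. -/
def IsNormFamily (Nrm : ℕ → X → ℝ) : Prop :=
  ∀ k, (∀ x y : X, Nrm k (x + y) ≤ Nrm k x + Nrm k y) ∧
    (∀ (c : ℝ) (x : X), Nrm k (c • x) = |c| * Nrm k x) ∧
    (∀ x : X, Nrm k x = 0 → x = 0)

/-- Each norm in the family is equivalent to the ambient norm. -/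
def NormsEquivalent (Nrm : ℕ → X → ℝ) : Prop :=
  ∀ k, ∃ α β : ℝ, 0 < α ∧ 0 < β ∧ ∀ x : X, α * ‖x‖ ≤ Nrm k x ∧ Nrm k x ≤ β * ‖x‖

/-- (od1)–(od2): a sequence of projections compatible with the dynamics, such that the
restriction of `A k` to `Ker P k` is an isomorphism onto `Ker P (k+1)`. -/
def ProjectionsCompat (A P : ℕ → X →L[ℝ] X) : Prop :=
  (∀ k, 1 ≤ k → (P k).comp (P k) = P k) ∧
  (∀ k, 1 ≤ k → (A k).comp (P k) = (P (k + 1)).comp (A k)) ∧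
  (∀ k, 1 ≤ k → Set.BijOn (⇑(A k)) {x : X | P k x = 0} {x : X | P (k + 1) x = 0})

/-- μ-dichotomy with respect to a sequence of norms, relative to given projections.
For `m ≤ k`, `Φ_A(m,k)(Id - P_k)x` denotes the unique `z ∈ Ker P_m` with
`Φ_A(k,m) z = (Id - P_k) x`. -/
def MuDichotomyNormsWith (μ : ℕ → ℝ) (A P : ℕ → X →L[ℝ] X) (Nrm : ℕ → X → ℝ) : Prop :=
  ProjectionsCompat A P ∧
  ∃ N ν : ℝ, 1 ≤ N ∧ 0 < ν ∧
    (∀ k m : ℕ, 1 ≤ k → k ≤ m → ∀ x : X,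
      Nrm m (evol A m k (P k x)) ≤ N * (μ m / μ k) ^ (-ν) * Nrm k x) ∧
    (∀ m k : ℕ, 1 ≤ m → m ≤ k → ∀ x z : X, P m z = 0 → evol A k m z = x - P k x →
      Nrm m z ≤ N * (μ k / μ m) ^ (-ν) * Nrm k x)

/-- Ordinary dichotomy with respect to a sequence of norms, relative to given projections. -/
def OrdinaryDichotomyNormsWith (A P : ℕ → X →L[ℝ] X) (Nrm : ℕ → X → ℝ) : Prop :=
  ProjectionsCompat A P ∧
  ∃ K : ℝ, 1 ≤ K ∧
    (∀ k m : ℕ, 1 ≤ k → k ≤ m → ∀ x : X, Nrm m (evol A m k (P k x)) ≤ K * Nrm k x) ∧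
    (∀ m k : ℕ, 1 ≤ m → m ≤ k → ∀ x z : X, P m z = 0 → evol A k m z = x - P k x →
      Nrm m z ≤ K * Nrm k x)

/-- μ-dichotomy (with respect to a sequence of norms) of a system of invertible operators. -/
def MuDichotomyNormsE (μ : ℕ → ℝ) (A : ℕ → X ≃L[ℝ] X) (Nrm : ℕ → X → ℝ) : Prop :=
  ∃ P : ℕ → X →L[ℝ] X,
    (∀ k, 1 ≤ k → (P k).comp (P k) = P k) ∧
    (∀ k, 1 ≤ k → ((A k : X →L[ℝ] X)).comp (P k) = (P (k + 1)).comp ((A k : X →L[ℝ] X))) ∧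
    (∀ k, 1 ≤ k → Set.BijOn (⇑(A k)) {x : X | P k x = 0} {x : X | P (k + 1) x = 0}) ∧
    ∃ N ν : ℝ, 1 ≤ N ∧ 0 < ν ∧
      (∀ k m : ℕ, 1 ≤ k → k ≤ m → ∀ x : X,
        Nrm m (evolE A m k (P k x)) ≤ N * (μ m / μ k) ^ (-ν) * Nrm k x) ∧
      (∀ m k : ℕ, 1 ≤ m → m ≤ k → ∀ x : X,
        Nrm m (evolE A m k (x - P k x)) ≤ N * (μ k / μ m) ^ (-ν) * Nrm k x)

/-- μ-dichotomy with respect to the original norm. -/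
def MuDichotomy (μ : ℕ → ℝ) (B : ℕ → X →L[ℝ] X) : Prop :=
  ∃ P : ℕ → X →L[ℝ] X, MuDichotomyNormsWith μ B P fun _ x => ‖x‖

/-- The scaled system `Ã_n = (μ_{n+1}/μ_n)^{-λ} A_n`. -/
def scaledSys (μ : ℕ → ℝ) (A : ℕ → X ≃L[ℝ] X) (l : ℝ) (n : ℕ) : X →L[ℝ] X :=
  ((μ (n + 1) / μ n) ^ (-l)) • (A n : X →L[ℝ] X)

/-- The generalized dichotomy spectrum `Σ_{μD,𝔸}`. -/
def muSpectrum (μ : ℕ → ℝ) (A : ℕ → X ≃L[ℝ] X) : Set ℝ :=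
  {l : ℝ | ¬ MuDichotomy μ (scaledSys μ A l)}

/-- The exponential growth rate `n ↦ e^n`. -/
def expRate : ℕ → ℝ := fun n => Real.exp n

/-- `Σ_{ED,ℚ}`: the Sacker–Sell spectrum of the time-rescaled system. -/
def expSpectrumQ (μ : ℕ → ℝ) (A : ℕ → X ≃L[ℝ] X) : Set ℝ :=
  {l : ℝ | ¬ MuDichotomy expRate fun n => Real.exp (-l) • (QseqE A μ expRate n : X →L[ℝ] X)}

/-- `f` is a homeomorphism. -/
def IsHomeoOf {Y : Type*} [TopologicalSpace Y] (f : Y → Y) : Prop :=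
  ∃ h : Y ≃ₜ Y, ∀ x, h x = f x

/-- The perturbed maps `x ↦ A_n x + g_n x`. -/
def pert (A : ℕ → X ≃L[ℝ] X) (g : ℕ → X → X) (n : ℕ) : X → X := fun x => A n x + g n x

def nlFwd (F : ℕ → X → X) (n : ℕ) : ℕ → X → X
  | 0 => id
  | j + 1 => F (n + j) ∘ nlFwd F n j

/-- Nonlinear evolution `𝒢(m,n) = (A_{m-1}+g_{m-1})∘⋯∘(A_n+g_n)` for `m ≥ n`. -/
def nlEvol (A : ℕ → X ≃L[ℝ] X) (g : ℕ → X → X) (m n : ℕ) : X → X := nlFwd (pert A g) n (m - n)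

def nlBwd (F : ℕ → X → X) (m : ℕ) : ℕ → X → X
  | 0 => id
  | j + 1 => nlBwd F m j ∘ Function.invFun (F (m + j))

/-- Nonlinear evolution `𝒢(m,n) = (A_m+g_m)⁻¹∘⋯∘(A_{n-1}+g_{n-1})⁻¹` for `m ≤ n`. -/
def nlEvolBwd (A : ℕ → X ≃L[ℝ] X) (g : ℕ → X → X) (m n : ℕ) : X → X :=
  nlBwd (pert A g) m (n - m)

/-- The rescaled nonlinearities `f_n`. -/
def fSeq (A : ℕ → X ≃L[ℝ] X) (g : ℕ → X → X) (μ : ℕ → ℝ) (n : ℕ) (x : X) : X :=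
  ∑ j ∈ Finset.Icc (floorInvTilde μ (expRate (n - 1)) + 1) (floorInvTilde μ (expRate n)),
    evolE A (floorInvTilde μ (expRate n) + 1) (j + 1)
      (g j (nlEvol A g j (floorInvTilde μ (expRate (n - 1)) + 1) x))

/-- The class `𝒪_μ^k`, with constant `M`. -/
def InOmegaMu (μ : ℕ → ℝ) (k : ℕ) (f : ℕ → X → X) (M : ℝ) : Prop :=
  (∀ n, ContDiff ℝ (k : ℕ∞) (f n)) ∧ (∀ n, f n 0 = 0) ∧ (∀ n, fderiv ℝ (f n) 0 = 0) ∧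
  ∀ n, 1 ≤ n → ∀ x : X, ∀ j : ℕ, j ≤ k →
    ‖iteratedFDeriv ℝ j (f n) x‖ ≤ M * (μ (n + 1) - μ n) / μ n

/-- The fundamental solution of `x_{n+1} = A_n x_n` normalised at time `0`. -/
def fundSol (A : ℕ → X ≃L[ℝ] X) : ℕ → X ≃L[ℝ] X
  | 0 => ContinuousLinearEquiv.refl ℝ X
  | n + 1 => (fundSol A n).trans (A n)

/-- The two-sided evolution operator from time `k` to time `m`. -/
def Ev (A : ℕ → X ≃L[ℝ] X) (m k : ℕ) : X →L[ℝ] X :=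
  (((fundSol A k).symm.trans (fundSol A m) : X ≃L[ℝ] X) : X →L[ℝ] X)

section Evolution

variable (A : ℕ → X ≃L[ℝ] X)

lemma Ev_apply (m k : ℕ) (x : X) : Ev A m k x = fundSol A m ((fundSol A k).symm x) := rfl

@[simp] lemma Ev_Ev (m n k : ℕ) (x : X) : Ev A m n (Ev A n k x) = Ev A m k x := by
  simp [Ev_apply]

lemma Ev_mul (m n k : ℕ) : Ev A m n * Ev A n k = Ev A m k := by
  ext x; simp

@[simp] lemma Ev_self (k : ℕ) : Ev A k k = 1 := by
  ext x; simp [Ev_apply]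

lemma Ev_succ_self (n : ℕ) (x : X) : Ev A (n + 1) n x = A n x := by
  simp [Ev_apply, fundSol]

lemma Ev_succ_left (n k : ℕ) (x : X) : A n (Ev A n k x) = Ev A (n + 1) k x := by
  rw [← Ev_succ_self, Ev_Ev]

lemma Ev_succ_right (k n : ℕ) (x : X) : Ev A k (n + 1) (A n x) = Ev A k n x := by
  rw [← Ev_succ_self, Ev_Ev]

lemma Ev_self_succ (n : ℕ) (x : X) : Ev A n (n + 1) x = (A n).symm x := by
  simp [Ev_apply, fundSol]

lemma evolFwdE_succ_apply (k j : ℕ) (x : X) :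
    evolFwdE A (k + 1) j x = Ev (fun n => A (n + 1)) (k + j) k x := by
  induction j with
  | zero => simp [evolFwdE]
  | succ j ih =>
    have := Ev_succ_left (fun n => A (n + 1)) (k + j) k x
    simp only [evolFwdE, ContinuousLinearEquiv.trans_apply, ih]
    rw [← Nat.add_assoc, ← this]
    congr 2
    omega

lemma evolE_succ_succ (m k : ℕ) :
    evolE A (m + 1) (k + 1) = Ev (fun n => A (n + 1)) m k := by
  ext x
  by_cases h : k ≤ m
  · have := evolFwdE_succ_apply A k (m - k) x
    rw [Nat.add_sub_cancel' h] at this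
    simpa [evolE, evolEquiv, h] using this
  · have h' : m ≤ k := by omega
    have := evolFwdE_succ_apply A m (k - m) (Ev (fun n => A (n + 1)) m k x)
    rw [Nat.add_sub_cancel' h'] at this
    simp only [Ev_Ev, Ev_self] at this
    simp only [evolE, evolEquiv, Nat.add_le_add_iff_right, h, if_false, Nat.add_sub_add_right]
    rw [ContinuousLinearEquiv.coe_coe, ContinuousLinearEquiv.symm_apply_eq, this]
    rfl

end Evolution

/-- `P` is a family of projections for an exponential dichotomy, in the time scale `τ`, of the
system `x_{n+1} = e^{-lam (τ_{n+1} - τ_n)} A_n x_n`. -/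
structure IsDich (A : ℕ → X ≃L[ℝ] X) (τ : ℕ → ℝ) (lam : ℝ) (P : ℕ → X →L[ℝ] X) : Prop where
  proj : ∀ k, P k * P k = P k
  comm : ∀ m k, Ev A m k * P k = P m * Ev A m k
  bound : ∃ N ν : ℝ, 1 ≤ N ∧ 0 < ν ∧
    (∀ k m, k ≤ m → ‖Ev A m k * P k‖ ≤ N * Real.exp ((lam - ν) * (τ m - τ k))) ∧
    (∀ m k, m ≤ k → ‖Ev A m k * (1 - P k)‖ ≤ N * Real.exp (-(lam + ν) * (τ k - τ m)))

lemma comm_of_comm_succ {A : ℕ → X ≃L[ℝ] X} {P : ℕ → X →L[ℝ] X}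
    (h : ∀ n x, A n (P n x) = P (n + 1) (A n x)) (m k : ℕ) :
    Ev A m k * P k = P m * Ev A m k := by
  have key : ∀ m x, fundSol A m (P 0 x) = P m (fundSol A m x) := by
    intro m
    induction m with
    | zero => intro x; simp [fundSol]
    | succ m ih => intro x; simp [fundSol, ih, h]
  ext x
  obtain ⟨y, rfl⟩ := (fundSol A k).surjective x
  simp [Ev_apply, ← key]

section FromMu

lemma mu_rpow {μ : ℕ → ℝ} (hpos : ∀ n, 0 < μ n) (m k : ℕ) (s : ℝ) :
    (μ m / μ k) ^ s = Real.exp (s * (Real.log (μ m) - Real.log (μ k))) := by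
  rw [Real.rpow_def_of_pos (div_pos (hpos m) (hpos k)),
    Real.log_div (hpos m).ne' (hpos k).ne', mul_comm]

lemma IsGrowthRate.pos {μ : ℕ → ℝ} (hμ : IsGrowthRate μ) (n : ℕ) : 0 < μ n := by
  have := hμ.1.monotone (Nat.zero_le n)
  rw [hμ.2.1] at this
  linarith

lemma evol_scaledSys {μ : ℕ → ℝ} (hpos : ∀ n, 0 < μ n) (A : ℕ → X ≃L[ℝ] X) (lam : ℝ) (k j : ℕ)
    (x : X) : evol (scaledSys μ A lam) (k + 1 + j) (k + 1) x =
      (μ (k + 1 + j) / μ (k + 1)) ^ (-lam) • Ev (fun n => A (n + 1)) (k + j) k x := by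
  unfold evol
  rw [Nat.add_sub_cancel_left]
  induction j with
  | zero => simp [evolFwd, div_self (hpos _).ne']
  | succ j ih =>
    simp only [evolFwd, ContinuousLinearMap.comp_apply, ih, scaledSys,
      smul_apply, map_smul, smul_smul]
    have := Ev_succ_left (fun n => A (n + 1)) (k + j) k x
    rw [← Nat.add_assoc, ← Nat.add_assoc, ← this]
    congr 1
    · rw [mu_rpow hpos, mu_rpow hpos, mu_rpow hpos, ← Real.exp_add]
      congr 1; ring
    · show (A (k + 1 + j)) _ = _
      congr 2; omega

lemma isDich_of_muDichotomy {μ : ℕ → ℝ} (hpos : ∀ n, 0 < μ n) {A : ℕ → X ≃L[ℝ] X} {lam : ℝ}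
    (h : MuDichotomy μ (scaledSys μ A lam)) :
    ∃ P, IsDich (fun n => A (n + 1)) (fun n => Real.log (μ (n + 1))) lam P := by
  obtain ⟨P, ⟨hP, hc, -⟩, N, ν, hN, hν, h1, h2⟩ := h
  have hc' : ∀ n x, A (n + 1) (P (n + 1) x) = P (n + 1 + 1) (A (n + 1) x) := by
    intro n x
    have := congrArg (fun f : X →L[ℝ] X => f x) (hc (n + 1) (by omega))
    simp only [scaledSys, ContinuousLinearMap.comp_apply, smul_apply,
      map_smul] at this
    exact smul_right_injective X (Real.rpow_pos_of_pos (div_pos (hpos _) (hpos _)) _).ne' this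
  have hcomm := comm_of_comm_succ (A := fun n => A (n + 1)) (P := fun n => P (n + 1)) hc'
  have hcx : ∀ m k x, Ev (fun n => A (n + 1)) m k (P (k + 1) x) =
      P (m + 1) (Ev (fun n => A (n + 1)) m k x) := fun m k x =>
    congrArg (fun f : X →L[ℝ] X => f x) (hcomm m k)
  refine ⟨fun n => P (n + 1), fun k => hP (k + 1) (by omega), hcomm, N, ν, hN, hν, ?_, ?_⟩
  · intro k m hkm
    refine ContinuousLinearMap.opNorm_le_bound _ (by positivity) fun x => ?_
    obtain ⟨j, rfl⟩ := Nat.exists_eq_add_of_le hkm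
    have := h1 (k + 1) (k + 1 + j) (by omega) (by omega) x
    beta_reduce at this
    rw [evol_scaledSys hpos, norm_smul, mu_rpow hpos, mu_rpow hpos, Real.norm_eq_abs,
      Real.abs_exp] at this
    rw [show k + 1 + j = k + j + 1 by omega] at this
    set D := Real.log (μ (k + j + 1)) - Real.log (μ (k + 1)) with hD
    change ‖Ev (fun n => A (n + 1)) (k + j) k (P (k + 1) x)‖ ≤ _
    have e : (lam - ν) * D = lam * D + -ν * D := by ring
    rw [e, Real.exp_add]
    calc _ = Real.exp (lam * D) * (Real.exp (-lam * D) * ‖Ev (fun n => A (n + 1)) (k + j) k (P (k + 1) x)‖) := by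
          rw [← mul_assoc, ← Real.exp_add]; simp
      _ ≤ Real.exp (lam * D) * (N * Real.exp (-ν * D) * ‖x‖) := by gcongr
      _ = _ := by ring
  · intro m k hmk
    refine ContinuousLinearMap.opNorm_le_bound _ (by positivity) fun x => ?_
    obtain ⟨j, rfl⟩ := Nat.exists_eq_add_of_le hmk
    set D := Real.log (μ (m + j + 1)) - Real.log (μ (m + 1)) with hD
    have hPP : ∀ y, P (m + j + 1) (P (m + j + 1) y) = P (m + j + 1) y := fun y =>
      congrArg (fun f : X →L[ℝ] X => f y) (hP (m + j + 1) (by omega))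
    have := h2 (m + 1) (m + 1 + j) (by omega) (by omega) x
      (Real.exp (lam * D) • Ev (fun n => A (n + 1)) m (m + j) (x - P (m + 1 + j) x)) (by
        rw [show m + 1 + j = m + j + 1 by omega, map_smul, ← hcx, map_sub, hPP]; simp)
      (by
        rw [evol_scaledSys hpos, mu_rpow hpos]
        rw [show m + 1 + j = m + j + 1 by omega]
        rw [← hD, map_smul, Ev_Ev, smul_smul, ← Real.exp_add]
        simp)
    beta_reduce at this
    rw [norm_smul, mu_rpow hpos, Real.norm_eq_abs, Real.abs_exp] at this
    rw [show m + 1 + j = m + j + 1 by omega, ← hD] at this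
    have e : -(lam + ν) * D = -(lam * D) + -ν * D := by ring
    change ‖Ev (fun n => A (n + 1)) m (m + j) (x - P (m + j + 1) x)‖ ≤ _
    rw [e, Real.exp_add]
    calc _ = Real.exp (-(lam * D)) * (Real.exp (lam * D) * ‖Ev (fun n => A (n + 1)) m (m + j) (x - P (m + j + 1) x)‖) := by
          rw [← mul_assoc, ← Real.exp_add]; simp
      _ ≤ Real.exp (-(lam * D)) * (N * Real.exp (-ν * D) * ‖x‖) := by gcongr
      _ = _ := by ring

end FromMu

section Dich

variable {A : ℕ → X ≃L[ℝ] X} {τ : ℕ → ℝ} {lam lam' : ℝ} {P Q : ℕ → X →L[ℝ] X}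

lemma IsDich.norm_le (h : IsDich A τ lam P) :
    ∃ C : ℝ, 0 ≤ C ∧ ∀ k, ‖P k‖ ≤ C ∧ ‖1 - P k‖ ≤ C := by
  obtain ⟨N, ν, hN, hν, h1, h2⟩ := h.bound
  refine ⟨N, by linarith, fun k => ⟨?_, ?_⟩⟩
  · simpa using h1 k k le_rfl
  · simpa using h2 k k le_rfl

lemma IsDich.comm_one_sub (h : IsDich A τ lam P) (m k : ℕ) :
    Ev A m k * (1 - P k) = (1 - P m) * Ev A m k := by
  rw [mul_sub, sub_mul, h.comm, mul_one, one_mul]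

lemma IsDich.mul_eq (hτ : Tendsto τ atTop atTop) (hP : IsDich A τ lam P)
    (hQ : IsDich A τ lam Q) (k : ℕ) : Q k * P k = P k := by
  obtain ⟨N, ν, hN, hν, h1, -⟩ := hP.bound
  obtain ⟨N', ν', hN', hν', -, h2⟩ := hQ.bound
  have key : ∀ m, k ≤ m →
      ‖(1 - Q k) * P k‖ ≤ N' * N * Real.exp (-(ν + ν') * (τ m - τ k)) := by
    intro m hm
    have e : (1 - Q k) * P k = (Ev A k m * (1 - Q m)) * (Ev A m k * P k) := by
      rw [hQ.comm_one_sub, mul_assoc, ← mul_assoc (Ev A k m), Ev_mul, Ev_self, one_mul]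
    rw [e]
    calc _ ≤ ‖Ev A k m * (1 - Q m)‖ * ‖Ev A m k * P k‖ := norm_mul_le _ _
      _ ≤ (N' * Real.exp (-(lam + ν') * (τ m - τ k))) *
          (N * Real.exp ((lam - ν) * (τ m - τ k))) := by
        gcongr
        · exact h2 k m hm
        · exact h1 k m hm
      _ = N' * N * (Real.exp (-(lam + ν') * (τ m - τ k)) * Real.exp ((lam - ν) * (τ m - τ k))) := by
        ring
      _ = _ := by rw [← Real.exp_add]; congr 2; ring
  have hlim : Tendsto (fun m => N' * N * Real.exp (-(ν + ν') * (τ m - τ k))) atTop (𝓝 0) := by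
    have : Tendsto (fun m => -(ν + ν') * (τ m - τ k)) atTop atBot :=
      (tendsto_atTop_add_const_right _ (-τ k) hτ).const_mul_atTop_of_neg (by linarith)
    simpa using (Real.tendsto_exp_atBot.comp this).const_mul (N' * N)
  have h0 : ‖(1 - Q k) * P k‖ ≤ 0 :=
    ge_of_tendsto hlim ((eventually_ge_atTop k).mono key)
  have := norm_le_zero_iff.1 h0
  rw [sub_mul, one_mul, sub_eq_zero] at this
  exact this.symm

lemma IsDich.transfer (hτ : Tendsto τ atTop atTop) (hP : IsDich A τ lam P)
    (hQ : IsDich A τ lam Q) (hP' : IsDich A τ lam' P) : IsDich A τ lam' Q := by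
  obtain ⟨C, hC, hQC⟩ := hQ.norm_le
  obtain ⟨N, ν, hN, hν, h1, h2⟩ := hP'.bound
  have hNC : N * C ≤ N * (C + 1) := by gcongr; linarith
  refine ⟨hQ.proj, hQ.comm, N * (C + 1), ν, by nlinarith, hν, fun k m hkm => ?_, fun m k hmk => ?_⟩
  · rw [← hQ.mul_eq hτ hP, ← mul_assoc]
    calc _ ≤ ‖Ev A m k * P k‖ * ‖Q k‖ := norm_mul_le _ _
      _ ≤ (N * Real.exp ((lam' - ν) * (τ m - τ k))) * C := by
        gcongr
        · exact h1 k m hkm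
        · exact (hQC k).1
      _ = N * C * Real.exp ((lam' - ν) * (τ m - τ k)) := by ring
      _ ≤ _ := by gcongr
  · have e : (1 - Q m) = (1 - Q m) * (1 - P m) := by
      rw [mul_sub, sub_mul _ _ (P m), hP.mul_eq hτ hQ]; simp
    rw [hQ.comm_one_sub, e, mul_assoc, ← hP.comm_one_sub]
    calc _ ≤ ‖1 - Q m‖ * ‖Ev A m k * (1 - P k)‖ := norm_mul_le _ _
      _ ≤ C * (N * Real.exp (-(lam' + ν) * (τ k - τ m))) := by
        gcongr
        · exact (hQC m).2
        · exact h2 m k hmk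
      _ = N * C * Real.exp (-(lam' + ν) * (τ k - τ m)) := by ring
      _ ≤ _ := by gcongr

lemma IsDich.eventually (hτm : Monotone τ) (hP : IsDich A τ lam P) :
    ∀ᶠ y in 𝓝 lam, IsDich A τ y P := by
  obtain ⟨N, ν, hN, hν, h1, h2⟩ := hP.bound
  filter_upwards [Ioo_mem_nhds (show lam - ν / 2 < lam by linarith)
    (show lam < lam + ν / 2 by linarith)] with y hy
  refine ⟨hP.proj, hP.comm, N, ν / 2, hN, by linarith, fun k m hkm => (h1 k m hkm).trans ?_,
    fun m k hmk => (h2 m k hmk).trans ?_⟩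
  · have := sub_nonneg.2 (hτm hkm)
    exact mul_le_mul_of_nonneg_left (Real.exp_le_exp.2 (mul_le_mul_of_nonneg_right
      (by linarith [hy.1]) this)) (by linarith)
  · have := sub_nonneg.2 (hτm hmk)
    exact mul_le_mul_of_nonneg_left (Real.exp_le_exp.2 (mul_le_mul_of_nonneg_right
      (by linarith [hy.2]) this)) (by linarith)

lemma isDich_iff_of_isPreconnected (hτ : Tendsto τ atTop atTop) (hτm : Monotone τ) {s : Set ℝ}
    (hs : IsPreconnected s) (hres : ∀ x ∈ s, ∃ P, IsDich A τ x P) {x y : ℝ} (hx : x ∈ s)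
    (hy : y ∈ s) : ∀ P, IsDich A τ x P ↔ IsDich A τ y P := by
  refine hs.induction₂ (fun x y => ∀ P, IsDich A τ x P ↔ IsDich A τ y P) ?_ ?_ ?_ hx hy
  · intro x hx
    obtain ⟨P₀, hP₀⟩ := hres x hx
    filter_upwards [nhdsWithin_le_nhds (hP₀.eventually hτm)] with y hy P
    exact ⟨fun h => hP₀.transfer hτ h hy, fun h => hy.transfer hτ h hP₀⟩
  · intro x y z _ _ _ h1 h2 P
    exact (h1 P).trans (h2 P)
  · intro x y _ _ h P
    exact (h P).symm

lemma isDich_one_of_lt (hτm : Monotone τ) {K a : ℝ} (hK : 1 ≤ K)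
    (hEv : ∀ m k, ‖Ev A m k‖ ≤ K * Real.exp (a * |τ m - τ k|)) (h : a < lam) :
    IsDich A τ lam (fun _ => 1) := by
  refine ⟨fun _ => one_mul _, fun m k => by rw [mul_one, one_mul], K, lam - a, hK, by linarith,
    fun k m hkm => ?_, fun m k _ => ?_⟩
  · have := hEv m k
    rw [abs_of_nonneg (sub_nonneg.2 (hτm hkm))] at this
    simpa using this
  · simp; positivity

lemma isDich_zero_of_lt (hτm : Monotone τ) {K a : ℝ} (hK : 1 ≤ K)
    (hEv : ∀ m k, ‖Ev A m k‖ ≤ K * Real.exp (a * |τ m - τ k|)) (h : lam < -a) :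
    IsDich A τ lam (fun _ => 0) := by
  refine ⟨fun _ => mul_zero _, fun m k => by rw [mul_zero, zero_mul], K, -a - lam, hK, by linarith,
    fun k m hkm => ?_, fun m k hmk => ?_⟩
  · simp; positivity
  · have := hEv m k
    rw [abs_of_nonpos (by linarith [hτm hmk])] at this
    simpa using this

end Dich

/-- A bounded invariant splitting of the identity into `r` blocks with growth rates in
`[α i, β i]`, up to `ε`. -/
structure IsSplitting (A : ℕ → X ≃L[ℝ] X) (τ : ℕ → ℝ) {r : ℕ} (α β : Fin r → ℝ)
    (S : Fin r → ℕ → X →L[ℝ] X) : Prop where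
  sum_eq : ∀ n, ∑ i, S i n = 1
  comm : ∀ i m k, Ev A m k * S i k = S i m * Ev A m k
  bound : ∀ ε > 0, ∃ C : ℝ, 0 ≤ C ∧ ∀ i,
    (∀ k m, k ≤ m → ‖Ev A m k * S i k‖ ≤ C * Real.exp ((β i + ε) * (τ m - τ k))) ∧
    (∀ m k, m ≤ k → ‖Ev A m k * S i k‖ ≤ C * Real.exp (-(α i - ε) * (τ k - τ m)))

section Splitting

variable {A : ℕ → X ≃L[ℝ] X} {τ : ℕ → ℝ}

/-- Products of complementary projections. -/
def coProd (P : ℕ → ℕ → X →L[ℝ] X) : ℕ → ℕ → X →L[ℝ] X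
  | 0, n => 1 - P 0 n
  | i + 1, n => coProd P i n * (1 - P (i + 1) n)

lemma coProd_bound {P : ℕ → ℕ → X →L[ℝ] X} {r : ℕ} (lam : ℕ → ℝ)
    (hP : ∀ i ≤ r, IsDich A τ (lam i) (P i)) (i : ℕ) (hi : i ≤ r) :
    (∃ C : ℝ, 0 ≤ C ∧ ∀ n, ‖coProd P i n‖ ≤ C) ∧
    (∀ m k, Ev A m k * coProd P i k = coProd P i m * Ev A m k) ∧
    ∀ lam', IsDich A τ lam' (P i) → ∃ C ν : ℝ, 0 ≤ C ∧ 0 < ν ∧ ∀ m k, m ≤ k →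
      ‖Ev A m k * coProd P i k‖ ≤ C * Real.exp (-(lam' + ν) * (τ k - τ m)) := by
  induction i with
  | zero =>
    refine ⟨?_, fun m k => (hP 0 hi).comm_one_sub m k, fun lam' h => ?_⟩
    · obtain ⟨C, hC, h⟩ := (hP 0 hi).norm_le
      exact ⟨C, hC, fun n => (h n).2⟩
    · obtain ⟨N, ν, hN, hν, h1, h2⟩ := h.bound
      exact ⟨N, ν, by linarith, hν, h2⟩
  | succ i ih =>
    obtain ⟨⟨C, hC, hb⟩, hc, -⟩ := ih (by omega)
    refine ⟨?_, fun m k => ?_, fun lam' h => ?_⟩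
    · obtain ⟨C', hC', h⟩ := (hP (i + 1) hi).norm_le
      refine ⟨C * C', by positivity, fun n => (norm_mul_le _ _).trans ?_⟩
      gcongr
      · exact hb n
      · exact (h n).2
    · simp only [coProd]
      rw [← mul_assoc, hc, mul_assoc, (hP (i + 1) hi).comm_one_sub, mul_assoc]
    · obtain ⟨N, ν, hN, hν, h1, h2⟩ := h.bound
      refine ⟨C * N, ν, by positivity, hν, fun m k hmk => ?_⟩
      simp only [coProd]
      rw [← mul_assoc, hc, mul_assoc, mul_assoc]
      refine (norm_mul_le _ _).trans ?_
      gcongr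
      · exact hb m
      · exact h2 m k hmk

lemma exists_isSplitting (hτ : Tendsto τ atTop atTop) (hτm : Monotone τ) {K a : ℝ} (hK : 1 ≤ K)
    (hEv : ∀ m k, ‖Ev A m k‖ ≤ K * Real.exp (a * |τ m - τ k|)) {r : ℕ} (hr : 1 ≤ r)
    {aa bb : ℕ → ℝ} (hab : ∀ i, 1 ≤ i → i ≤ r → aa i ≤ bb i)
    (hord : ∀ i, 1 ≤ i → i < r → bb i < aa (i + 1))
    (hspec : ∀ lam, (∀ i, 1 ≤ i → i ≤ r → lam ∉ Icc (aa i) (bb i)) → ∃ P, IsDich A τ lam P) :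
    ∃ S, IsSplitting A τ (fun i : Fin r => aa (i + 1)) (fun i : Fin r => bb (i + 1)) S := by
  have hbb : ∀ i j, 1 ≤ i → i ≤ j → j ≤ r → bb i ≤ bb j := by
    intro i j hi hij hj
    induction j, hij using Nat.le_induction with
    | base => exact le_rfl
    | succ j hij ih =>
      linarith [ih (by omega), hord j (by omega) (by omega), hab (j + 1) (by omega) hj]
  have haa : ∀ i j, 1 ≤ i → i ≤ j → j ≤ r → aa i ≤ aa j := by
    intro i j hi hij hj
    induction j, hij using Nat.le_induction with
    | base => exact le_rfl
    | succ j hij ih =>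
      linarith [ih (by omega), hord j (by omega) (by omega), hab j (by omega) (by omega)]
  let G : ℕ → Set ℝ := fun i => {x | (1 ≤ i → bb i < x) ∧ (i < r → x < aa (i + 1))}
  have hG : ∀ i, IsPreconnected (G i) := by
    intro i
    refine Set.OrdConnected.isPreconnected ⟨fun x hx y hy z hz => ⟨fun h => ?_, fun h => ?_⟩⟩
    · exact (hx.1 h).trans_le hz.1
    · exact hz.2.trans_lt (hy.2 h)
  have hres : ∀ i ≤ r, ∀ x ∈ G i, ∃ P, IsDich A τ x P := by
    intro i hi x hx
    refine hspec x fun j hj1 hjr hxj => ?_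
    by_cases hji : j ≤ i
    · linarith [hx.1 (by omega), hbb j i hj1 hji hi, hxj.2]
    · linarith [hx.2 (by omega), haa (i + 1) j (by omega) (by omega) hjr, hxj.1]
  have hP : ∀ i ≤ r, ∃ P, (i = 0 → P = fun _ => 0) ∧ (i = r → P = fun _ => 1) ∧
      ∃ x₀ ∈ G i, ∀ x ∈ G i, IsDich A τ x P := by
    intro i hi
    by_cases h0 : i = 0
    · subst h0
      have hx₀ : min (-a) (aa 1) - 1 ∈ G 0 := by
        refine ⟨fun h => by omega, fun _ => ?_⟩
        have := min_le_right (-a) (aa 1)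
        simp only [zero_add]
        linarith
      refine ⟨fun _ => 0, fun _ => rfl, fun h => by omega, _, hx₀, fun x hx => ?_⟩
      refine (isDich_iff_of_isPreconnected hτ hτm (hG 0) (hres 0 hi) hx₀ hx _).1 ?_
      exact isDich_zero_of_lt hτm hK hEv (by linarith [min_le_left (-a) (aa 1)])
    by_cases h1 : i = r
    · subst h1
      have hx₀ : max a (bb i) + 1 ∈ G i := by
        refine ⟨fun h => ?_, fun h => by omega⟩
        have := le_max_right a (bb i)
        linarith
      refine ⟨fun _ => 1, fun h => by omega, fun _ => rfl, _, hx₀, fun x hx => ?_⟩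
      refine (isDich_iff_of_isPreconnected hτ hτm (hG i) (hres i hi) hx₀ hx _).1 ?_
      exact isDich_one_of_lt hτm hK hEv (by linarith [le_max_left a (bb i)])
    · have := hord i (by omega) (by omega)
      have hx₀ : (bb i + aa (i + 1)) / 2 ∈ G i := ⟨fun _ => by linarith, fun _ => by linarith⟩
      obtain ⟨P, hP⟩ := hres i hi _ hx₀
      refine ⟨P, fun h => absurd h h0, fun h => absurd h h1, _, hx₀, fun x hx => ?_⟩
      exact (isDich_iff_of_isPreconnected hτ hτm (hG i) (hres i hi) hx₀ hx _).1 hP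
  choose! P hP0 hPr lam hlam hdich using hP
  have hco := coProd_bound lam (fun i hi => hdich i hi _ (hlam i hi))
  have hcx : ∀ i ≤ r, ∀ m k, Ev A m k * P i k = P i m * Ev A m k := fun i hi =>
    (hdich i hi _ (hlam i hi)).comm
  refine ⟨fun i n => coProd P i n * P (i + 1) n, fun n => ?_, fun i m k => ?_, fun ε hε => ?_⟩
  · have htel : ∀ i, coProd P i n * P (i + 1) n = coProd P i n - coProd P (i + 1) n := by
      intro i; simp [coProd, mul_sub]
    rw [Fin.sum_univ_eq_sum_range (fun i => coProd P i n * P (i + 1) n)]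
    simp only [htel]
    rw [Finset.sum_range_sub']
    obtain ⟨s, rfl⟩ : ∃ s, r = s + 1 := ⟨r - 1, by omega⟩
    simp [coProd, hP0 0 (by omega) rfl, hPr (s + 1) le_rfl rfl]
  · rw [← mul_assoc, (hco i i.2.le).2.1, mul_assoc, hcx _ i.2, mul_assoc]
  · have key : ∀ i : Fin r, ∃ C : ℝ, 0 ≤ C ∧
        (∀ k m, k ≤ m → ‖Ev A m k * (coProd P i k * P (i + 1) k)‖ ≤
          C * Real.exp ((bb (i + 1) + ε) * (τ m - τ k))) ∧
        (∀ m k, m ≤ k → ‖Ev A m k * (coProd P i k * P (i + 1) k)‖ ≤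
          C * Real.exp (-(aa (i + 1) - ε) * (τ k - τ m))) := by
      intro i
      have hi : (i : ℕ) + 1 ≤ r := i.2
      obtain ⟨⟨C₁, hC₁, hb⟩, hc, hd⟩ := hco i i.2.le
      have hu : ∃ x ∈ G (i + 1), x ≤ bb (i + 1) + ε := by
        by_cases h : (i : ℕ) + 1 < r
        · have := hord _ (by omega) h
          refine ⟨min (bb (i + 1) + ε) ((bb (i + 1) + aa (i + 1 + 1)) / 2),
            ⟨fun _ => lt_min (by linarith) (by linarith), fun _ => ?_⟩, min_le_left _ _⟩
          exact (min_le_right _ _).trans_lt (by linarith)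
        · exact ⟨bb (i + 1) + ε, ⟨fun _ => by linarith, fun h' => absurd h' h⟩, le_rfl⟩
      have hl : ∃ x ∈ G i, aa (i + 1) - ε ≤ x := by
        by_cases h : 1 ≤ (i : ℕ)
        · have := hord _ h i.2
          refine ⟨max (aa (i + 1) - ε) ((bb i + aa (i + 1)) / 2),
            ⟨fun _ => ?_, fun _ => max_lt (by linarith) (by linarith)⟩, le_max_left _ _⟩
          exact lt_of_lt_of_le (by linarith) (le_max_right _ _)
        · exact ⟨aa (i + 1) - ε, ⟨fun h' => absurd h' h, fun _ => by linarith⟩, le_rfl⟩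
      obtain ⟨x, hx, hxb⟩ := hu
      obtain ⟨y, hy, hya⟩ := hl
      obtain ⟨N, ν, hN, hν, h1, -⟩ := (hdich _ hi x hx).bound
      obtain ⟨N', ν', hN', hν', h2⟩ := hd y (hdich _ i.2.le y hy)
      obtain ⟨C₂, hC₂, hbd⟩ := (hdich _ hi x hx).norm_le
      refine ⟨C₁ * N + N' * C₂, by positivity, fun k m hkm => ?_, fun m k hmk => ?_⟩
      · have := sub_nonneg.2 (hτm hkm)
        rw [← mul_assoc, hc, mul_assoc]
        calc _ ≤ ‖coProd P i m‖ * ‖Ev A m k * P (i + 1) k‖ := norm_mul_le _ _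
          _ ≤ C₁ * (N * Real.exp ((x - ν) * (τ m - τ k))) := by
            gcongr
            · exact hb m
            · exact h1 k m hkm
          _ ≤ C₁ * (N * Real.exp ((bb (i + 1) + ε) * (τ m - τ k))) := by
            gcongr; linarith
          _ = C₁ * N * Real.exp ((bb (i + 1) + ε) * (τ m - τ k)) := by ring
          _ ≤ _ := by gcongr; exact le_add_of_nonneg_right (by positivity)
      · have := sub_nonneg.2 (hτm hmk)
        rw [← mul_assoc]
        calc _ ≤ ‖Ev A m k * coProd P i k‖ * ‖P (i + 1) k‖ := norm_mul_le _ _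
          _ ≤ (N' * Real.exp (-(y + ν') * (τ k - τ m))) * C₂ := by
            gcongr
            · exact h2 m k hmk
            · exact (hbd k).1
          _ ≤ (N' * Real.exp (-(aa (i + 1) - ε) * (τ k - τ m))) * C₂ := by
            gcongr; linarith
          _ = N' * C₂ * Real.exp (-(aa (i + 1) - ε) * (τ k - τ m)) := by ring
          _ ≤ _ := by gcongr; exact le_add_of_nonneg_left (by positivity)
    choose C hC h1 h2 using key
    have hle : ∀ i, C i ≤ ∑ j, C j := fun i =>
      Finset.single_le_sum (fun j _ => hC j) (Finset.mem_univ i)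
    refine ⟨∑ j, C j, Finset.sum_nonneg fun j _ => hC j, fun i => ⟨fun k m hkm => ?_,
      fun m k hmk => ?_⟩⟩
    · refine (h1 i k m hkm).trans ?_
      gcongr
      exact hle i
    · refine (h2 i m k hmk).trans ?_
      gcongr
      exact hle i

end Splitting

section ExpSums

variable {τ : ℕ → ℝ} {L c : ℝ}

lemma sum_past_le (hc : 0 < c) (k : ℕ) :
    ∑ n ∈ Finset.range k, (τ (n + 1) - τ n) * Real.exp (-c * (τ k - τ n)) ≤ 1 / c := by
  have h1 : ∀ n, (τ (n + 1) - τ n) * Real.exp (-c * (τ k - τ n)) ≤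
      Real.exp (-c * (τ k - τ (n + 1))) / c - Real.exp (-c * (τ k - τ n)) / c := by
    intro n
    have e : Real.exp (-c * (τ k - τ (n + 1))) =
        Real.exp (c * (τ (n + 1) - τ n)) * Real.exp (-c * (τ k - τ n)) := by
      rw [← Real.exp_add]; congr 1; ring
    rw [e, ← sub_div, le_div_iff₀ hc]
    have := Real.add_one_le_exp (c * (τ (n + 1) - τ n))
    nlinarith [Real.exp_pos (-c * (τ k - τ n))]
  refine (Finset.sum_le_sum fun n _ => h1 n).trans ?_
  rw [Finset.sum_range_sub (fun n => Real.exp (-c * (τ k - τ n)) / c)]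
  simp only [sub_self, mul_zero, Real.exp_zero]
  have := Real.exp_pos (-c * (τ k - τ 0))
  have : 0 ≤ Real.exp (-c * (τ k - τ 0)) / c := by positivity
  linarith

lemma sum_future_le (hm : Monotone τ) (hL : ∀ n, τ (n + 1) - τ n ≤ L) (hc : 0 < c) (k m : ℕ) :
    ∑ j ∈ Finset.range m, (τ (k + j + 1) - τ (k + j)) * Real.exp (-c * (τ (k + j) - τ k)) ≤
      Real.exp (c * L) / c := by
  have h1 : ∀ j, (τ (k + j + 1) - τ (k + j)) * Real.exp (-c * (τ (k + j) - τ k)) ≤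
      Real.exp (c * L) / c * Real.exp (-c * (τ (k + j) - τ k)) -
        Real.exp (c * L) / c * Real.exp (-c * (τ (k + (j + 1)) - τ k)) := by
    intro j
    set x := τ (k + j + 1) - τ (k + j) with hx
    have hx0 : 0 ≤ x := sub_nonneg.2 (hm (by omega))
    have e : Real.exp (-c * (τ (k + (j + 1)) - τ k)) =
        Real.exp (-(c * x)) * Real.exp (-c * (τ (k + j) - τ k)) := by
      rw [← Real.exp_add, hx, ← add_assoc]; congr 1; ring
    have h2 : c * x * Real.exp (-(c * x)) ≤ 1 - Real.exp (-(c * x)) := by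
      have := Real.add_one_le_exp (c * x)
      have h3 : Real.exp (c * x) * Real.exp (-(c * x)) = 1 := by rw [← Real.exp_add]; simp
      nlinarith [Real.exp_pos (-(c * x))]
    have h3 : 1 ≤ Real.exp (c * L) * Real.exp (-(c * x)) := by
      rw [← Real.exp_add, ← Real.exp_zero]
      refine Real.exp_le_exp.2 ?_
      nlinarith [hL (k + j)]
    have h4 : c * x ≤ Real.exp (c * L) * (1 - Real.exp (-(c * x))) := by
      have : 0 ≤ c * x := by positivity
      calc c * x ≤ c * x * (Real.exp (c * L) * Real.exp (-(c * x))) := le_mul_of_one_le_right this h3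
        _ = Real.exp (c * L) * (c * x * Real.exp (-(c * x))) := by ring
        _ ≤ _ := by gcongr
    have h5 : x ≤ Real.exp (c * L) / c * (1 - Real.exp (-(c * x))) := by
      rw [div_mul_eq_mul_div, le_div_iff₀ hc]; linarith
    rw [e]
    nlinarith [Real.exp_pos (-c * (τ (k + j) - τ k))]
  refine (Finset.sum_le_sum fun n _ => h1 n).trans ?_
  rw [Finset.sum_range_sub' (fun j => Real.exp (c * L) / c * Real.exp (-c * (τ (k + j) - τ k)))]
  simp only [add_zero, sub_self, mul_zero, Real.exp_zero, mul_one]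
  have : 0 ≤ Real.exp (c * L) / c * Real.exp (-c * (τ (k + m) - τ k)) := by positivity
  linarith

lemma summable_future (hm : Monotone τ) (hL : ∀ n, τ (n + 1) - τ n ≤ L) (hc : 0 < c) (k : ℕ) :
    Summable fun j => (τ (k + j + 1) - τ (k + j)) * Real.exp (-c * (τ (k + j) - τ k)) :=
  summable_of_sum_range_le
    (fun j => mul_nonneg (sub_nonneg.2 (hm (by omega))) (Real.exp_pos _).le)
    (sum_future_le hm hL hc k)

lemma tsum_future_le (hm : Monotone τ) (hL : ∀ n, τ (n + 1) - τ n ≤ L) (hc : 0 < c) (k : ℕ) :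
    ∑' j, (τ (k + j + 1) - τ (k + j)) * Real.exp (-c * (τ (k + j) - τ k)) ≤
      Real.exp (c * L) / c :=
  Real.tsum_le_of_sum_range_le
    (fun j => mul_nonneg (sub_nonneg.2 (hm (by omega))) (Real.exp_pos _).le)
    (sum_future_le hm hL hc k)

end ExpSums

section Homological

variable {A : ℕ → X ≃L[ℝ] X} {τ : ℕ → ℝ} {L : ℝ} {r p : ℕ} {α β : Fin r → ℝ}
  {S : Fin r → ℕ → X →L[ℝ] X}

/-- The `(i, σ)` component of the forcing at time `n`, transported to time `k`. -/
def homTerm (A : ℕ → X ≃L[ℝ] X) (S : Fin r → ℕ → X →L[ℝ] X)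
    (γ : ℕ → ContinuousMultilinearMap ℝ (fun _ : Fin p => X) X) (i : Fin r) (σ : Fin p → Fin r)
    (k n : ℕ) : ContinuousMultilinearMap ℝ (fun _ : Fin p => X) X :=
  (Ev A k (n + 1) * S i (n + 1)).compContinuousMultilinearMap
    ((γ n).compContinuousLinearMap fun s => Ev A n k * S (σ s) k)

lemma homTerm_apply (γ : ℕ → ContinuousMultilinearMap ℝ (fun _ : Fin p => X) X) (i : Fin r)
    (σ : Fin p → Fin r) (k n : ℕ) (v : Fin p → X) : homTerm A S γ i σ k n v =
      Ev A k (n + 1) (S i (n + 1) (γ n fun s => Ev A n k (S (σ s) k (v s)))) := rfl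

lemma IsSplitting.comm_apply (hS : IsSplitting A τ α β S) (i : Fin r) (m k : ℕ) (x : X) :
    Ev A m k (S i k x) = S i m (Ev A m k x) :=
  congrArg (fun f : X →L[ℝ] X => f x) (hS.comm i m k)

lemma homTerm_succ (hS : IsSplitting A τ α β S)
    (γ : ℕ → ContinuousMultilinearMap ℝ (fun _ : Fin p => X) X) (i : Fin r)
    (σ : Fin p → Fin r) (k n : ℕ) (v : Fin p → X) :
    homTerm A S γ i σ (k + 1) n (fun s => A k (v s)) = A k (homTerm A S γ i σ k n v) := by
  simp only [homTerm_apply, Ev_succ_left]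
  congr 3
  funext s
  rw [hS.comm_apply, Ev_succ_right, hS.comm_apply]

lemma homTerm_self (hS : IsSplitting A τ α β S)
    (γ : ℕ → ContinuousMultilinearMap ℝ (fun _ : Fin p => X) X) (i : Fin r)
    (σ : Fin p → Fin r) (k : ℕ) (v : Fin p → X) :
    homTerm A S γ i σ (k + 1) k (fun s => A k (v s)) =
      S i (k + 1) (γ k fun s => S (σ s) k (v s)) := by
  rw [homTerm_succ hS, homTerm_apply, Ev_succ_left]
  simp

lemma sum_homTerm_self (hS : IsSplitting A τ α β S)
    (γ : ℕ → ContinuousMultilinearMap ℝ (fun _ : Fin p => X) X) (k : ℕ) (v : Fin p → X) :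
    ∑ i, ∑ σ, homTerm A S γ i σ (k + 1) k (fun s => A k (v s)) = γ k v := by
  have h1 : ∀ n (x : X), ∑ i, S i n x = x := fun n x => by
    have := congrArg (fun f : X →L[ℝ] X => f x) (hS.sum_eq n)
    simpa using this
  simp only [homTerm_self hS]
  have h2 : γ k v = ∑ σ : Fin p → Fin r, γ k fun s => S (σ s) k (v s) := by
    rw [← (γ k).map_sum (fun s i => S i k (v s))]
    simp only [h1]
  simp_rw [← map_sum, ← h2]
  exact h1 _ _

lemma norm_homTerm_le (γ : ℕ → ContinuousMultilinearMap ℝ (fun _ : Fin p => X) X) (i : Fin r)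
    (σ : Fin p → Fin r) (k n : ℕ) : ‖homTerm A S γ i σ k n‖ ≤
      ‖Ev A k (n + 1) * S i (n + 1)‖ * (‖γ n‖ * ∏ s, ‖Ev A n k * S (σ s) k‖) := by
  refine (ContinuousLinearMap.norm_compContinuousMultilinearMap_le _ _).trans ?_
  gcongr
  exact ContinuousMultilinearMap.norm_compContinuousLinearMap_le _ _

lemma exists_homTerm_sol [CompleteSpace X] (hm : Monotone τ)
    (hL : ∀ n, τ (n + 1) - τ n ≤ L) (hS : IsSplitting A τ α β S) {C : ℝ} (hC : 0 ≤ C)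
    (γ : ℕ → ContinuousMultilinearMap ℝ (fun _ : Fin p => X) X)
    (hγ : ∀ n, ‖γ n‖ ≤ C * (τ (n + 1) - τ n)) (i : Fin r) (σ : Fin p → Fin r)
    (hres : β i < ∑ s, α (σ s) ∨ ∑ s, β (σ s) < α i) :
    ∃ (φ : ℕ → ContinuousMultilinearMap ℝ (fun _ : Fin p => X) X) (C' : ℝ), 0 ≤ C' ∧
      (∀ n, ‖φ n‖ ≤ C') ∧ ∀ k v, φ (k + 1) (fun s => A k (v s)) - A k (φ k v) =
        -homTerm A S γ i σ (k + 1) k (fun s => A k (v s)) := by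
  have hL0 : 0 ≤ L := (sub_nonneg.2 (hm (Nat.le_succ 0))).trans (hL 0)
  have hδ : ∀ n, 0 ≤ τ (n + 1) - τ n := fun n => sub_nonneg.2 (hm (Nat.le_succ n))
  rcases hres with h | h
  · set c := (∑ s, α (σ s) - β i) / 2 with hc
    have hc0 : 0 < c := by rw [hc]; linarith
    set ε := c / (p + 1) with hε
    have hε0 : 0 < ε := by positivity
    have hεc : (p + 1) * ε = c := by rw [hε]; field_simp
    obtain ⟨D, hD, hb⟩ := hS.bound ε hε0
    have hterm : ∀ k n, n < k → ‖homTerm A S γ i σ k n‖ ≤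
        D * Real.exp (|β i + ε| * L) * C * D ^ p *
          ((τ (n + 1) - τ n) * Real.exp (-c * (τ k - τ n))) := by
      intro k n hnk
      have h1 : ‖Ev A k (n + 1) * S i (n + 1)‖ ≤
          D * (Real.exp (|β i + ε| * L) * Real.exp ((β i + ε) * (τ k - τ n))) := by
        refine ((hb i).1 _ _ hnk).trans ?_
        rw [← Real.exp_add]
        gcongr
        have : -(β i + ε) * (τ (n + 1) - τ n) ≤ |β i + ε| * L := by
          calc _ ≤ |β i + ε| * (τ (n + 1) - τ n) := by
                gcongr
                · exact hδ n
                · exact neg_le_abs _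
            _ ≤ _ := by gcongr; exact hL n
        linarith
      have h2 : ∏ s, ‖Ev A n k * S (σ s) k‖ ≤
          D ^ p * Real.exp (-(∑ s, α (σ s) - p * ε) * (τ k - τ n)) := by
        calc _ ≤ ∏ s : Fin p, D * Real.exp (-(α (σ s) - ε) * (τ k - τ n)) :=
              Finset.prod_le_prod (fun _ _ => norm_nonneg _) fun s _ => (hb (σ s)).2 _ _ hnk.le
          _ = _ := by
            rw [Finset.prod_mul_distrib, ← Real.exp_sum, ← Finset.sum_mul, Finset.sum_neg_distrib,
              Finset.sum_sub_distrib]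
            simp
      calc _ ≤ _ := norm_homTerm_le γ i σ k n
        _ ≤ (D * (Real.exp (|β i + ε| * L) * Real.exp ((β i + ε) * (τ k - τ n)))) *
            ((C * (τ (n + 1) - τ n)) * (D ^ p * Real.exp (-(∑ s, α (σ s) - p * ε) * (τ k - τ n)))) := by
          gcongr
          · exact mul_nonneg hC (hδ n)
          · exact hγ n
        _ = D * Real.exp (|β i + ε| * L) * C * D ^ p * ((τ (n + 1) - τ n) *
            (Real.exp ((β i + ε) * (τ k - τ n)) *
              Real.exp (-(∑ s, α (σ s) - p * ε) * (τ k - τ n)))) := by ring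
        _ = _ := by
          rw [← Real.exp_add]
          congr 3
          have : ∑ s, α (σ s) = 2 * c + β i := by rw [hc]; ring
          rw [this]
          linear_combination (τ k - τ n) * hεc
    refine ⟨fun k => -∑ n ∈ Finset.range k, homTerm A S γ i σ k n,
      D * Real.exp (|β i + ε| * L) * C * D ^ p * (1 / c), by positivity, fun k => ?_,
      fun k v => ?_⟩
    · rw [norm_neg]
      refine (norm_sum_le _ _).trans ?_
      refine (Finset.sum_le_sum fun n hn => hterm k n (Finset.mem_range.1 hn)).trans ?_
      rw [← Finset.mul_sum]
      gcongr
      exact sum_past_le hc0 k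
    · simp only [neg_apply, sum_apply, map_neg,
        map_sum, ← homTerm_succ hS]
      rw [Finset.sum_range_succ]
      abel
  · set c := (α i - ∑ s, β (σ s)) / 2 with hc
    have hc0 : 0 < c := by rw [hc]; linarith
    set ε := c / (p + 1) with hε
    have hε0 : 0 < ε := by positivity
    have hεc : (p + 1) * ε = c := by rw [hε]; field_simp
    obtain ⟨D, hD, hb⟩ := hS.bound ε hε0
    have hterm : ∀ k n, k ≤ n → ‖homTerm A S γ i σ k n‖ ≤
        D * Real.exp (|α i - ε| * L) * C * D ^ p *
          ((τ (n + 1) - τ n) * Real.exp (-c * (τ n - τ k))) := by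
      intro k n hnk
      have h1 : ‖Ev A k (n + 1) * S i (n + 1)‖ ≤
          D * (Real.exp (|α i - ε| * L) * Real.exp (-(α i - ε) * (τ n - τ k))) := by
        refine ((hb i).2 _ _ (by omega)).trans ?_
        rw [← Real.exp_add]
        gcongr
        have : -(α i - ε) * (τ (n + 1) - τ n) ≤ |α i - ε| * L := by
          calc _ ≤ |α i - ε| * (τ (n + 1) - τ n) := by
                gcongr
                · exact hδ n
                · exact neg_le_abs _
            _ ≤ _ := by gcongr; exact hL n
        linarith
      have h2 : ∏ s, ‖Ev A n k * S (σ s) k‖ ≤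
          D ^ p * Real.exp ((∑ s, β (σ s) + p * ε) * (τ n - τ k)) := by
        calc _ ≤ ∏ s : Fin p, D * Real.exp ((β (σ s) + ε) * (τ n - τ k)) :=
              Finset.prod_le_prod (fun _ _ => norm_nonneg _) fun s _ => (hb (σ s)).1 _ _ hnk
          _ = _ := by
            rw [Finset.prod_mul_distrib, ← Real.exp_sum, ← Finset.sum_mul, Finset.sum_add_distrib]
            simp
      calc _ ≤ _ := norm_homTerm_le γ i σ k n
        _ ≤ (D * (Real.exp (|α i - ε| * L) * Real.exp (-(α i - ε) * (τ n - τ k)))) *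
            ((C * (τ (n + 1) - τ n)) * (D ^ p * Real.exp ((∑ s, β (σ s) + p * ε) * (τ n - τ k)))) := by
          gcongr
          · exact mul_nonneg hC (hδ n)
          · exact hγ n
        _ = D * Real.exp (|α i - ε| * L) * C * D ^ p * ((τ (n + 1) - τ n) *
            (Real.exp (-(α i - ε) * (τ n - τ k)) *
              Real.exp ((∑ s, β (σ s) + p * ε) * (τ n - τ k)))) := by ring
        _ = _ := by
          rw [← Real.exp_add]
          congr 3
          have : ∑ s, β (σ s) = α i - 2 * c := by rw [hc]; ring
          rw [this]
          linear_combination (τ n - τ k) * hεc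
    have hsum : ∀ k, Summable fun j => homTerm A S γ i σ k (k + j) := fun k =>
      Summable.of_norm_bounded ((summable_future hm hL hc0 k).mul_left _)
        fun j => hterm k (k + j) (by omega)
    refine ⟨fun k => ∑' j, homTerm A S γ i σ k (k + j),
      D * Real.exp (|α i - ε| * L) * C * D ^ p * (Real.exp (c * L) / c), by positivity,
      fun k => ?_, fun k v => ?_⟩
    · refine (tsum_of_norm_bounded ((summable_future hm hL hc0 k).mul_left _).hasSum
        fun j => hterm k (k + j) (by omega)).trans ?_
      rw [tsum_mul_left]
      gcongr
      exact tsum_future_le hm hL hc0 k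
    · have h1 : HasSum (fun j => homTerm A S γ i σ (k + 1) (k + 1 + j) fun s => A k (v s))
          ((∑' j, homTerm A S γ i σ (k + 1) (k + 1 + j)) fun s => A k (v s)) :=
        (hsum (k + 1)).hasSum.mapL (ContinuousMultilinearMap.apply ℝ _ X fun s => A k (v s))
      have h2 : HasSum (fun j => A k (homTerm A S γ i σ k (k + j) v))
          (A k ((∑' j, homTerm A S γ i σ k (k + j)) v)) :=
        ((hsum k).hasSum.mapL (ContinuousMultilinearMap.apply ℝ _ X v)).mapL
          (A k : X →L[ℝ] X)
      simp only [← homTerm_succ hS] at h2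
      have h3 := (hasSum_nat_add_iff' 1).2 h2
      simp only [Finset.sum_range_one, add_zero] at h3
      have h4 : HasSum (fun j => homTerm A S γ i σ (k + 1) (k + 1 + j) fun s => A k (v s))
          (A k ((∑' j, homTerm A S γ i σ k (k + j)) v) -
            homTerm A S γ i σ (k + 1) k fun s => A k (v s)) := by
        convert h3 using 4 with j
        omega
      rw [h1.unique h4]
      abel

/-- Solvability of the homological equation under the non-resonance condition. -/
lemma exists_homological_sol [CompleteSpace X] (hm : Monotone τ)
    (hL : ∀ n, τ (n + 1) - τ n ≤ L) (hS : IsSplitting A τ α β S) {C : ℝ} (hC : 0 ≤ C)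
    (γ : ℕ → ContinuousMultilinearMap ℝ (fun _ : Fin p => X) X)
    (hγ : ∀ n, ‖γ n‖ ≤ C * (τ (n + 1) - τ n))
    (hres : ∀ (i : Fin r) (σ : Fin p → Fin r), β i < ∑ s, α (σ s) ∨ ∑ s, β (σ s) < α i) :
    ∃ (φ : ℕ → ContinuousMultilinearMap ℝ (fun _ : Fin p => X) X) (C' : ℝ), 0 ≤ C' ∧
      (∀ n, ‖φ n‖ ≤ C') ∧
      ∀ k v, φ (k + 1) (fun s => A k (v s)) - A k (φ k v) = -γ k v := by
  choose φ C' hC' hφ hsol using fun (i : Fin r) (σ : Fin p → Fin r) =>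
    exists_homTerm_sol hm hL hS hC γ hγ i σ (hres i σ)
  refine ⟨fun n => ∑ i, ∑ σ, φ i σ n, ∑ i, ∑ σ, C' i σ,
    Finset.sum_nonneg fun i _ => Finset.sum_nonneg fun σ _ => hC' i σ, fun n => ?_, fun k v => ?_⟩
  · exact norm_sum_le_of_le _ fun i _ => norm_sum_le_of_le _ fun σ _ => hφ i σ n
  · simp only [sum_apply, map_sum, ← Finset.sum_sub_distrib, hsol,
      Finset.sum_neg_distrib, sum_homTerm_self hS]

end Homological

section Flat

variable {E F G : Type*} [NormedAddCommGroup E] [NormedSpace ℝ E] [NormedAddCommGroup F]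
  [NormedSpace ℝ F] [NormedAddCommGroup G] [NormedSpace ℝ G]

/-- Iterated derivatives of `C^n` functions are symmetric. -/
lemma iteratedFDeriv_comp_perm {f : E → F} {n : ℕ} (hf : ContDiff ℝ n f)
    (σ : Equiv.Perm (Fin n)) (x : E) (v : Fin n → E) :
    iteratedFDeriv ℝ n f x (v ∘ σ) = iteratedFDeriv ℝ n f x v := by
  induction n generalizing x with
  | zero => congr 1; exact Subsingleton.elim _ _
  | succ n ih =>
    have hmem : σ ∈ Submonoid.closure
        (Set.range fun i : Fin n => Equiv.swap i.castSucc i.succ) := by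
      rw [Equiv.Perm.mclosure_swap_castSucc_succ]; trivial
    induction hmem using Submonoid.closure_induction generalizing v with
    | one => rfl
    | mul σ₁ σ₂ _ _ h1 h2 =>
      rw [Equiv.Perm.coe_mul, ← Function.comp_assoc, h2, h1]
    | mem σ hσ =>
      obtain ⟨i, rfl⟩ := hσ
      have hd : Differentiable ℝ (iteratedFDeriv ℝ n f) :=
        hf.differentiable_iteratedFDeriv (by exact_mod_cast Nat.lt_succ_self n)
      obtain ⟨m, rfl⟩ : ∃ m, n = m + 1 := ⟨n - 1, by have := i.pos; omega⟩
      rcases Fin.eq_zero_or_eq_succ i with rfl | ⟨j, rfl⟩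
      · have hC : ContDiff ℝ 2 (iteratedFDeriv ℝ m f) :=
          hf.iteratedFDeriv_right (m := 2) (by norm_cast; omega)
        have hd2 : Differentiable ℝ (fderiv ℝ (iteratedFDeriv ℝ m f)) :=
          (hC.fderiv_right (m := 1) le_rfl).differentiable one_ne_zero
        have key : ∀ w : Fin (m + 1 + 1) → E, iteratedFDeriv ℝ (m + 1 + 1) f x w =
            fderiv ℝ (fderiv ℝ (iteratedFDeriv ℝ m f)) x (w 0) (w 1) (Fin.tail (Fin.tail w)) := by
          intro w
          rw [iteratedFDeriv_succ_apply_left]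
          have e1 : fderiv ℝ (iteratedFDeriv ℝ (m + 1) f) x (w 0) (Fin.tail w) =
              fderiv ℝ (fun y => iteratedFDeriv ℝ (m + 1) f y (Fin.tail w)) x (w 0) := by
            have := ((ContinuousMultilinearMap.apply ℝ (fun _ : Fin (m + 1) => E) F
              (Fin.tail w)).hasFDerivAt.comp x (hd x).hasFDerivAt).fderiv
            simp only [Function.comp_def, ContinuousMultilinearMap.apply_apply] at this
            rw [this]; rfl
          have e2 : fderiv ℝ (fun y => fderiv ℝ (iteratedFDeriv ℝ m f) y (w 1)
              (Fin.tail (Fin.tail w))) x (w 0) =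
              fderiv ℝ (fderiv ℝ (iteratedFDeriv ℝ m f)) x (w 0) (w 1)
                (Fin.tail (Fin.tail w)) := by
            have h1 := (hd2 x).hasFDerivAt.clm_apply (hasFDerivAt_const (w 1) x)
            have := ((ContinuousMultilinearMap.apply ℝ (fun _ : Fin m => E) F
              (Fin.tail (Fin.tail w))).hasFDerivAt.comp x h1).fderiv
            simp only [Function.comp_def, ContinuousMultilinearMap.apply_apply] at this
            rw [this]
            simp
          rw [e1, ← e2]; rfl
        rw [key, key, ((hC.contDiffAt (x := x)).isSymmSndFDerivAt (by simp)).eq (v 0) (v 1)]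
        have t : Fin.tail (Fin.tail (v ∘ Equiv.swap (Fin.castSucc 0) (Fin.succ 0))) =
            Fin.tail (Fin.tail v) := by
          funext s
          simp only [Fin.tail, Function.comp_apply]
          rw [Equiv.swap_apply_of_ne_of_ne]
          · simp [Fin.ext_iff]
          · simp [Fin.ext_iff]
        rw [t]
        simp
      · have hs : ∀ y (w : Fin (m + 1) → E), iteratedFDeriv ℝ (m + 1) f y
            (w ∘ Equiv.swap j.castSucc j.succ) = iteratedFDeriv ℝ (m + 1) f y w := fun y w =>
          ih (hf.of_le (by norm_cast; omega)) _ y w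
        have e : ∀ w : Fin (m + 1) → E, ∀ u, fderiv ℝ (iteratedFDeriv ℝ (m + 1) f) x u w =
              fderiv ℝ (fun y => iteratedFDeriv ℝ (m + 1) f y w) x u := by
          intro w u
          have := ((ContinuousMultilinearMap.apply ℝ (fun _ : Fin (m + 1) => E) F
              w).hasFDerivAt.comp x (hd x).hasFDerivAt).fderiv
          simp only [Function.comp_def, ContinuousMultilinearMap.apply_apply] at this
          rw [this]; rfl
        rw [iteratedFDeriv_succ_apply_left, iteratedFDeriv_succ_apply_left]
        have t : Fin.tail (v ∘ Equiv.swap j.succ.castSucc j.succ.succ) =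
            Fin.tail v ∘ Equiv.swap j.castSucc j.succ := by
          funext s
          simp only [Fin.tail, Function.comp_apply]
          congr 1
          rw [← Fin.succ_castSucc]
          exact ((Fin.succ_injective _).swap_apply _ _ _)
        have t0 : (v ∘ Equiv.swap j.succ.castSucc j.succ.succ) 0 = v 0 := by
          simp only [Function.comp_apply]
          rw [Equiv.swap_apply_of_ne_of_ne]
          · simp [Fin.ext_iff]
          · simp [Fin.ext_iff]
        rw [t, t0, e, e]
        simp only [hs]

/-- `C^n` functions vanishing to order `p` at the origin, with quantitative bounds on the unit
ball. -/
structure IsFlat (n p : ℕ) (C : ℝ) (f : E → F) : Prop where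
  nonneg : 0 ≤ C
  contDiff : ContDiff ℝ n f
  bound : ∀ i ≤ n, ∀ x, ‖x‖ ≤ 1 → ‖iteratedFDeriv ℝ i f x‖ ≤ C * ‖x‖ ^ (p - i)

namespace IsFlat

variable {n p q : ℕ} {C D : ℝ} {f g : E → F}

lemma contDiff_of_le (h : IsFlat n p C f) {i : ℕ} (hi : i ≤ n) : ContDiff ℝ i f :=
  h.contDiff.of_le (by exact_mod_cast hi)

lemma bound_one (h : IsFlat n p C f) {i : ℕ} (hi : i ≤ n) {x : E} (hx : ‖x‖ ≤ 1) :
    ‖iteratedFDeriv ℝ i f x‖ ≤ C :=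
  (h.bound i hi x hx).trans (mul_le_of_le_one_right h.nonneg (pow_le_one₀ (norm_nonneg _) hx))

lemma eq_zero (h : IsFlat n p C f) {i : ℕ} (hi : i ≤ n) (hip : i < p) :
    iteratedFDeriv ℝ i f 0 = 0 := by
  have := h.bound i hi 0 (by simp)
  rw [norm_zero, zero_pow (by omega), mul_zero] at this
  exact norm_le_zero_iff.1 this

lemma mono (h : IsFlat n p C f) (hCD : C ≤ D) : IsFlat n p D f :=
  ⟨h.nonneg.trans hCD, h.contDiff, fun i hi x hx => (h.bound i hi x hx).trans (by gcongr)⟩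

lemma add (hf : IsFlat n p C f) (hg : IsFlat n p D g) :
    IsFlat n p (C + D) fun x => f x + g x := by
  refine ⟨add_nonneg hf.nonneg hg.nonneg, hf.contDiff.add hg.contDiff, fun i hi x hx => ?_⟩
  rw [fun_iteratedFDeriv_add_apply (hf.contDiff_of_le hi).contDiffAt
    (hg.contDiff_of_le hi).contDiffAt, add_mul]
  exact (norm_add_le _ _).trans (add_le_add (hf.bound i hi x hx) (hg.bound i hi x hx))

lemma sub (hf : IsFlat n p C f) (hg : IsFlat n p D g) :
    IsFlat n p (C + D) fun x => f x - g x := by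
  refine ⟨add_nonneg hf.nonneg hg.nonneg, hf.contDiff.sub hg.contDiff, fun i hi x hx => ?_⟩
  rw [fun_iteratedFDeriv_sub_apply (hf.contDiff_of_le hi).contDiffAt
    (hg.contDiff_of_le hi).contDiffAt, add_mul]
  exact (norm_sub_le _ _).trans (add_le_add (hf.bound i hi x hx) (hg.bound i hi x hx))

lemma clm_comp (L : F →L[ℝ] G) (hf : IsFlat n p C f) : IsFlat n p (‖L‖ * C) fun x => L (f x) := by
  refine ⟨mul_nonneg (norm_nonneg _) hf.nonneg, L.contDiff.comp hf.contDiff, fun i hi x hx => ?_⟩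
  refine (L.norm_iteratedFDeriv_comp_left hf.contDiff.contDiffAt
    (by exact_mod_cast hi)).trans ?_
  rw [mul_assoc]
  gcongr
  exact hf.bound i hi x hx

lemma bilinear {g : E → G} {H : Type*} [NormedAddCommGroup H] [NormedSpace ℝ H]
    (B : F →L[ℝ] G →L[ℝ] H) (hB : ‖B‖ ≤ 1) (hf : IsFlat n p C f) (hg : IsFlat n q D g) :
    IsFlat n (p + q) (2 ^ n * C * D) fun x => B (f x) (g x) := by
  have hC := hf.nonneg
  have hD := hg.nonneg
  refine ⟨by positivity, (B.contDiff.comp hf.contDiff).clm_apply hg.contDiff, fun i hi x hx => ?_⟩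
  refine (B.norm_iteratedFDeriv_le_of_bilinear hf.contDiff hg.contDiff x
    (by exact_mod_cast hi)).trans ?_
  have hterm : ∀ j ∈ Finset.range (i + 1), (i.choose j : ℝ) * ‖iteratedFDeriv ℝ j f x‖ *
      ‖iteratedFDeriv ℝ (i - j) g x‖ ≤ i.choose j * (C * D * ‖x‖ ^ (p + q - i)) := by
    intro j hj
    have hj' : j ≤ i := Nat.lt_succ_iff.1 (Finset.mem_range.1 hj)
    calc _ ≤ (i.choose j : ℝ) * (C * ‖x‖ ^ (p - j)) * (D * ‖x‖ ^ (q - (i - j))) := by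
          gcongr
          · exact hf.bound j (by omega) x hx
          · exact hg.bound _ (by omega) x hx
      _ = i.choose j * (C * D * ‖x‖ ^ (p - j + (q - (i - j)))) := by rw [pow_add]; ring
      _ ≤ _ := by
        have hpow : ‖x‖ ^ (p - j + (q - (i - j))) ≤ ‖x‖ ^ (p + q - i) :=
          pow_le_pow_of_le_one (norm_nonneg _) hx (by omega)
        exact mul_le_mul_of_nonneg_left
          (mul_le_mul_of_nonneg_left hpow (by positivity)) (by positivity)
  calc _ ≤ 1 * ∑ j ∈ Finset.range (i + 1), (i.choose j : ℝ) * (C * D * ‖x‖ ^ (p + q - i)) := by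
        gcongr ?_ * ?_
        exact Finset.sum_le_sum hterm
    _ = 2 ^ i * (C * D * ‖x‖ ^ (p + q - i)) := by
        rw [one_mul, ← Finset.sum_mul]
        congr 1
        exact_mod_cast Nat.sum_range_choose i
    _ ≤ 2 ^ n * (C * D * ‖x‖ ^ (p + q - i)) := by
        gcongr
        exact one_le_two
    _ = _ := by ring

lemma of_iteratedFDeriv_zero (hC : 0 ≤ C) (hf : ContDiff ℝ n f) (hpn : p ≤ n)
    (h : ∀ i ≤ n, ∀ x, ‖x‖ ≤ 1 → ‖iteratedFDeriv ℝ i f x‖ ≤ C)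
    (h0 : ∀ i < p, iteratedFDeriv ℝ i f 0 = 0) : IsFlat n p C f := by
  refine ⟨hC, hf, ?_⟩
  have key : ∀ j ≤ p, ∀ x, ‖x‖ ≤ 1 → ‖iteratedFDeriv ℝ (p - j) f x‖ ≤ C * ‖x‖ ^ j := by
    intro j
    induction j with
    | zero => intro _ x hx; simpa using h p hpn x hx
    | succ j ih =>
      intro hj x hx
      have hd : Differentiable ℝ (iteratedFDeriv ℝ (p - (j + 1)) f) :=
        hf.differentiable_iteratedFDeriv (by norm_cast; omega)
      have hmv := (convex_closedBall (0 : E) ‖x‖).norm_image_sub_le_of_norm_fderiv_le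
        (f := iteratedFDeriv ℝ (p - (j + 1)) f) (C := C * ‖x‖ ^ j) (x := 0) (y := x)
        (fun y _ => hd y) (fun y hy => ?_) (by simp) (by simp)
      · rw [h0 _ (by omega), sub_zero, sub_zero] at hmv
        rw [pow_succ]
        linarith
      · have hy' : ‖y‖ ≤ ‖x‖ := by simpa using hy
        rw [norm_fderiv_iteratedFDeriv, show p - (j + 1) + 1 = p - j by omega]
        refine (ih (by omega) y (hy'.trans hx)).trans ?_
        gcongr
  intro i hi x hx
  by_cases hip : i ≤ p
  · have := key (p - i) (by omega) x hx
    rwa [show p - (p - i) = i by omega] at this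
  · rw [show p - i = 0 by omega]
    simpa using h i hi x hx

lemma const (n : ℕ) (c : F) : IsFlat n 0 ‖c‖ fun _ : E => c := by
  refine ⟨norm_nonneg _, contDiff_const, fun i _ x _ => ?_⟩
  rcases Nat.eq_zero_or_pos i with rfl | hi
  · simp
  · rw [iteratedFDeriv_const_of_ne hi.ne']; simp

lemma clm (n : ℕ) (L : E →L[ℝ] F) : IsFlat n 1 ‖L‖ fun x => L x := by
  refine ⟨norm_nonneg _, L.contDiff, fun i _ x _ => ?_⟩
  match i with
  | 0 => simpa using L.le_opNorm x
  | i + 1 =>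
    rw [← norm_iteratedFDeriv_fderiv]
    have e : fderiv ℝ (fun x => L x) = fun _ => L := funext fun y => L.fderiv
    rw [e]
    rcases Nat.eq_zero_or_pos i with rfl | hi
    · simp
    · rw [iteratedFDeriv_const_of_ne hi.ne']; simp

section Multilinear

set_option maxSynthPendingDepth 3 in
lemma curry {m : ℕ} {φ : E → ContinuousMultilinearMap ℝ (fun _ : Fin (m + 1) => G) F}
    {g : E → G} (hφ : IsFlat n p C φ) (hg : IsFlat n q D g) :
    IsFlat n (p + q) (2 ^ n * C * D) fun x => (φ x).curryLeft (g x) := by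
  have hL : ‖(continuousMultilinearCurryLeftEquiv ℝ (fun _ : Fin (m + 1) => G)
      F).toLinearIsometry.toContinuousLinearMap‖ ≤ 1 :=
    (continuousMultilinearCurryLeftEquiv ℝ (fun _ : Fin (m + 1) => G)
      F).toLinearIsometry.norm_toContinuousLinearMap_le
  exact bilinear _ hL hφ hg

lemma curryLeft_apply_const {m : ℕ} (φ : ContinuousMultilinearMap ℝ (fun _ : Fin (m + 1) => G) F)
    (y : G) : φ (fun _ => y) = φ.curryLeft y fun _ => y := by
  rw [ContinuousMultilinearMap.curryLeft_apply]
  congr 1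
  funext s
  refine Fin.cases ?_ (fun _ => ?_) s <;> rfl

lemma multilinear {m : ℕ} {φ : E → ContinuousMultilinearMap ℝ (fun _ : Fin m => G) F}
    {g : E → G} (hφ : IsFlat n p C φ) (hg : IsFlat n q D g) :
    IsFlat n (p + m * q) ((2 ^ n) ^ m * C * D ^ m) fun x => φ x fun _ => g x := by
  induction m generalizing p C with
  | zero =>
    have h := hφ.clm_comp (ContinuousMultilinearMap.apply ℝ (fun _ : Fin 0 => G) F 0)
    have h1 : ‖ContinuousMultilinearMap.apply ℝ (fun _ : Fin 0 => G) F 0‖ ≤ 1 :=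
      ContinuousLinearMap.opNorm_le_bound _ zero_le_one fun ψ => by
        simp
    have h2 := h.mono (mul_le_of_le_one_left hφ.nonneg h1)
    simp only [Nat.zero_mul, add_zero, pow_zero, one_mul, mul_one]
    convert h2 using 2 with x
    exact congrArg (φ x) (Subsingleton.elim _ _)
  | succ m ih =>
    have h := ih (hφ.curry hg)
    simp only [← curryLeft_apply_const] at h
    convert h using 1
    · ring
    · ring

lemma multilinear_sub {m : ℕ} {φ : E → ContinuousMultilinearMap ℝ (fun _ : Fin m => G) F}
    {g h : E → G} {D' : ℝ} (hφ : IsFlat n p C φ) (hg : IsFlat n 1 D g) (hh : IsFlat n 1 D h)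
    (hgh : IsFlat n 2 D' fun x => g x - h x) :
    IsFlat n (p + m + 1) (m * (2 ^ n) ^ m * C * D ^ (m - 1) * D')
      fun x => (φ x fun _ => g x) - φ x fun _ => h x := by
  induction m generalizing p C with
  | zero =>
    have : (fun x => (φ x fun _ => g x) - φ x fun _ => h x) = fun _ : E => (0 : F) := by
      funext x
      rw [sub_eq_zero]
      congr 1
      exact Subsingleton.elim _ _
    rw [this]
    refine ⟨by simp, contDiff_const, fun i hi x hx => ?_⟩
    rw [show (fun _ : E => (0 : F)) = 0 from rfl, iteratedFDeriv_zero]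
    simp
  | succ m ih =>
    have h1 := (hφ.curry hgh).multilinear hg
    have h2 := ih (hφ.curry hh)
    have e : (fun x => (φ x fun _ => g x) - φ x fun _ => h x) = fun x =>
        ((φ x).curryLeft (g x - h x) fun _ => g x) +
          (((φ x).curryLeft (h x) fun _ => g x) - (φ x).curryLeft (h x) fun _ => h x) := by
      funext x
      rw [curryLeft_apply_const, curryLeft_apply_const, map_sub]
      simp
    rw [e]
    rw [show p + 2 + m * 1 = p + 1 + m + 1 by ring] at h1
    have h3 := h1.add h2
    rw [show p + (m + 1) + 1 = p + 1 + m + 1 by ring]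
    refine h3.mono (le_of_eq ?_)
    rcases m with _ | m
    · simp
    · simp only [Nat.add_sub_cancel]
      push_cast
      ring

end Multilinear

lemma norm_taylorCoeff_le (h : IsFlat n p C f) (hp : p ≤ n) :
    ‖((p.factorial : ℝ)⁻¹) • iteratedFDeriv ℝ p f 0‖ ≤ C := by
  rw [norm_smul, norm_inv, Real.norm_natCast]
  have h1 := h.bound_one hp (x := 0) (by simp)
  have h2 : (1 : ℝ) ≤ p.factorial := by exact_mod_cast Nat.one_le_iff_ne_zero.2 p.factorial_ne_zero
  exact (mul_le_of_le_one_left (norm_nonneg _) (inv_le_one_of_one_le₀ h2)).trans h1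

lemma sub_taylor (h : IsFlat n p C f) (hp : p + 1 ≤ n) :
    IsFlat n (p + 1) (C + (2 ^ n) ^ p * C)
      fun x => f x - (((p.factorial : ℝ)⁻¹) • iteratedFDeriv ℝ p f 0) fun _ => x := by
  set γ := ((p.factorial : ℝ)⁻¹) • iteratedFDeriv ℝ p f 0 with hγ
  have hγn : ‖γ‖ ≤ C := h.norm_taylorCoeff_le (by omega)
  have hid : IsFlat n 1 1 fun x : E => x :=
    (clm n (ContinuousLinearMap.id ℝ E)).mono ContinuousLinearMap.norm_id_le
  have h1 := ((const (E := E) n γ).mono hγn).multilinear hid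
  simp only [zero_add, mul_one, one_pow] at h1
  have h2 := h.sub h1
  refine of_iteratedFDeriv_zero h2.nonneg h2.contDiff hp (fun i hi x hx => h2.bound_one hi hx) ?_
  intro i hi
  rcases Nat.lt_succ_iff_lt_or_eq.1 hi with hi | rfl
  · exact h2.eq_zero (by omega) hi
  · have hi' : i ≤ n := by omega
    rw [fun_iteratedFDeriv_sub_apply (h.contDiff_of_le hi').contDiffAt
      (h1.contDiff_of_le hi').contDiffAt, sub_eq_zero]
    ext v
    rw [ContinuousMultilinearMap.iteratedFDeriv_comp_diagonal, hγ]
    have : ∀ σ : Equiv.Perm (Fin i), iteratedFDeriv ℝ i f 0 (fun s => v (σ s)) =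
        iteratedFDeriv ℝ i f 0 v := fun σ =>
      iteratedFDeriv_comp_perm (h.contDiff_of_le hi') σ 0 v
    simp only [smul_apply, this, Finset.sum_const, Finset.card_univ,
      Fintype.card_perm, Fintype.card_fin]
    rw [← Nat.cast_smul_eq_nsmul ℝ, smul_smul, mul_inv_cancel₀, one_smul]
    exact_mod_cast i.factorial_ne_zero

end IsFlat

end Flat

lemma IsFlat.of_order_le {E F : Type*} [NormedAddCommGroup E] [NormedSpace ℝ E]
    [NormedAddCommGroup F] [NormedSpace ℝ F] {n p q : ℕ} {C : ℝ} {f : E → F}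
    (h : IsFlat n p C f) (hqp : q ≤ p) : IsFlat n q C f :=
  ⟨h.nonneg, h.contDiff, fun i hi x hx => (h.bound i hi x hx).trans <|
    mul_le_mul_of_nonneg_left (pow_le_pow_of_le_one (norm_nonneg _) hx (by omega)) h.nonneg⟩

section NormalForm

variable [CompleteSpace X] {A : ℕ → X ≃L[ℝ] X} {τ : ℕ → ℝ} {L : ℝ} {r : ℕ} {α β : Fin r → ℝ}
  {S : Fin r → ℕ → X →L[ℝ] X}

/-- Removal of all terms of order at most `t` by a near-identity change of variables. -/
lemma exists_normalForm (hm : Monotone τ) (hL : ∀ n, τ (n + 1) - τ n ≤ L)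
    (hS : IsSplitting A τ α β S) {N : ℕ} {C DA : ℝ} (hC : 0 ≤ C)
    (hA : ∀ n, ‖(A n : X →L[ℝ] X)‖ ≤ DA) (g : ℕ → X → X)
    (hg : ∀ n, IsFlat N 2 (C * (τ (n + 1) - τ n)) (g n)) (t : ℕ) (htN : t + 1 ≤ N)
    (hres : ∀ p, 2 ≤ p → p ≤ t → ∀ (i : Fin r) (σ : Fin p → Fin r),
      β i < ∑ s, α (σ s) ∨ ∑ s, β (σ s) < α i) (ht : 1 ≤ t) :
    ∃ (H : ℕ → X → X) (C₁ C₂ : ℝ), 0 ≤ C₂ ∧ (∀ n, IsFlat N 2 C₁ fun x => H n x - x) ∧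
      ∀ n, IsFlat N (t + 1) (C₂ * (τ (n + 1) - τ n))
        fun x => H (n + 1) (A n x + g n x) - A n (H n x) := by
  have hδ : ∀ n, 0 ≤ τ (n + 1) - τ n := fun n => sub_nonneg.2 (hm n.le_succ)
  have hDA : 0 ≤ DA := (norm_nonneg _).trans (hA 0)
  have hL0 : 0 ≤ L := (hδ 0).trans (hL 0)
  have hAf : ∀ n, IsFlat N 1 (DA + C * L) fun x => A n x := fun n =>
    (IsFlat.clm N (A n : X →L[ℝ] X)).mono ((hA n).trans (by nlinarith [mul_nonneg hC hL0]))
  have hU : ∀ n, IsFlat N 1 (DA + C * L) fun x => A n x + g n x := fun n =>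
    ((IsFlat.clm N (A n : X →L[ℝ] X)).add ((hg n).of_order_le one_le_two)).mono
      (add_le_add (hA n) (mul_le_mul_of_nonneg_left (hL n) hC))
  induction t, ht using Nat.le_induction with
  | base =>
    refine ⟨fun _ x => x, 0, C, hC, fun n => ⟨le_rfl, ?_, ?_⟩, fun n => ?_⟩
    · simpa using contDiff_const
    · intro i _ x _
      simp only [sub_self]
      rw [show (fun _ : X => (0 : X)) = 0 from rfl, iteratedFDeriv_zero]
      simp
    · simpa using hg n
  | succ p hp ih =>
    obtain ⟨H, C₁, C₂, hC₂, hH, hR⟩ := ih (by omega) fun q hq hqp => hres q hq (by omega)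
    set R : ℕ → X → X := fun n x => H (n + 1) (A n x + g n x) - A n (H n x) with hRdef
    let γ : ℕ → ContinuousMultilinearMap ℝ (fun _ : Fin (p + 1) => X) X := fun n =>
      (((p + 1).factorial : ℝ)⁻¹) • iteratedFDeriv ℝ (p + 1) (R n) 0
    obtain ⟨φ, C', hC', hφ, hsol⟩ := exists_homological_sol hm hL hS hC₂ γ
      (fun n => (hR n).norm_taylorCoeff_le (by omega)) (hres (p + 1) (by omega) le_rfl)
    have hφc : ∀ n, IsFlat (E := X) N 0 C' fun _ => φ n := fun n => (IsFlat.const N _).mono (hφ n)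
    have hid : IsFlat N 1 1 fun x : X => x :=
      (IsFlat.clm N (ContinuousLinearMap.id ℝ X)).mono ContinuousLinearMap.norm_id_le
    refine ⟨fun n x => H n x + φ n fun _ => x, C₁ + (2 ^ N) ^ (p + 1) * C' * 1 ^ (p + 1),
      C₂ + (2 ^ N) ^ (p + 1) * C₂ +
        ((p + 1 : ℕ) : ℝ) * (2 ^ N) ^ (p + 1) * C' * (DA + C * L) ^ (p + 1 - 1) * C,
      ?_, fun n => ?_, fun n => ?_⟩
    · positivity
    · have := (hH n).add (((hφc n).multilinear hid).of_order_le (q := 2) (by omega))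
      simpa only [add_sub_right_comm] using this
    · have h1 := (hR n).sub_taylor (by omega)
      have h2 := (hφc (n + 1)).multilinear_sub (hU n) (hAf n) (D' := C * (τ (n + 1) - τ n))
        (by simpa using hg n)
      rw [zero_add] at h2
      have h3 := h1.add h2
      refine (show (fun x => _) = (fun x => _) from funext fun x => ?_) ▸
        h3.mono (le_of_eq ?_)
      · have := hsol n fun _ => x
        have e : φ (n + 1) (fun _ => A n x) = A n (φ n fun _ => x) - γ n fun _ => x := by
          rw [sub_eq_iff_eq_add.1 this]
          abel
        rw [e]
        simp only [hRdef, map_add, γ]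
        abel
      · ring

end NormalForm

section Cutoff

variable {E F : Type*} [NormedAddCommGroup E] [InnerProductSpace ℝ E] [FiniteDimensional ℝ E]
  [NormedAddCommGroup F] [NormedSpace ℝ F]

variable (E) in
/-- A smooth cutoff function equal to `1` on the ball of radius `1/2`, supported in the unit
ball. -/
def cutoff : ContDiffBump (0 : E) := ⟨1 / 2, 1, by norm_num, by norm_num⟩

lemma cutoff_eq_one {x : E} (hx : ‖x‖ ≤ 1 / 2) : cutoff E x = 1 :=
  (cutoff E).one_of_mem_closedBall (by simpa [cutoff] using hx)

lemma cutoff_eq_zero {x : E} (hx : 1 ≤ ‖x‖) : cutoff E x = 0 :=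
  (cutoff E).zero_of_le_dist (by simpa [cutoff] using hx)

variable (E) in
lemma exists_isFlat_cutoff (N : ℕ) : ∃ B : ℝ, 1 ≤ B ∧ IsFlat N 0 B (cutoff E : E → ℝ) := by
  have hb : ∀ i : ℕ, ∃ B : ℝ, ∀ x, ‖x‖ ≤ 1 → ‖iteratedFDeriv ℝ i (cutoff E : E → ℝ) x‖ ≤ B := by
    intro i
    have hc : Continuous fun x => ‖iteratedFDeriv ℝ i (cutoff E : E → ℝ) x‖ :=
      ((cutoff E).contDiff (n := i).continuous_iteratedFDeriv le_rfl).norm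
    obtain ⟨B, hB⟩ := (isCompact_closedBall (0 : E) 1).bddAbove_image hc.continuousOn
    exact ⟨B, fun x hx => hB ⟨x, by simpa using hx, rfl⟩⟩
  choose B hB using hb
  have h0 : ∀ i, 0 ≤ B i := fun i => (norm_nonneg _).trans (hB i 0 (by simp))
  refine ⟨1 + ∑ i ∈ Finset.range (N + 1), B i, by
    linarith [Finset.sum_nonneg fun i (_ : i ∈ Finset.range (N + 1)) => h0 i], by
    linarith [Finset.sum_nonneg fun i (_ : i ∈ Finset.range (N + 1)) => h0 i],
    (cutoff E).contDiff, fun i hi x hx => ?_⟩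
  rw [Nat.zero_sub, pow_zero, mul_one]
  have := Finset.single_le_sum (fun i _ => h0 i) (Finset.mem_range.2 (Nat.lt_succ_of_le hi))
  linarith [hB i x hx]

omit [FiniteDimensional ℝ E] in
lemma iteratedFDeriv_eq_zero_of_one_lt_norm {f : E → F} (hf : ∀ x, 1 ≤ ‖x‖ → f x = 0) (i : ℕ)
    {x : E} (hx : 1 < ‖x‖) : iteratedFDeriv ℝ i f x = 0 := by
  have h : f =ᶠ[𝓝 x] fun _ => 0 := by
    filter_upwards [(isOpen_lt continuous_const continuous_norm).mem_nhds hx] with y hy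
    exact hf y (le_of_lt hy)
  rw [(h.iteratedFDeriv ℝ i).self_of_nhds, show (fun _ : E => (0 : F)) = 0 from rfl,
    iteratedFDeriv_zero]
  rfl

variable {N p : ℕ} {B C : ℝ} {f : E → F}

lemma IsFlat.cutoff_smul (hB : IsFlat N 0 B (cutoff E : E → ℝ)) (hf : IsFlat N p C f) :
    IsFlat N p (2 ^ N * B * C) fun x => cutoff E x • f x := by
  have := IsFlat.bilinear (ContinuousLinearMap.lsmul ℝ ℝ : ℝ →L[ℝ] F →L[ℝ] F)
    ContinuousLinearMap.opNorm_lsmul_le hB hf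
  simpa using this

omit [FiniteDimensional ℝ E] in
lemma IsFlat.norm_iteratedFDeriv_le (hf : IsFlat N p C f) (h0 : ∀ x, 1 ≤ ‖x‖ → f x = 0)
    {i : ℕ} (hi : i ≤ N) (x : E) : ‖iteratedFDeriv ℝ i f x‖ ≤ C := by
  rcases le_or_gt ‖x‖ 1 with hx | hx
  · exact hf.bound_one hi hx
  · rw [iteratedFDeriv_eq_zero_of_one_lt_norm h0 i hx, norm_zero]
    exact hf.nonneg

lemma cutoff_smul_eq_zero {x : E} (hx : 1 ≤ ‖x‖) : cutoff E x • f x = 0 := by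
  rw [cutoff_eq_zero hx, zero_smul]

omit [FiniteDimensional ℝ E] in
lemma IsFlat.rescale (hf : IsFlat N 2 C f) {ρ : ℝ} (h0 : 0 < ρ) (h1 : ρ ≤ 1) :
    IsFlat N 2 (C * ρ) fun x => ρ⁻¹ • f (ρ • x) := by
  have hC := hf.nonneg
  have hsm : ContDiff ℝ N fun x : E => f (ρ • x) := hf.contDiff.comp (contDiff_const_smul ρ)
  refine ⟨by positivity, hsm.const_smul _, fun i hi x hx => ?_⟩
  have hi' : (i : WithTop ℕ∞) ≤ N := by exact_mod_cast hi
  have e : iteratedFDeriv ℝ i (fun x => ρ⁻¹ • f (ρ • x)) x =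
      ρ⁻¹ • ρ ^ i • iteratedFDeriv ℝ i f (ρ • x) := by
    rw [show (fun x => ρ⁻¹ • f (ρ • x)) = ρ⁻¹ • fun x => f (ρ • x) from rfl,
      iteratedFDeriv_const_smul_apply (hsm.of_le hi').contDiffAt,
      iteratedFDeriv_comp_const_smul _ (hf.contDiff_of_le hi)]
  have hρx : ‖ρ • x‖ = ρ * ‖x‖ := by rw [norm_smul, Real.norm_of_nonneg h0.le]
  rw [e, norm_smul, norm_smul, norm_inv, norm_pow, Real.norm_of_nonneg h0.le]
  have hb := hf.bound i hi (ρ • x) (by rw [hρx]; exact mul_le_one₀ h1 (norm_nonneg _) hx)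
  rw [hρx, mul_pow] at hb
  have hpow : ρ⁻¹ * ρ ^ i * ρ ^ (2 - i) ≤ ρ := by
    rw [mul_assoc, ← pow_add, inv_mul_le_iff₀ h0, ← pow_two]
    exact pow_le_pow_of_le_one h0.le h1 (by omega)
  calc ρ⁻¹ * (ρ ^ i * ‖iteratedFDeriv ℝ i f (ρ • x)‖)
      ≤ ρ⁻¹ * (ρ ^ i * (C * (ρ ^ (2 - i) * ‖x‖ ^ (2 - i)))) := by gcongr
    _ = C * ‖x‖ ^ (2 - i) * (ρ⁻¹ * ρ ^ i * ρ ^ (2 - i)) := by ring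
    _ ≤ C * ‖x‖ ^ (2 - i) * ρ := by gcongr
    _ = _ := by ring

end Cutoff

section Singular

/-- A function which is smooth off the origin and vanishes to high order there is smooth. -/
lemma contDiff_of_contDiffOn_compl_zero.{u} {E F : Type u} [NormedAddCommGroup E]
    [NormedSpace ℝ E] [NormedAddCommGroup F] [NormedSpace ℝ F] {n p : ℕ} {C : ℝ} {f : E → F} (h0 : f 0 = 0)
    (hf : ContDiffOn ℝ n f {0}ᶜ) (hnp : n < p)
    (hb : ∀ i ≤ n, ∀ x ≠ 0, ‖x‖ ≤ 1 → ‖iteratedFDeriv ℝ i f x‖ ≤ C * ‖x‖ ^ (p - i)) :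
    ContDiff ℝ n f ∧ ∀ i ≤ n, iteratedFDeriv ℝ i f 0 = 0 := by
  have hval : ∀ x, ‖x‖ ≤ 1 → ‖f x‖ ≤ C * ‖x‖ ^ p := by
    intro x hx
    rcases eq_or_ne x 0 with rfl | hx0
    · simp [h0, zero_pow (show p ≠ 0 by omega)]
    · simpa using hb 0 (Nat.zero_le _) x hx0 hx
  have hopen : IsOpen ({0}ᶜ : Set E) := isOpen_compl_singleton
  have hball : ∀ᶠ x : E in 𝓝 0, ‖x‖ ≤ 1 := by
    filter_upwards [closedBall_mem_nhds (0 : E) one_pos] with x hx using by simpa using hx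
  induction n generalizing F p C with
  | zero =>
    refine ⟨?_, fun i hi => ?_⟩
    · rw [Nat.cast_zero, contDiff_zero, continuous_iff_continuousAt]
      intro x
      rcases eq_or_ne x 0 with rfl | hx
      · have ht : Tendsto (fun x : E => C * ‖x‖ ^ p) (𝓝 0) (𝓝 0) := by
          have : Continuous fun x : E => C * ‖x‖ ^ p := by fun_prop
          have := this.tendsto 0
          simpa [zero_pow (show p ≠ 0 by omega)] using this
        rw [ContinuousAt, h0]
        exact squeeze_zero_norm' (hball.mono hval) ht
      · exact hf.continuousOn.continuousAt (hopen.mem_nhds hx)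
    · obtain rfl : i = 0 := by omega
      ext v
      simp [h0]
  | succ n ih =>
    have hd0 : HasFDerivAt f (0 : E →L[ℝ] F) 0 := by
      rw [hasFDerivAt_iff_isLittleO_nhds_zero]
      simp only [zero_add, h0, sub_zero, zero_apply]
      have h1 : f =O[𝓝 0] fun x : E => ‖x‖ ^ p := by
        refine Asymptotics.IsBigO.of_bound C ?_
        filter_upwards [hball] with x hx
        simpa using hval x hx
      refine h1.trans_isLittleO ?_
      have := (Asymptotics.isLittleO_norm_pow_id (E' := E) (n := p) (by omega))
      exact this
    have hdx : ∀ x ≠ 0, DifferentiableAt ℝ f x := fun x hx =>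
      (hf.differentiableOn (by norm_cast)).differentiableAt (hopen.mem_nhds hx)
    have hd : Differentiable ℝ f := fun x => by
      rcases eq_or_ne x 0 with rfl | hx
      exacts [hd0.differentiableAt, hdx x hx]
    have hbf : ∀ i ≤ n, ∀ x ≠ 0, ‖x‖ ≤ 1 →
        ‖iteratedFDeriv ℝ i (fderiv ℝ f) x‖ ≤ C * ‖x‖ ^ (p - 1 - i) := by
      intro i hi x hx0 hx
      rw [norm_iteratedFDeriv_fderiv, show p - 1 - i = p - (i + 1) by omega]
      exact hb (i + 1) (by omega) x hx0 hx
    have h0f : fderiv ℝ f 0 = 0 := hd0.fderiv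
    have h := ih (p := p - 1) (C := C) h0f
      (hf.fderiv_of_isOpen hopen (by norm_cast)) (by omega) hbf (by
        intro x hx
        rcases eq_or_ne x 0 with rfl | hx0
        · simp [h0f, zero_pow (show p - 1 ≠ 0 by omega)]
        · simpa using hbf 0 (Nat.zero_le _) x hx0 hx)
    refine ⟨?_, fun i hi => ?_⟩
    · rw [Nat.cast_succ, contDiff_succ_iff_fderiv]
      exact ⟨hd, by simp, h.1⟩
    · rcases i with _ | i
      · ext v
        simp [h0]
      · rw [← norm_eq_zero, ← norm_iteratedFDeriv_fderiv, h.2 i (by omega), norm_zero]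

end Singular

section Angular

lemma norm_iteratedFDeriv_comp_clm_le {E W F : Type*} [NormedAddCommGroup E] [NormedSpace ℝ E]
    [NormedAddCommGroup W] [NormedSpace ℝ W] [NormedAddCommGroup F] [NormedSpace ℝ F]
    {f : W → F} {s : Set W} {n i : ℕ} (hs : IsOpen s) (hf : ContDiffOn ℝ n f s) (L : E →L[ℝ] W)
    {x : E} (hx : L x ∈ s) (hi : i ≤ n) :
    ‖iteratedFDeriv ℝ i (fun x => f (L x)) x‖ ≤ ‖iteratedFDeriv ℝ i f (L x)‖ * ‖L‖ ^ i := by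
  have ho : IsOpen (L ⁻¹' s) := hs.preimage L.continuous
  have h := L.iteratedFDerivWithin_comp_right hf hs.uniqueDiffOn ho.uniqueDiffOn hx
    (i := i) (by exact_mod_cast hi)
  rw [iteratedFDerivWithin_of_isOpen i ho hx, iteratedFDerivWithin_of_isOpen i hs hx] at h
  change ‖iteratedFDeriv ℝ i (f ∘ L) x‖ ≤ _
  rw [h]
  refine (ContinuousMultilinearMap.norm_compContinuousLinearMap_le _ _).trans_eq ?_
  simp

variable {W : Type*} [NormedAddCommGroup W] [NormedSpace ℝ W] [FiniteDimensional ℝ W]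

/-- Derivatives of functions homogeneous of degree zero. -/
lemma exists_norm_iteratedFDeriv_le_of_homogeneous {f : W → ℝ} {n : ℕ}
    (hf : ContDiffOn ℝ n f {0}ᶜ) (hhom : ∀ c : ℝ, 0 < c → ∀ x, f (c • x) = f x) :
    ∃ C : ℝ, 0 ≤ C ∧ ∀ i ≤ n, ∀ x ≠ 0, ‖iteratedFDeriv ℝ i f x‖ * ‖x‖ ^ i ≤ C := by
  have ho : IsOpen ({0}ᶜ : Set W) := isOpen_compl_singleton
  have hb : ∀ i : ℕ, ∃ C : ℝ, 0 ≤ C ∧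
      (i ≤ n → ∀ x ∈ sphere (0 : W) 1, ‖iteratedFDeriv ℝ i f x‖ ≤ C) := by
    intro i
    by_cases hi : i ≤ n
    · have hc := (hf.continuousOn_iteratedFDerivWithin (m := i) (by exact_mod_cast hi)
        ho.uniqueDiffOn)
      have hc' : ContinuousOn (iteratedFDeriv ℝ i f) {0}ᶜ :=
        hc.congr fun x hx => (iteratedFDerivWithin_of_isOpen i ho hx).symm
      obtain ⟨C, hC⟩ := (isCompact_sphere (0 : W) 1).bddAbove_image
        (hc'.mono fun x hx => by
          have : ‖x‖ = 1 := by simpa using hx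
          intro h0
          rw [mem_singleton_iff.1 h0, norm_zero] at this
          exact zero_ne_one this).norm
      exact ⟨max C 0, le_max_right _ _, fun _ x hx => (hC ⟨x, hx, rfl⟩).trans (le_max_left _ _)⟩
    · exact ⟨0, le_rfl, fun h => absurd h hi⟩
  choose C hC0 hC using hb
  refine ⟨∑ i ∈ Finset.range (n + 1), C i, Finset.sum_nonneg fun i _ => hC0 i,
    fun i hi x hx => ?_⟩
  refine le_trans ?_ (Finset.single_le_sum (fun i _ => hC0 i)
    (Finset.mem_range.2 (Nat.lt_succ_of_le hi)))
  have hx' : 0 < ‖x‖ := norm_pos_iff.2 hx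
  set L : W →L[ℝ] W := ‖x‖⁻¹ • ContinuousLinearMap.id ℝ W with hL
  have hLx : L x = ‖x‖⁻¹ • x := rfl
  have hn : ‖L x‖ = 1 := by
    rw [hLx, norm_smul, norm_inv, norm_norm, inv_mul_cancel₀ hx'.ne']
  have hLx0 : L x ∈ ({0}ᶜ : Set W) := fun h0 => by
    rw [mem_singleton_iff.1 h0, norm_zero] at hn
    exact zero_ne_one hn
  have h := norm_iteratedFDeriv_comp_clm_le ho hf L hLx0 hi
  have e : (fun y => f (L y)) = f := funext fun y => hhom _ (inv_pos.2 hx') y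
  rw [e] at h
  have hLn : ‖L‖ ≤ ‖x‖⁻¹ := by
    rw [hL, norm_smul, norm_inv, norm_norm]
    exact mul_le_of_le_one_right (inv_nonneg.2 hx'.le) ContinuousLinearMap.norm_id_le
  calc ‖iteratedFDeriv ℝ i f x‖ * ‖x‖ ^ i
      ≤ (‖iteratedFDeriv ℝ i f (L x)‖ * ‖L‖ ^ i) * ‖x‖ ^ i := by gcongr
    _ ≤ (C i * (‖x‖⁻¹) ^ i) * ‖x‖ ^ i := by
        gcongr
        · exact hC0 i
        · exact hC i hi _ (by simpa using hn)
    _ = C i := by rw [mul_assoc, ← mul_pow, inv_mul_cancel₀ hx'.ne', one_pow, mul_one]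

variable {E : Type*} [NormedAddCommGroup E] [InnerProductSpace ℝ E] [FiniteDimensional ℝ E]

/-- Localization of a flat function to a cone in the unit ball. -/
lemma exists_cone_cut {f : W → ℝ} {l : ℕ} (hf : ContDiffOn ℝ l f {0}ᶜ)
    (hhom : ∀ c : ℝ, 0 < c → ∀ x, f (c • x) = f x) {Z : Set W} (hZ : IsClosed Z)
    (hfZ : ∀ w, f w ≠ 0 → w ∈ Z) (c : ℝ) :
    ∃ B : ℝ, 0 ≤ B ∧ ∀ L : E →L[ℝ] W, ‖L‖ ≤ c → (∀ x, ‖x‖ ≤ 2 * ‖L x‖) →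
      ∀ (R : E → E) (C : ℝ) (q : ℕ), 1 ≤ q → IsFlat l (q + l) C R →
        ContDiff ℝ l (fun x => cutoff E x • f (L x) • R x) ∧
        (∀ i ≤ l, ∀ x, ‖iteratedFDeriv ℝ i (fun x => cutoff E x • f (L x) • R x) x‖ ≤
          B * C * ‖x‖ ^ q) ∧
        (∀ i x, iteratedFDeriv ℝ i (fun x => cutoff E x • f (L x) • R x) x ≠ 0 →
          ‖x‖ ≤ 1 ∧ L x ∈ Z) := by
  obtain ⟨D, hD0, hD⟩ := exists_norm_iteratedFDeriv_le_of_homogeneous hf hhom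
  obtain ⟨B, hB1, hB⟩ := exists_isFlat_cutoff E l
  set c' := max c 1 with hc'
  have hc1 : 1 ≤ c' := le_max_right _ _
  set A := D * (2 * c') ^ l with hA
  have hA0 : 0 ≤ A := by positivity
  refine ⟨2 ^ l * B * (2 ^ l * A), by positivity, fun L hL hLx R C q hq hR => ?_⟩
  have hC := hR.nonneg
  have hW : IsOpen ({0}ᶜ : Set W) := isOpen_compl_singleton
  have hE : IsOpen ({0}ᶜ : Set E) := isOpen_compl_singleton
  have hL0 : ∀ x ∈ ({0}ᶜ : Set E), L x ∈ ({0}ᶜ : Set W) := fun x hx h0 => hx (by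
    have := hLx x
    rw [mem_singleton_iff.1 h0, norm_zero, mul_zero] at this
    exact norm_le_zero_iff.1 this)
  have hfL : ContDiffOn ℝ l (fun x => f (L x)) {0}ᶜ := hf.comp L.contDiff.contDiffOn hL0
  have hfLb : ∀ i ≤ l, ∀ x ≠ 0, ‖iteratedFDeriv ℝ i (fun x => f (L x)) x‖ * ‖x‖ ^ i ≤ A := by
    intro i hi x hx
    calc ‖iteratedFDeriv ℝ i (fun x => f (L x)) x‖ * ‖x‖ ^ i
        ≤ (‖iteratedFDeriv ℝ i f (L x)‖ * c' ^ i) * (2 * ‖L x‖) ^ i := by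
          gcongr
          · refine (norm_iteratedFDeriv_comp_clm_le hW hf L (hL0 x hx) hi).trans ?_
            gcongr
            exact hL.trans (le_max_left _ _)
          · exact hLx x
      _ = (‖iteratedFDeriv ℝ i f (L x)‖ * ‖L x‖ ^ i) * (2 * c') ^ i := by
          rw [mul_pow, mul_pow]; ring
      _ ≤ D * (2 * c') ^ l := by
          gcongr
          · exact hD i hi _ (hL0 x hx)
          · linarith
  have hprod : ContDiffOn ℝ l (fun x => f (L x) • R x) {0}ᶜ := hfL.smul hR.contDiff.contDiffOn
  have hprodb : ∀ i ≤ l, ∀ x ≠ 0, ‖x‖ ≤ 1 → ‖iteratedFDeriv ℝ i (fun x => f (L x) • R x) x‖ ≤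
      2 ^ l * A * C * ‖x‖ ^ (q + l - i) := by
    intro i hi x hx hx1
    have hxm : x ∈ ({0}ᶜ : Set E) := hx
    have h := norm_iteratedFDerivWithin_smul_le hfL hR.contDiff.contDiffOn hE.uniqueDiffOn hxm
      (n := i) (by exact_mod_cast hi)
    simp only [iteratedFDerivWithin_of_isOpen _ hE hxm] at h
    refine h.trans ?_
    calc _ ≤ ∑ j ∈ Finset.range (i + 1), (i.choose j : ℝ) * (A * C * ‖x‖ ^ (q + l - i)) := by
          refine Finset.sum_le_sum fun j hj => ?_
          have hji : j ≤ i := Nat.lt_succ_iff.1 (Finset.mem_range.1 hj)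
          rw [mul_assoc]
          refine mul_le_mul_of_nonneg_left ?_ (Nat.cast_nonneg _)
          calc _ ≤ ‖iteratedFDeriv ℝ j (fun x => f (L x)) x‖ *
                (C * ‖x‖ ^ (q + l - (i - j))) := by
                gcongr
                exact hR.bound _ (by omega) x hx1
            _ = (‖iteratedFDeriv ℝ j (fun x => f (L x)) x‖ * ‖x‖ ^ j) *
                (C * ‖x‖ ^ (q + l - i)) := by
                rw [show q + l - (i - j) = j + (q + l - i) by omega, pow_add]; ring
            _ ≤ A * (C * ‖x‖ ^ (q + l - i)) := by
                gcongr
                exact hfLb j (by omega) x hx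
            _ = _ := by ring
      _ = 2 ^ i * (A * C * ‖x‖ ^ (q + l - i)) := by
          rw [← Finset.sum_mul]
          congr 1
          exact_mod_cast Nat.sum_range_choose i
      _ ≤ 2 ^ l * (A * C * ‖x‖ ^ (q + l - i)) := by
          gcongr
          exact one_le_two
      _ = _ := by ring
  have hR0 : R 0 = 0 := by
    have h0 := hR.bound 0 (Nat.zero_le _) 0 (by simp)
    rw [norm_iteratedFDeriv_zero, norm_zero, zero_pow (by omega), mul_zero] at h0
    exact norm_le_zero_iff.1 h0
  obtain ⟨hsm, hz⟩ := contDiff_of_contDiffOn_compl_zero (f := fun x => f (L x) • R x)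
    (by simp [hR0]) hprod (show l < q + l by omega) hprodb
  have hflat : IsFlat l (q + l) (2 ^ l * A * C) fun x => f (L x) • R x := by
    refine ⟨by positivity, hsm, fun i hi x hx => ?_⟩
    rcases eq_or_ne x 0 with rfl | hx0
    · rw [hz i hi, norm_zero]; positivity
    · exact hprodb i hi x hx0 hx
  have hcut := IsFlat.cutoff_smul hB hflat
  refine ⟨hcut.contDiff, fun i hi x => ?_, fun i x hx => ?_⟩
  · rcases le_or_gt ‖x‖ 1 with hx | hx
    · refine (hcut.bound i hi x hx).trans ?_
      have := pow_le_pow_of_le_one (norm_nonneg x) hx (show q ≤ q + l - i by omega)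
      calc _ ≤ 2 ^ l * B * (2 ^ l * A * C) * ‖x‖ ^ q := by gcongr
        _ = _ := by ring
    · rw [iteratedFDeriv_eq_zero_of_one_lt_norm (f := fun x => cutoff E x • f (L x) • R x)
        (fun x hx => cutoff_smul_eq_zero (f := fun x => f (L x) • R x) hx) i hx, norm_zero]
      positivity
  · have hcl : IsClosed {x : E | ‖x‖ ≤ 1 ∧ L x ∈ Z} :=
      (isClosed_le continuous_norm continuous_const).inter (hZ.preimage L.continuous)
    refine closure_minimal (s := Function.support _) (fun y hy => ?_) hcl
      (support_iteratedFDeriv_subset (𝕜 := ℝ) (f := fun x => cutoff E x • f (L x) • R x) i hx)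
    have hy' : cutoff E y • f (L y) • R y ≠ 0 := hy
    refine ⟨?_, hfZ _ fun h0 => hy' (by rw [h0, zero_smul, smul_zero])⟩
    by_contra h1
    exact hy' (cutoff_smul_eq_zero (f := fun x => f (L x) • R x) (not_le.1 h1).le)

/-- A smooth angular cutoff on a product. -/
def coneFun (w : E × E) : ℝ :=
  Real.smoothTransition ((‖w.1‖ ^ 2 - ‖w.2‖ ^ 2) / (‖w.1‖ ^ 2 + ‖w.2‖ ^ 2) + 1 / 2)

omit [InnerProductSpace ℝ E] [FiniteDimensional ℝ E] in
lemma coneFun_den_pos {w : E × E} (hw : w ≠ 0) : 0 < ‖w.1‖ ^ 2 + ‖w.2‖ ^ 2 := by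
  by_contra h
  have h1 : ‖w.1‖ = 0 := by nlinarith [sq_nonneg ‖w.1‖, sq_nonneg ‖w.2‖]
  have h2 : ‖w.2‖ = 0 := by nlinarith [sq_nonneg ‖w.1‖, sq_nonneg ‖w.2‖]
  exact hw (Prod.ext (norm_eq_zero.1 h1) (norm_eq_zero.1 h2))

omit [FiniteDimensional ℝ E] in
lemma contDiffOn_coneFun (n : ℕ) : ContDiffOn ℝ n (coneFun : E × E → ℝ) {0}ᶜ := by
  refine Real.smoothTransition.contDiff.comp_contDiffOn ?_
  refine ContDiffOn.add (ContDiffOn.div ?_ ?_ fun w hw => (coneFun_den_pos hw).ne')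
    contDiffOn_const
  · exact ((contDiff_fst.norm_sq ℝ).sub (contDiff_snd.norm_sq ℝ)).contDiffOn
  · exact ((contDiff_fst.norm_sq ℝ).add (contDiff_snd.norm_sq ℝ)).contDiffOn

omit [FiniteDimensional ℝ E] in
lemma coneFun_smul {c : ℝ} (hc : 0 < c) (w : E × E) : coneFun (c • w) = coneFun w := by
  have hc2 : c ^ 2 ≠ 0 := by positivity
  simp only [coneFun, Prod.smul_fst, Prod.smul_snd, norm_smul, mul_pow, Real.norm_of_nonneg hc.le,
    ← mul_sub, ← mul_add, mul_div_mul_left _ _ hc2]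

omit [InnerProductSpace ℝ E] [FiniteDimensional ℝ E] in
lemma norm_snd_le_of_coneFun_ne_zero {w : E × E} (hw : coneFun w ≠ 0) : ‖w.2‖ ≤ 2 * ‖w.1‖ := by
  by_contra h
  rw [not_le] at h
  refine hw (Real.smoothTransition.zero_of_nonpos ?_)
  have hpos : 0 < ‖w.1‖ ^ 2 + ‖w.2‖ ^ 2 := by nlinarith [norm_nonneg w.1]
  rw [← le_neg_iff_add_nonpos_right, div_le_iff₀ hpos]
  nlinarith [norm_nonneg w.1]

omit [InnerProductSpace ℝ E] [FiniteDimensional ℝ E] in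
lemma norm_fst_le_of_one_sub_coneFun_ne_zero {w : E × E} (hw : 1 - coneFun w ≠ 0) :
    ‖w.1‖ ≤ 2 * ‖w.2‖ := by
  by_contra h
  rw [not_le] at h
  refine hw (sub_eq_zero.2 (Real.smoothTransition.one_of_one_le ?_).symm)
  have hpos : 0 < ‖w.1‖ ^ 2 + ‖w.2‖ ^ 2 := by nlinarith [norm_nonneg w.2]
  rw [← sub_le_iff_le_add, le_div_iff₀ hpos]
  nlinarith [norm_nonneg w.2]

/-- Splitting of flat remainders into parts supported in complementary cones. -/
lemma exists_cone_splitting (l : ℕ) (c : ℝ) :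
    ∃ B : ℝ, 0 ≤ B ∧ ∀ P : E →L[ℝ] E, ‖P‖ ≤ c → ‖1 - P‖ ≤ c →
      ∀ (R : E → E) (C : ℝ) (q : ℕ), 1 ≤ q → IsFlat l (q + l) C R →
      ∃ R₁ R₂ : E → E, (∀ x, ‖x‖ ≤ 1 / 2 → R₁ x + R₂ x = R x) ∧
        (ContDiff ℝ l R₁ ∧ (∀ i ≤ l, ∀ x, ‖iteratedFDeriv ℝ i R₁ x‖ ≤ B * C * ‖x‖ ^ q) ∧
          ∀ i x, iteratedFDeriv ℝ i R₁ x ≠ 0 → ‖x‖ ≤ 1 ∧ ‖x - P x‖ ≤ 2 * ‖P x‖) ∧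
        (ContDiff ℝ l R₂ ∧ (∀ i ≤ l, ∀ x, ‖iteratedFDeriv ℝ i R₂ x‖ ≤ B * C * ‖x‖ ^ q) ∧
          ∀ i x, iteratedFDeriv ℝ i R₂ x ≠ 0 → ‖x‖ ≤ 1 ∧ ‖P x‖ ≤ 2 * ‖x - P x‖) := by
  have hcl1 : IsClosed {w : E × E | ‖w.2‖ ≤ 2 * ‖w.1‖} :=
    isClosed_le continuous_snd.norm (continuous_const.mul continuous_fst.norm)
  have hcl2 : IsClosed {w : E × E | ‖w.1‖ ≤ 2 * ‖w.2‖} :=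
    isClosed_le continuous_fst.norm (continuous_const.mul continuous_snd.norm)
  obtain ⟨B₁, hB₁, h₁⟩ := exists_cone_cut (E := E) (contDiffOn_coneFun (E := E) l)
    (fun c hc w => coneFun_smul hc w) hcl1 (fun w hw => norm_snd_le_of_coneFun_ne_zero hw) c
  obtain ⟨B₂, hB₂, h₂⟩ := exists_cone_cut (E := E) (f := fun w : E × E => 1 - coneFun w)
    (contDiffOn_const.sub (contDiffOn_coneFun (E := E) l))
    (fun c hc w => by rw [coneFun_smul hc]) hcl2
    (fun w hw => norm_fst_le_of_one_sub_coneFun_ne_zero hw) c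
  refine ⟨max B₁ B₂, le_max_of_le_left hB₁, fun P hP hQ R C q hq hR => ?_⟩
  set L : E →L[ℝ] E × E := P.prod (1 - P) with hL
  have hLc : ‖L‖ ≤ c := by
    refine L.opNorm_le_bound ((norm_nonneg _).trans hP) fun x => ?_
    exact max_le (P.le_of_opNorm_le hP x) ((1 - P).le_of_opNorm_le hQ x)
  have hLx : ∀ x, ‖x‖ ≤ 2 * ‖L x‖ := fun x => by
    have h1 : ‖P x‖ ≤ ‖L x‖ := le_max_left _ _
    have h2 : ‖x - P x‖ ≤ ‖L x‖ := le_max_right _ _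
    calc ‖x‖ = ‖P x + (x - P x)‖ := by rw [add_sub_cancel]
      _ ≤ _ := (norm_add_le _ _).trans (by linarith)
  obtain ⟨s1, b1, z1⟩ := h₁ L hLc hLx R C q hq hR
  obtain ⟨s2, b2, z2⟩ := h₂ L hLc hLx R C q hq hR
  have hC := hR.nonneg
  refine ⟨_, _, fun x hx => ?_, ⟨s1, fun i hi x => (b1 i hi x).trans ?_, z1⟩,
    ⟨s2, fun i hi x => (b2 i hi x).trans ?_, z2⟩⟩
  · rw [cutoff_eq_one hx, one_smul, one_smul, ← add_smul, add_sub_cancel, one_smul]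
  · gcongr; exact le_max_left _ _
  · gcongr; exact le_max_right _ _

end Angular

/-- The supremum seminorm of a sequence of operators. -/
def opSup (L : ℕ → X →L[ℝ] X) (x : X) : ℝ := ⨆ m, ‖L m x‖

section opSup

variable {L : ℕ → X →L[ℝ] X} {C : ℝ}

lemma opSup_le {x : X} {b : ℝ} (h : ∀ m, ‖L m x‖ ≤ b) : opSup L x ≤ b := ciSup_le h

lemma le_opSup (hL : ∀ m, ‖L m‖ ≤ C) (m : ℕ) (x : X) : ‖L m x‖ ≤ opSup L x :=
  le_ciSup (f := fun m => ‖L m x‖) ⟨C * ‖x‖, by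
    rintro _ ⟨m, rfl⟩
    exact (L m).le_of_opNorm_le (hL m) x⟩ m

lemma opSup_le_norm (hL : ∀ m, ‖L m‖ ≤ C) (x : X) : opSup L x ≤ C * ‖x‖ :=
  opSup_le fun m => (L m).le_of_opNorm_le (hL m) x

lemma opSup_nonneg (x : X) : 0 ≤ opSup L x := Real.iSup_nonneg fun _ => norm_nonneg _

lemma opSup_add_le (hL : ∀ m, ‖L m‖ ≤ C) (x y : X) :
    opSup L (x + y) ≤ opSup L x + C * ‖y‖ :=
  opSup_le fun m => by
    rw [map_add]
    exact (norm_add_le _ _).trans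
      (add_le_add (le_opSup hL m x) ((L m).le_of_opNorm_le (hL m) y))

lemma opSup_le_add (hL : ∀ m, ‖L m‖ ≤ C) (x y : X) :
    opSup L x ≤ opSup L (x + y) + C * ‖y‖ := by
  simpa using opSup_add_le hL (x + y) (-y)

end opSup

variable {A : ℕ → X ≃L[ℝ] X} {τ : ℕ → ℝ} {P : ℕ → X →L[ℝ] X} {N ν L ε a K : ℝ}

def stableOp (A : ℕ → X ≃L[ℝ] X) (τ : ℕ → ℝ) (P : ℕ → X →L[ℝ] X) (ν : ℝ) (k m : ℕ) : X →L[ℝ] X :=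
  if k ≤ m then Real.exp (ν * (τ m - τ k)) • (Ev A m k * P k) else 0

def unstableOp (A : ℕ → X ≃L[ℝ] X) (τ : ℕ → ℝ) (P : ℕ → X →L[ℝ] X) (ν : ℝ) (k m : ℕ) :
    X →L[ℝ] X :=
  if m ≤ k then Real.exp (ν * (τ k - τ m)) • (Ev A m k * (1 - P k)) else 0

def growthOp (A : ℕ → X ≃L[ℝ] X) (τ : ℕ → ℝ) (a : ℝ) (k m : ℕ) : X →L[ℝ] X :=
  Real.exp (-(a * |τ m - τ k|)) • Ev A m k

/-- A hyperbolic splitting with explicit constants. -/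
structure IsHyp (A : ℕ → X ≃L[ℝ] X) (τ : ℕ → ℝ) (P : ℕ → X →L[ℝ] X) (N ν : ℝ) : Prop where
  proj : ∀ k, P k * P k = P k
  comm : ∀ k, (A k : X →L[ℝ] X) * P k = P (k + 1) * (A k : X →L[ℝ] X)
  one_le : 1 ≤ N
  pos : 0 < ν
  stable : ∀ m k, k ≤ m → ‖Ev A m k * P k‖ ≤ N * Real.exp (-(ν * (τ m - τ k)))
  unstable : ∀ m k, m ≤ k → ‖Ev A m k * (1 - P k)‖ ≤ N * Real.exp (-(ν * (τ k - τ m)))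

namespace IsHyp

variable (h : IsHyp A τ P N ν)
include h

lemma norm_stableOp_le (k m : ℕ) : ‖stableOp A τ P ν k m‖ ≤ N := by
  rw [stableOp]
  split_ifs with hk
  · rw [norm_smul, Real.norm_eq_abs, Real.abs_exp]
    calc _ ≤ Real.exp (ν * (τ m - τ k)) * (N * Real.exp (-(ν * (τ m - τ k)))) := by
          gcongr; exact h.stable m k hk
      _ = N := by rw [mul_left_comm, ← Real.exp_add, add_neg_cancel, Real.exp_zero, mul_one]
  · rw [norm_zero]; linarith [h.one_le]

lemma norm_unstableOp_le (k m : ℕ) : ‖unstableOp A τ P ν k m‖ ≤ N := by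
  rw [unstableOp]
  split_ifs with hk
  · rw [norm_smul, Real.norm_eq_abs, Real.abs_exp]
    calc _ ≤ Real.exp (ν * (τ k - τ m)) * (N * Real.exp (-(ν * (τ k - τ m)))) := by
          gcongr; exact h.unstable m k hk
      _ = N := by rw [mul_left_comm, ← Real.exp_add, add_neg_cancel, Real.exp_zero, mul_one]
  · rw [norm_zero]; linarith [h.one_le]

lemma comm_apply (k : ℕ) (x : X) : P (k + 1) (A k x) = A k (P k x) :=
  (DFunLike.congr_fun (h.comm k) x).symm

lemma norm_proj_le (k : ℕ) (x : X) : ‖P k x‖ ≤ opSup (stableOp A τ P ν k) x := by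
  have := le_opSup (h.norm_stableOp_le k) k x
  simpa [stableOp] using this

lemma norm_sub_proj_le (k : ℕ) (x : X) : ‖x - P k x‖ ≤ opSup (unstableOp A τ P ν k) x := by
  have := le_opSup (h.norm_unstableOp_le k) k x
  simpa [unstableOp] using this

lemma norm_le (k : ℕ) (x : X) :
    ‖x‖ ≤ opSup (stableOp A τ P ν k) x + opSup (unstableOp A τ P ν k) x := by
  have h1 := h.norm_proj_le k x
  have h2 := h.norm_sub_proj_le k x
  have := norm_add_le (P k x) (x - P k x)
  rw [add_sub_cancel] at this
  linarith

lemma opSup_stable_le (k : ℕ) (x : X) : opSup (stableOp A τ P ν k) x ≤ N * ‖P k x‖ := by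
  refine opSup_le fun m => ?_
  have e : stableOp A τ P ν k m x = stableOp A τ P ν k m (P k x) := by
    have : P k (P k x) = P k x := DFunLike.congr_fun (h.proj k) x
    rw [stableOp]
    split_ifs <;> simp [this]
  rw [e]
  exact (stableOp A τ P ν k m).le_of_opNorm_le (h.norm_stableOp_le k m) _

lemma opSup_unstable_le (k : ℕ) (x : X) :
    opSup (unstableOp A τ P ν k) x ≤ N * ‖x - P k x‖ := by
  refine opSup_le fun m => ?_
  have e : unstableOp A τ P ν k m x = unstableOp A τ P ν k m (x - P k x) := by
    have : P k (P k x) = P k x := DFunLike.congr_fun (h.proj k) x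
    rw [unstableOp]
    split_ifs <;> simp [this]
  rw [e]
  exact (unstableOp A τ P ν k m).le_of_opNorm_le (h.norm_unstableOp_le k m) _

lemma stable_succ (k : ℕ) (x : X) :
    opSup (stableOp A τ P ν (k + 1)) (A k x) ≤
      Real.exp (-(ν * (τ (k + 1) - τ k))) * opSup (stableOp A τ P ν k) x := by
  refine opSup_le fun m => ?_
  by_cases hm : k + 1 ≤ m
  · have h1 := le_opSup (h.norm_stableOp_le k) m x
    have e : stableOp A τ P ν (k + 1) m (A k x) =
        Real.exp (-(ν * (τ (k + 1) - τ k))) • stableOp A τ P ν k m x := by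
      simp only [stableOp, if_pos hm, if_pos (Nat.le_of_succ_le hm), smul_apply,
        mul_apply_eq_comp, h.comm_apply, Ev_succ_right, smul_smul,
        ← Real.exp_add]
      congr 2; ring
    rw [e, norm_smul, Real.norm_eq_abs, Real.abs_exp]
    gcongr
  · have := opSup_nonneg (L := stableOp A τ P ν k) x
    simp only [stableOp, if_neg hm, zero_apply, norm_zero]
    positivity

lemma unstable_succ (k : ℕ) (x : X) :
    Real.exp (ν * (τ (k + 1) - τ k)) * opSup (unstableOp A τ P ν k) x ≤
      opSup (unstableOp A τ P ν (k + 1)) (A k x) := by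
  rw [mul_comm, ← le_div_iff₀ (Real.exp_pos _)]
  refine opSup_le fun m => ?_
  rw [le_div_iff₀ (Real.exp_pos _)]
  by_cases hm : m ≤ k
  · have h1 := le_opSup (h.norm_unstableOp_le (k + 1)) m (A k x)
    have e : unstableOp A τ P ν (k + 1) m (A k x) =
        Real.exp (ν * (τ (k + 1) - τ k)) • unstableOp A τ P ν k m x := by
      simp only [unstableOp, if_pos hm, if_pos (Nat.le_succ_of_le hm), smul_apply,
        mul_apply_eq_comp, sub_apply, one_apply_eq_self, h.comm_apply,
        map_sub, Ev_succ_right, smul_smul, ← Real.exp_add]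
      congr 2; ring
    rw [e, norm_smul, Real.norm_eq_abs, Real.abs_exp] at h1
    linarith
  · have := opSup_nonneg (L := unstableOp A τ P ν (k + 1)) (A k x)
    simp only [unstableOp, if_neg hm, zero_apply, norm_zero, zero_mul]
    exact this

variable (hm : Monotone τ) (hL : ∀ n, τ (n + 1) - τ n ≤ L) (hε : 0 ≤ ε)
  (hs : N * ε * (1 + 2 * N) ≤ Real.exp (-(ν * L)) * (ν / 2))
include hm hL hε hs

omit hε in
lemma exp_gap (k : ℕ) :
    Real.exp (ν / 2 * (τ (k + 1) - τ k)) + N * ε * (1 + 2 * N) * (τ (k + 1) - τ k) ≤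
        Real.exp (ν * (τ (k + 1) - τ k)) ∧
      Real.exp (-(ν * (τ (k + 1) - τ k))) + N * ε * (1 + 2 * N) * (τ (k + 1) - τ k) ≤
        Real.exp (-(ν / 2 * (τ (k + 1) - τ k))) := by
  have hu : 0 ≤ τ (k + 1) - τ k := sub_nonneg.2 (hm k.le_succ)
  have huL := hL k
  have hν := h.pos
  generalize τ (k + 1) - τ k = u at *
  have h1 : 1 + ν / 2 * u ≤ Real.exp (ν / 2 * u) := by linarith [Real.add_one_le_exp (ν / 2 * u)]
  have h2 : Real.exp (-(ν * L)) ≤ Real.exp (-(ν * u)) := Real.exp_le_exp.2 (by nlinarith)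
  have h3 : Real.exp (-(ν * L)) ≤ 1 := Real.exp_le_one_iff.2 (by nlinarith)
  have h4 : N * ε * (1 + 2 * N) * u ≤ Real.exp (-(ν * L)) * (ν / 2) * u := by gcongr
  have h5 : 0 ≤ ν / 2 * u := by positivity
  constructor
  · have e : Real.exp (ν * u) = Real.exp (ν / 2 * u) * Real.exp (ν / 2 * u) := by
      rw [← Real.exp_add]; congr 1; ring
    rw [e]
    nlinarith
  · have e : Real.exp (-(ν / 2 * u)) = Real.exp (-(ν * u)) * Real.exp (ν / 2 * u) := by
      rw [← Real.exp_add]; congr 1; ring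
    rw [e]
    nlinarith [Real.exp_pos (-(ν * u))]

lemma cone_unstable {k : ℕ} {x y : X} (hy : ‖y‖ ≤ ε * (τ (k + 1) - τ k) * ‖x‖)
    (hc : opSup (stableOp A τ P ν k) x ≤ 2 * N * opSup (unstableOp A τ P ν k) x) :
    opSup (stableOp A τ P ν (k + 1)) (A k x + y) ≤
        2 * N * opSup (unstableOp A τ P ν (k + 1)) (A k x + y) ∧
      Real.exp (ν / 2 * (τ (k + 1) - τ k)) * opSup (unstableOp A τ P ν k) x ≤
        opSup (unstableOp A τ P ν (k + 1)) (A k x + y) := by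
  obtain ⟨e1, e2⟩ := h.exp_gap hm hL hs k
  have hu : 0 ≤ τ (k + 1) - τ k := sub_nonneg.2 (hm k.le_succ)
  have hS := opSup_nonneg (L := stableOp A τ P ν k) x
  have hT := opSup_nonneg (L := unstableOp A τ P ν k) x
  have hS' := (opSup_add_le (h.norm_stableOp_le (k + 1)) (A k x) y).trans
    (add_le_add_left (h.stable_succ k x) _)
  have hT' := (h.unstable_succ k x).trans (opSup_le_add (h.norm_unstableOp_le (k + 1)) (A k x) y)
  have hN := h.one_le
  have hNy : N * ‖y‖ ≤ N * (ε * (τ (k + 1) - τ k) *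
      (opSup (stableOp A τ P ν k) x + opSup (unstableOp A τ P ν k) x)) := by
    have := h.norm_le k x
    refine mul_le_mul_of_nonneg_left (hy.trans ?_) (by linarith)
    gcongr
  have e3 : Real.exp (-(ν / 2 * (τ (k + 1) - τ k))) ≤ 1 :=
    Real.exp_le_one_iff.2 (by have := h.pos; have : 0 ≤ ν / 2 * (τ (k + 1) - τ k) := by positivity
                              linarith)
  have e4 : 1 ≤ Real.exp (ν / 2 * (τ (k + 1) - τ k)) :=
    Real.one_le_exp (by have := h.pos; positivity)
  have e5 := Real.exp_pos (-(ν * (τ (k + 1) - τ k)))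
  have hw : 0 ≤ N * ε * (τ (k + 1) - τ k) := by positivity
  generalize opSup (stableOp A τ P ν k) x = S at *
  generalize opSup (unstableOp A τ P ν k) x = T at *
  generalize opSup (stableOp A τ P ν (k + 1)) (A k x + y) = S' at *
  generalize opSup (unstableOp A τ P ν (k + 1)) (A k x + y) = T' at *
  generalize τ (k + 1) - τ k = u at *
  have hN1 : N * ‖y‖ ≤ N * ε * (1 + 2 * N) * u * T := by nlinarith
  have h1 : Real.exp (ν / 2 * u) * T ≤ T' := by nlinarith
  refine ⟨?_, h1⟩
  have h2 : S' ≤ 2 * N * ((Real.exp (-(ν * u)) + N * ε * (1 + 2 * N) * u) * T) := by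
    have : 0 ≤ N * ε * (1 + 2 * N) * u * T := by positivity
    nlinarith
  refine h2.trans (mul_le_mul_of_nonneg_left ?_ (by linarith))
  nlinarith

lemma cone_stable {k : ℕ} {x y : X} (hy : ‖y‖ ≤ ε * (τ (k + 1) - τ k) * ‖x‖)
    (hc : opSup (unstableOp A τ P ν (k + 1)) (A k x + y) ≤
        2 * N * opSup (stableOp A τ P ν (k + 1)) (A k x + y)) :
    opSup (unstableOp A τ P ν k) x ≤ 2 * N * opSup (stableOp A τ P ν k) x ∧
      opSup (stableOp A τ P ν (k + 1)) (A k x + y) ≤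
        Real.exp (-(ν / 2 * (τ (k + 1) - τ k))) * opSup (stableOp A τ P ν k) x := by
  obtain ⟨e1, e2⟩ := h.exp_gap hm hL hs k
  have hu : 0 ≤ τ (k + 1) - τ k := sub_nonneg.2 (hm k.le_succ)
  have hS := opSup_nonneg (L := stableOp A τ P ν k) x
  have hT := opSup_nonneg (L := unstableOp A τ P ν k) x
  have hS' := (opSup_add_le (h.norm_stableOp_le (k + 1)) (A k x) y).trans
    (add_le_add_left (h.stable_succ k x) _)
  have hT' := (h.unstable_succ k x).trans (opSup_le_add (h.norm_unstableOp_le (k + 1)) (A k x) y)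
  have hN := h.one_le
  have hNy : N * ‖y‖ ≤ N * (ε * (τ (k + 1) - τ k) *
      (opSup (stableOp A τ P ν k) x + opSup (unstableOp A τ P ν k) x)) := by
    have := h.norm_le k x
    refine mul_le_mul_of_nonneg_left (hy.trans ?_) (by linarith)
    gcongr
  have e3 : Real.exp (-(ν / 2 * (τ (k + 1) - τ k))) ≤ 1 :=
    Real.exp_le_one_iff.2 (by have := h.pos; have : 0 ≤ ν / 2 * (τ (k + 1) - τ k) := by positivity
                              linarith)
  have e4 : 1 ≤ Real.exp (ν / 2 * (τ (k + 1) - τ k)) :=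
    Real.one_le_exp (by have := h.pos; positivity)
  have e5 := Real.exp_pos (-(ν * (τ (k + 1) - τ k)))
  have hw : 0 ≤ N * ε * (τ (k + 1) - τ k) := by positivity
  generalize opSup (stableOp A τ P ν k) x = S at *
  generalize opSup (unstableOp A τ P ν k) x = T at *
  generalize opSup (stableOp A τ P ν (k + 1)) (A k x + y) = S' at *
  generalize opSup (unstableOp A τ P ν (k + 1)) (A k x + y) = T' at *
  generalize τ (k + 1) - τ k = u at *
  have h0 : T ≤ 2 * N * S := by
    by_contra! hlt
    have hT0 : 0 < T := lt_of_le_of_lt (by positivity) hlt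
    have hN1 : 2 * N * (N * ‖y‖) ≤ N * ε * (1 + 2 * N) * u * T := by nlinarith
    have hST : S ≤ 2 * N * T := by nlinarith
    have hN2 : N * ‖y‖ ≤ N * ε * (1 + 2 * N) * u * T := by nlinarith
    have h1 : Real.exp (ν / 2 * u) * T ≤ T' := by nlinarith
    have h2 : 2 * N * S' < (Real.exp (-(ν * u)) + N * ε * (1 + 2 * N) * u) * T := by nlinarith
    nlinarith
  refine ⟨h0, ?_⟩
  have hN1 : N * ‖y‖ ≤ N * ε * (1 + 2 * N) * u * S := by nlinarith
  nlinarith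

variable {g : ℕ → X → X} (hg : ∀ n x, ‖g n x‖ ≤ ε * (τ (n + 1) - τ n) * ‖x‖) {z : ℕ → X}
  (hz : ∀ n, z (n + 1) = A n (z n) + g n (z n))
include hg hz

lemma norm_le_of_stable_cone {k n : ℕ} (hkn : k ≤ n)
    (hc : ‖z n - P n (z n)‖ ≤ 2 * ‖P n (z n)‖) :
    ‖z n‖ ≤ (1 + 2 * N) * N * Real.exp (-(ν / 2 * (τ n - τ k))) * ‖z k‖ := by
  have hN := h.one_le
  have key : ∀ j, k + j ≤ n →
      opSup (unstableOp A τ P ν (k + j)) (z (k + j)) ≤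
        2 * N * opSup (stableOp A τ P ν (k + j)) (z (k + j)) →
      opSup (stableOp A τ P ν (k + j)) (z (k + j)) ≤
        Real.exp (-(ν / 2 * (τ (k + j) - τ k))) * opSup (stableOp A τ P ν k) (z k) := by
    intro j
    induction j with
    | zero => intro _ _; simp
    | succ j ih =>
      intro hj hcj
      rw [← add_assoc, hz] at hcj ⊢
      obtain ⟨h1, h2⟩ := h.cone_stable hm hL hε hs (hg (k + j) (z (k + j))) hcj
      refine h2.trans ((mul_le_mul_of_nonneg_left (ih (by omega) h1) (Real.exp_pos _).le).trans ?_)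
      rw [← mul_assoc, ← Real.exp_add]
      apply le_of_eq
      congr 2; ring
  have hcn : opSup (unstableOp A τ P ν n) (z n) ≤ 2 * N * opSup (stableOp A τ P ν n) (z n) := by
    have h1 := h.opSup_unstable_le n (z n)
    have h2 := h.norm_proj_le n (z n)
    nlinarith
  obtain ⟨j, rfl⟩ := Nat.exists_eq_add_of_le hkn
  calc ‖z (k + j)‖ ≤ (1 + 2 * N) * opSup (stableOp A τ P ν (k + j)) (z (k + j)) := by
        linarith [h.norm_le (k + j) (z (k + j))]
    _ ≤ (1 + 2 * N) * (Real.exp (-(ν / 2 * (τ (k + j) - τ k))) * (N * ‖z k‖)) := by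
        gcongr
        exact (key j le_rfl hcn).trans (mul_le_mul_of_nonneg_left
          (opSup_le_norm (h.norm_stableOp_le k) _) (Real.exp_pos _).le)
    _ = _ := by ring

lemma norm_le_of_unstable_cone {k n : ℕ} (hnk : n ≤ k)
    (hc : ‖P n (z n)‖ ≤ 2 * ‖z n - P n (z n)‖) :
    ‖z n‖ ≤ (1 + 2 * N) * N * Real.exp (-(ν / 2 * (τ k - τ n))) * ‖z k‖ := by
  have hN := h.one_le
  have hcn : opSup (stableOp A τ P ν n) (z n) ≤ 2 * N * opSup (unstableOp A τ P ν n) (z n) := by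
    have h1 := h.opSup_stable_le n (z n)
    have h2 := h.norm_sub_proj_le n (z n)
    nlinarith
  have key : ∀ j, opSup (stableOp A τ P ν (n + j)) (z (n + j)) ≤
        2 * N * opSup (unstableOp A τ P ν (n + j)) (z (n + j)) ∧
      opSup (unstableOp A τ P ν n) (z n) ≤ Real.exp (-(ν / 2 * (τ (n + j) - τ n))) *
        opSup (unstableOp A τ P ν (n + j)) (z (n + j)) := by
    intro j
    induction j with
    | zero => simpa using hcn
    | succ j ih =>
      rw [← add_assoc, hz]
      obtain ⟨h1, h2⟩ := h.cone_unstable hm hL hε hs (hg (n + j) (z (n + j))) ih.1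
      refine ⟨h1, ih.2.trans ?_⟩
      have e : Real.exp (-(ν / 2 * (τ (n + j) - τ n))) =
          Real.exp (-(ν / 2 * (τ (n + j + 1) - τ n))) *
            Real.exp (ν / 2 * (τ (n + j + 1) - τ (n + j))) := by
        rw [← Real.exp_add]; congr 1; ring
      rw [e, mul_assoc]
      gcongr
  obtain ⟨j, rfl⟩ := Nat.exists_eq_add_of_le hnk
  calc ‖z n‖ ≤ (1 + 2 * N) * opSup (unstableOp A τ P ν n) (z n) := by
        linarith [h.norm_le n (z n)]
    _ ≤ (1 + 2 * N) * (Real.exp (-(ν / 2 * (τ (n + j) - τ n))) * (N * ‖z (n + j)‖)) := by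
        gcongr
        exact (key j).2.trans (mul_le_mul_of_nonneg_left
          (opSup_le_norm (h.norm_unstableOp_le (n + j)) _) (Real.exp_pos _).le)
    _ = _ := by ring

end IsHyp

section growth

variable (hK : 1 ≤ K) (ha : 0 ≤ a) (hEv : ∀ m k, ‖Ev A m k‖ ≤ K * Real.exp (a * |τ m - τ k|))
include hEv

lemma norm_growthOp_le (k m : ℕ) : ‖growthOp A τ a k m‖ ≤ K := by
  rw [growthOp, norm_smul, Real.norm_eq_abs, Real.abs_exp]
  calc _ ≤ Real.exp (-(a * |τ m - τ k|)) * (K * Real.exp (a * |τ m - τ k|)) := by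
        gcongr; exact hEv m k
    _ = K := by rw [mul_left_comm, ← Real.exp_add, neg_add_cancel, Real.exp_zero, mul_one]

lemma norm_le_growth (k : ℕ) (x : X) : ‖x‖ ≤ opSup (growthOp A τ a k) x := by
  simpa [growthOp] using le_opSup (norm_growthOp_le hEv k) k x

include ha in
lemma growth_le_succ (hm : Monotone τ) (k : ℕ) (x : X) :
    opSup (growthOp A τ a k) x ≤
      Real.exp (a * (τ (k + 1) - τ k)) * opSup (growthOp A τ a (k + 1)) (A k x) := by
  refine opSup_le fun m => ?_
  have h1 := le_opSup (norm_growthOp_le hEv (k + 1)) m (A k x)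
  simp only [growthOp, smul_apply, norm_smul, Real.norm_eq_abs, Real.abs_exp, Ev_succ_right] at h1 ⊢
  have hle : |τ m - τ (k + 1)| ≤ |τ m - τ k| + (τ (k + 1) - τ k) := by
    have h0 : 0 ≤ τ (k + 1) - τ k := sub_nonneg.2 (hm k.le_succ)
    have := abs_sub_le (τ m) (τ k) (τ (k + 1))
    rwa [abs_sub_comm (τ k), abs_of_nonneg h0] at this
  calc _ ≤ Real.exp (a * (τ (k + 1) - τ k)) * (Real.exp (-(a * |τ m - τ (k + 1)|)) *
        ‖Ev A m k x‖) := by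
        rw [← mul_assoc, ← Real.exp_add]
        gcongr
        nlinarith
    _ ≤ _ := by gcongr

include hK ha in
lemma norm_sub_le_backward (hm : Monotone τ) (hL : ∀ n, τ (n + 1) - τ n ≤ L) (hε : 0 ≤ ε)
    (hs : K * ε ≤ Real.exp (-((a + 1) * L))) {g : ℕ → X → X}
    (hg : ∀ n x y, ‖g n x - g n y‖ ≤ ε * (τ (n + 1) - τ n) * ‖x - y‖) {z w : ℕ → X}
    (hz : ∀ n, z (n + 1) = A n (z n) + g n (z n)) (hw : ∀ n, w (n + 1) = A n (w n) + g n (w n))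
    {n k : ℕ} (hnk : n ≤ k) :
    ‖z n - w n‖ ≤ K * Real.exp ((a + 1) * (τ k - τ n)) * ‖z k - w k‖ := by
  have key : ∀ j, opSup (growthOp A τ a n) (z n - w n) ≤ Real.exp ((a + 1) * (τ (n + j) - τ n)) *
      opSup (growthOp A τ a (n + j)) (z (n + j) - w (n + j)) := by
    intro j
    induction j with
    | zero => simp
    | succ j ih =>
      refine ih.trans ?_
      rw [← add_assoc]
      have h0 : 0 ≤ τ (n + j + 1) - τ (n + j) := sub_nonneg.2 (hm (n + j).le_succ)
      have h1 := growth_le_succ ha hEv hm (n + j) (z (n + j) - w (n + j))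
      have h2 := opSup_le_add (norm_growthOp_le hEv (n + j + 1)) (A (n + j) (z (n + j) - w (n + j)))
        (g (n + j) (z (n + j)) - g (n + j) (w (n + j)))
      have e : A (n + j) (z (n + j) - w (n + j)) +
          (g (n + j) (z (n + j)) - g (n + j) (w (n + j))) = z (n + j + 1) - w (n + j + 1) := by
        rw [hz, hw, map_sub]; abel
      rw [e] at h2
      have h3 := hg (n + j) (z (n + j)) (w (n + j))
      have h4 := norm_le_growth hEv (n + j) (z (n + j) - w (n + j))
      have h5 := hL (n + j)
      have e2 : Real.exp ((a + 1) * (τ (n + j + 1) - τ n)) = Real.exp ((a + 1) * (τ (n + j) - τ n))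
          * Real.exp ((a + 1) * (τ (n + j + 1) - τ (n + j))) := by
        rw [← Real.exp_add]; congr 1; ring
      rw [e2, mul_assoc]
      refine mul_le_mul_of_nonneg_left ?_ (Real.exp_pos _).le
      have hV := opSup_nonneg (L := growthOp A τ a (n + j)) (z (n + j) - w (n + j))
      have hV' := opSup_nonneg (L := growthOp A τ a (n + j + 1)) (z (n + j + 1) - w (n + j + 1))
      generalize opSup (growthOp A τ a (n + j)) (z (n + j) - w (n + j)) = V at *
      generalize opSup (growthOp A τ a (n + j + 1)) (z (n + j + 1) - w (n + j + 1)) = V' at *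
      generalize τ (n + j + 1) - τ (n + j) = u at *
      have h6 : K * ‖g (n + j) (z (n + j)) - g (n + j) (w (n + j))‖ ≤
          Real.exp (-((a + 1) * L)) * u * V := by
        calc _ ≤ K * (ε * u * V) := by
              refine mul_le_mul_of_nonneg_left (h3.trans ?_) (by linarith)
              gcongr
          _ = K * ε * (u * V) := by ring
          _ ≤ Real.exp (-((a + 1) * L)) * (u * V) := by gcongr
          _ = _ := by ring
      have e3 : Real.exp (a * u) * Real.exp (-((a + 1) * L)) * u ≤ 1 - Real.exp (-u) := by
        have : Real.exp (a * u) * Real.exp (-((a + 1) * L)) ≤ Real.exp (-u) := by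
          rw [← Real.exp_add]
          exact Real.exp_le_exp.2 (by nlinarith)
        have h7 := Real.add_one_le_exp u
        have h8 : Real.exp (-u) * Real.exp u = 1 := by rw [← Real.exp_add]; simp
        nlinarith [Real.exp_pos (-u)]
      have h9 : V ≤ Real.exp (a * u) * V' + (1 - Real.exp (-u)) * V := by
        have := mul_le_mul_of_nonneg_left (h2.trans (add_le_add_right h6 _)) (Real.exp_pos (a * u)).le
        nlinarith
      have h10 : Real.exp (-u) * V ≤ Real.exp (a * u) * V' := by linarith
      have e4 : Real.exp ((a + 1) * u) = Real.exp u * Real.exp (a * u) := by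
        rw [← Real.exp_add]; congr 1; ring
      have e5 : Real.exp u * Real.exp (-u) = 1 := by rw [← Real.exp_add]; simp
      rw [e4, mul_assoc]
      calc V = Real.exp u * (Real.exp (-u) * V) := by rw [← mul_assoc, e5, one_mul]
        _ ≤ _ := by gcongr
  obtain ⟨j, rfl⟩ := Nat.exists_eq_add_of_le hnk
  calc _ ≤ opSup (growthOp A τ a n) (z n - w n) := norm_le_growth hEv _ _
    _ ≤ _ := key j
    _ ≤ Real.exp ((a + 1) * (τ (n + j) - τ n)) * (K * ‖z (n + j) - w (n + j)‖) := by
        gcongr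
        exact opSup_le_norm (norm_growthOp_le hEv _) _
    _ = _ := by ring

end growth

section Homeo

variable {E : Type*} [NormedAddCommGroup E] [NormedSpace ℝ E] [FiniteDimensional ℝ E]

/-- A small Lipschitz perturbation of a linear isomorphism is a global diffeomorphism. -/
lemma exists_homeomorph_add (A : E ≃L[ℝ] E) {f : E → E} {l : ℕ} (hl : 1 ≤ l)
    (hf : ContDiff ℝ l f) {c : ℝ} (hc0 : 0 ≤ c) (hlip : ∀ x y, ‖f x - f y‖ ≤ c * ‖x - y‖)
    (hc : ‖(A.symm : E →L[ℝ] E)‖ * c < 1) :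
    ∃ U : E ≃ₜ E, (∀ x, U x = A x + f x) ∧ ContDiff ℝ l U ∧ ContDiff ℝ l U.symm := by
  have : CompleteSpace E := FiniteDimensional.complete ℝ E
  have happ : ApproximatesLinearOn (fun x => A x + f x) (A : E →L[ℝ] E) univ c.toNNReal := by
    intro x _ y _
    have e : A x + f x - (A y + f y) - (A : E →L[ℝ] E) (x - y) = f x - f y := by
      simp; abel
    rw [e]
    rw [Real.coe_toNNReal c hc0]
    exact hlip x y
  have hcc : Subsingleton E ∨ c.toNNReal < ‖(A.symm : E →L[ℝ] E)‖₊⁻¹ := by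
    rcases subsingleton_or_nontrivial E with h | h
    · exact Or.inl h
    · right
      have h1 : 0 < ‖(A.symm : E →L[ℝ] E)‖₊ := by
        rw [pos_iff_ne_zero, Ne, nnnorm_eq_zero]
        intro h0
        obtain ⟨x, hx⟩ := exists_ne (0 : E)
        have := DFunLike.congr_fun h0 x
        exact hx (A.symm.injective (by simpa using this))
      rw [← NNReal.coe_lt_coe, Real.coe_toNNReal c hc0, NNReal.coe_inv, coe_nnnorm]
      rw [← NNReal.coe_pos, coe_nnnorm] at h1
      exact (lt_inv_mul_iff₀ h1).2 hc |>.trans_eq (mul_one _)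
  let U := happ.toHomeomorph _ hcc
  have hU : ∀ x, U x = A x + f x := fun x => rfl
  have hUc : ContDiff ℝ l U := A.contDiff.add hf
  refine ⟨U, hU, hUc, ?_⟩
  have hinj : ∀ x, Function.Injective ((A : E →L[ℝ] E) + fderiv ℝ f x).toLinearMap := by
    intro x
    rw [← LinearMap.ker_eq_bot, LinearMap.ker_eq_bot']
    intro v hv
    have hfd : ‖fderiv ℝ f x‖ ≤ c :=
      norm_fderiv_le_of_lip' ℝ hc0 (Eventually.of_forall fun y => hlip y x)
    have h1 : A v = -(fderiv ℝ f x v) := eq_neg_of_add_eq_zero_left hv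
    have h2 : ‖v‖ ≤ ‖(A.symm : E →L[ℝ] E)‖ * (c * ‖v‖) := by
      calc ‖v‖ = ‖(A.symm : E →L[ℝ] E) (A v)‖ := by simp
        _ ≤ ‖(A.symm : E →L[ℝ] E)‖ * ‖A v‖ := ContinuousLinearMap.le_opNorm _ _
        _ ≤ _ := by
          gcongr
          rw [h1, norm_neg]
          exact ContinuousLinearMap.le_of_opNorm_le _ hfd v
    by_contra hv0
    have := norm_pos_iff.2 hv0
    nlinarith
  refine U.contDiff_symm (f₀' := fun x =>
    (LinearEquiv.ofInjectiveEndo _ (hinj x)).toContinuousLinearEquiv) (fun x => ?_) hUc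
  have h1 : HasFDerivAt (fun x => A x + f x) ((A : E →L[ℝ] E) + fderiv ℝ f x) x :=
    A.hasFDerivAt.add ((hf.differentiable (by exact_mod_cast (by omega : l ≠ 0))) x).hasFDerivAt
  have e : ((LinearEquiv.ofInjectiveEndo _ (hinj x)).toContinuousLinearEquiv : E →L[ℝ] E) =
      (A : E →L[ℝ] E) + fderiv ℝ f x := by
    ext v; rfl
  rw [e]
  exact h1

end Homeo

section Flow

variable {A : ℕ → X ≃L[ℝ] X} {g : ℕ → X → X} {U : ℕ → X ≃ₜ X}

def flowZero (U : ℕ → X ≃ₜ X) : ℕ → X ≃ₜ X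
  | 0 => Homeomorph.refl X
  | n + 1 => (flowZero U n).trans (U n)

/-- The two-sided nonlinear evolution from time `k` to time `n`. -/
def flow (U : ℕ → X ≃ₜ X) (n k : ℕ) (x : X) : X := flowZero U n ((flowZero U k).symm x)

omit [NormedSpace ℝ X] in
@[simp] lemma flow_self (k : ℕ) (x : X) : flow U k k x = x := by simp [flow]

omit [NormedSpace ℝ X] in
lemma flow_succ (n k : ℕ) (x : X) : flow U (n + 1) k x = U n (flow U n k x) := rfl

omit [NormedSpace ℝ X] in
lemma flow_apply_succ (n k : ℕ) (x : X) : flow U n (k + 1) (U k x) = flow U n k x := by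
  simp [flow, flowZero]

lemma contDiff_flow {l : ℕ} (h : ∀ n, ContDiff ℝ l (U n)) (h' : ∀ n, ContDiff ℝ l (U n).symm)
    (n k : ℕ) : ContDiff ℝ l (flow U n k) := by
  have h1 : ∀ n, ContDiff ℝ l (flowZero U n) := by
    intro n
    induction n with
    | zero => exact contDiff_id
    | succ n ih => exact (h n).comp ih
  have h2 : ∀ n, ContDiff ℝ l (flowZero U n).symm := by
    intro n
    induction n with
    | zero => exact contDiff_id
    | succ n ih => exact ih.comp (h' n)
  exact (h1 n).comp (h2 k)

lemma flow_eq_sum (hU : ∀ n x, U n x = A n x + g n x) {k n : ℕ} (hkn : k ≤ n) (x : X) :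
    flow U n k x = Ev A n k x + ∑ j ∈ Finset.Ico k n, Ev A n (j + 1) (g j (flow U j k x)) := by
  induction n, hkn using Nat.le_induction with
  | base => simp
  | succ n hkn ih =>
    rw [flow_succ, hU, Finset.sum_Ico_succ_top hkn, Ev_self, one_apply_eq_self]
    nth_rewrite 1 [ih]
    rw [map_add, map_sum, Ev_succ_left, add_assoc]
    simp only [Ev_succ_left]

end Flow

section FlowBounds

variable {A : ℕ → X ≃L[ℝ] X} {τ : ℕ → ℝ} {g : ℕ → X → X} {U : ℕ → X ≃ₜ X} {K a ε L : ℝ} {l : ℕ}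

lemma norm_iteratedFDeriv_clm_le (T : X →L[ℝ] X) (i : ℕ) (hi : 1 ≤ i) (x : X) :
    ‖iteratedFDeriv ℝ i (fun y => T y) x‖ ≤ if i = 1 then ‖T‖ else 0 := by
  obtain ⟨i, rfl⟩ := Nat.exists_eq_add_of_le' hi
  have e : fderiv ℝ (fun y => T y) = fun _ => T := funext fun x => T.fderiv
  rw [← norm_iteratedFDeriv_fderiv, e]
  split_ifs with h
  · have : i = 0 := by omega
    subst this
    rw [norm_iteratedFDeriv_zero]
  · rw [iteratedFDeriv_const_of_ne (by omega)]
    simp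

lemma norm_iteratedFDeriv_flow_le (hm : Monotone τ) (hK : 1 ≤ K) (ha : 0 ≤ a) (hε : 0 ≤ ε)
    (hEv : ∀ m k, ‖Ev A m k‖ ≤ K * Real.exp (a * |τ m - τ k|))
    (hU : ∀ n x, U n x = A n x + g n x) (hg : ∀ n, ContDiff ℝ l (g n))
    (hgb : ∀ n, ∀ i ≤ l, ∀ x, ‖iteratedFDeriv ℝ i (g n) x‖ ≤ ε * (τ (n + 1) - τ n))
    (hf : ∀ n k, ContDiff ℝ l (flow U n k)) (hs : (l.factorial : ℝ) * (K * ε) ≤ 1 / 2)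
    {k n : ℕ} (hkn : k ≤ n) {i : ℕ} (hi : 1 ≤ i) (hil : i ≤ l) (x : X) :
    ‖iteratedFDeriv ℝ i (flow U n k) x‖ ≤ (2 * K * Real.exp ((a + 1) * (τ n - τ k))) ^ i := by
  induction n using Nat.strong_induction_on generalizing i with
  | _ n ih =>
  have hδ : ∀ n, 0 ≤ τ (n + 1) - τ n := fun n => sub_nonneg.2 (hm n.le_succ)
  have e : flow U n k = fun x => (fun y => Ev A n k y) x +
      ∑ j ∈ Finset.Ico k n, Ev A n (j + 1) ((g j ∘ flow U j k) x) :=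
    funext fun x => flow_eq_sum hU hkn x
  have hterm : ∀ j, ContDiff ℝ i (fun x => Ev A n (j + 1) ((g j ∘ flow U j k) x)) := fun j =>
    (Ev A n (j + 1)).contDiff.comp
      (((hg j).comp (hf j k)).of_le (by exact_mod_cast hil))
  set b := 2 * K * Real.exp ((a + 1) * (τ n - τ k)) with hb
  have hkn' := sub_nonneg.2 (hm hkn)
  have hb1 : 1 ≤ b := by
    have : 1 ≤ Real.exp ((a + 1) * (τ n - τ k)) := Real.one_le_exp (by positivity)
    nlinarith
  have hbi : b ≤ b ^ i := le_self_pow₀ hb1 (by omega)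
  have h1 : ‖iteratedFDeriv ℝ i (fun y => Ev A n k y) x‖ ≤ 1 / 2 * b ^ i := by
    refine (norm_iteratedFDeriv_clm_le _ i hi x).trans ?_
    split_ifs with h
    · calc _ ≤ K * Real.exp (a * |τ n - τ k|) := hEv n k
        _ ≤ K * Real.exp ((a + 1) * (τ n - τ k)) := by
          rw [abs_of_nonneg hkn']
          gcongr
          linarith
        _ = 1 / 2 * b := by rw [hb]; ring
        _ ≤ _ := by linarith
    · positivity
  have h2 : ∀ j ∈ Finset.Ico k n,
      ‖iteratedFDeriv ℝ i (fun x => Ev A n (j + 1) ((g j ∘ flow U j k) x)) x‖ ≤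
        (l.factorial : ℝ) * (K * ε) * b ^ i *
          ((τ (j + 1) - τ j) * Real.exp (-1 * (τ n - τ j))) := by
    intro j hj
    obtain ⟨hkj, hjn⟩ := Finset.mem_Ico.1 hj
    have hjn' := sub_nonneg.2 (hm hjn.le)
    have hkj' := sub_nonneg.2 (hm hkj)
    have hc := norm_iteratedFDeriv_comp_le (𝕜 := ℝ) (hg j) (hf j k) (n := i)
      (by exact_mod_cast hil) x (C := ε * (τ (j + 1) - τ j))
      (D := 2 * K * Real.exp ((a + 1) * (τ j - τ k)))
      (fun i' hi' => hgb j i' (hi'.trans hil) _)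
      (fun i' hi' hi'' => ih j hjn hkj hi' (hi''.trans hil))
    have hE : ‖Ev A n (j + 1)‖ ≤ K * Real.exp (a * (τ n - τ j)) := by
      refine (hEv n (j + 1)).trans ?_
      rw [abs_of_nonneg (sub_nonneg.2 (hm hjn))]
      have := hδ j
      gcongr
      linarith
    have hbj : (2 * K * Real.exp ((a + 1) * (τ j - τ k))) ^ i ≤
        b ^ i * Real.exp (-((a + 1) * (τ n - τ j))) := by
      have : 2 * K * Real.exp ((a + 1) * (τ j - τ k)) =
          b * Real.exp (-((a + 1) * (τ n - τ j))) := by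
        rw [hb, mul_assoc _ (Real.exp _) (Real.exp _), ← Real.exp_add]
        congr 2; ring
      rw [this, mul_pow]
      gcongr
      have h3 : Real.exp (-((a + 1) * (τ n - τ j))) ≤ 1 :=
        Real.exp_le_one_iff.2 (neg_nonpos.2 (by positivity))
      exact pow_le_of_le_one (Real.exp_pos _).le h3 (by omega)
    have hfac : (i.factorial : ℝ) ≤ l.factorial := by exact_mod_cast Nat.factorial_le hil
    have hδj := hδ j
    calc _ ≤ ‖Ev A n (j + 1)‖ * ‖iteratedFDeriv ℝ i (g j ∘ flow U j k) x‖ :=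
          (Ev A n (j + 1)).norm_iteratedFDeriv_comp_left
            (((hg j).comp (hf j k)).of_le (by exact_mod_cast hil)).contDiffAt le_rfl
      _ ≤ (K * Real.exp (a * (τ n - τ j))) * (l.factorial * (ε * (τ (j + 1) - τ j)) *
          (b ^ i * Real.exp (-((a + 1) * (τ n - τ j))))) := by
          refine mul_le_mul hE (hc.trans ?_) (norm_nonneg _) (by positivity)
          gcongr
      _ = l.factorial * (K * ε) * b ^ i * ((τ (j + 1) - τ j) *
          (Real.exp (a * (τ n - τ j)) * Real.exp (-((a + 1) * (τ n - τ j))))) := by ring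
      _ = _ := by
          rw [← Real.exp_add]
          congr 3; ring
  rw [e, fun_iteratedFDeriv_add_apply (by fun_prop) (ContDiff.sum fun j _ => hterm j).contDiffAt,
    iteratedFDeriv_fun_sum_apply fun j _ => (hterm j).contDiffAt]
  have h3 : ∑ j ∈ Finset.Ico k n, (τ (j + 1) - τ j) * Real.exp (-1 * (τ n - τ j)) ≤ 1 := by
    refine le_trans ?_ ((sum_past_le (τ := τ) one_pos n).trans_eq (by norm_num))
    refine Finset.sum_le_sum_of_subset_of_nonneg (fun j hj => ?_) fun j _ _ =>
      mul_nonneg (hδ j) (Real.exp_pos _).le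
    exact Finset.mem_range.2 (Finset.mem_Ico.1 hj).2
  calc _ ≤ 1 / 2 * b ^ i + ∑ j ∈ Finset.Ico k n, (l.factorial : ℝ) * (K * ε) * b ^ i *
          ((τ (j + 1) - τ j) * Real.exp (-1 * (τ n - τ j))) :=
        (norm_add_le _ _).trans (add_le_add h1 ((norm_sum_le _ _).trans (Finset.sum_le_sum h2)))
    _ ≤ 1 / 2 * b ^ i + 1 / 2 * b ^ i * 1 := by
        rw [← Finset.mul_sum]
        have h4 : 0 ≤ ∑ j ∈ Finset.Ico k n, (τ (j + 1) - τ j) * Real.exp (-1 * (τ n - τ j)) :=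
          Finset.sum_nonneg fun j _ => mul_nonneg (hδ j) (Real.exp_pos _).le
        gcongr
    _ = b ^ i := by ring

/-- Derivatives of a flat function transported along an evolution operator. -/
lemma norm_iteratedFDeriv_transport_le {R φ : X → X} (hR : ContDiff ℝ l R) (hφ : ContDiff ℝ l φ)
    {m q : ℕ} (hml : m ≤ l) {x : X} {s D c κ : ℝ} {T : X →L[ℝ] X} (hs : 0 ≤ s) (hK : 1 ≤ K)
    (ha : 0 ≤ a) (hD : 0 ≤ D) (hc : 0 ≤ c) (hκ : a + l * (a + 1) + 1 ≤ κ * q)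
    (hT : ‖T‖ ≤ K * Real.exp (a * s))
    (hφb : ∀ i, 1 ≤ i → i ≤ m → ‖iteratedFDeriv ℝ i φ x‖ ≤ (2 * K * Real.exp ((a + 1) * s)) ^ i)
    (hRb : ∀ i ≤ l, ∀ y, ‖iteratedFDeriv ℝ i R y‖ ≤ D * ‖y‖ ^ q)
    (hcone : ∀ i, iteratedFDeriv ℝ i R (φ x) ≠ 0 → ‖φ x‖ ≤ c * Real.exp (-(κ * s)) * ‖x‖)
    {i : ℕ} (hi : i ≤ m) :
    ‖iteratedFDeriv ℝ i (fun y => T (R (φ y))) x‖ ≤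
      K * l.factorial * c ^ q * (2 * K) ^ l * D * Real.exp (-s) * ‖x‖ ^ q := by
  have hil := hi.trans hml
  have h1 := norm_iteratedFDeriv_comp_le (𝕜 := ℝ) hR hφ (n := i)
    (by exact_mod_cast hil) x (C := D * (c * Real.exp (-(κ * s)) * ‖x‖) ^ q)
    (D := 2 * K * Real.exp ((a + 1) * s)) (fun j hj => ?_)
    (fun j hj hj' => hφb j hj (hj'.trans hi))
  swap
  · by_cases h0 : iteratedFDeriv ℝ j R (φ x) = 0
    · rw [h0, norm_zero]; positivity
    · refine (hRb j (hj.trans hil) _).trans ?_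
      have := hcone j h0
      gcongr
  have hfac : (i.factorial : ℝ) ≤ l.factorial := by exact_mod_cast Nat.factorial_le hil
  have hb1 : 1 ≤ 2 * K * Real.exp ((a + 1) * s) := by
    have : 1 ≤ Real.exp ((a + 1) * s) := Real.one_le_exp (by positivity)
    nlinarith
  have hb : (2 * K * Real.exp ((a + 1) * s)) ^ i ≤ (2 * K) ^ l * Real.exp (l * ((a + 1) * s)) := by
    rw [Real.exp_nat_mul, ← mul_pow]
    exact pow_le_pow_right₀ hb1 hil
  calc _ ≤ ‖T‖ * ‖iteratedFDeriv ℝ i (R ∘ φ) x‖ :=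
        T.norm_iteratedFDeriv_comp_left ((hR.comp hφ).of_le (by exact_mod_cast hil)).contDiffAt le_rfl
    _ ≤ (K * Real.exp (a * s)) * (l.factorial * (D * (c * Real.exp (-(κ * s)) * ‖x‖) ^ q) *
          ((2 * K) ^ l * Real.exp (l * ((a + 1) * s)))) := by
        refine mul_le_mul hT (h1.trans ?_) (norm_nonneg _) (by positivity)
        gcongr
    _ = K * l.factorial * c ^ q * (2 * K) ^ l * D * (Real.exp (a * s) *
          (Real.exp (q * -(κ * s)) * Real.exp (l * ((a + 1) * s)))) * ‖x‖ ^ q := by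
        rw [mul_pow, mul_pow, Real.exp_nat_mul (-(κ * s)) q]; ring
    _ ≤ _ := by
        rw [← Real.exp_add, ← Real.exp_add]
        gcongr
        nlinarith [mul_le_mul_of_nonneg_right hκ hs]

end FlowBounds

section Solution

variable {E : Type*} [NormedAddCommGroup E] [InnerProductSpace ℝ E] [FiniteDimensional ℝ E]
  {A : ℕ → E ≃L[ℝ] E} {τ : ℕ → ℝ} {g : ℕ → E → E} {U : ℕ → E ≃ₜ E} {K a ε L N ν D : ℝ} {l q : ℕ}
  {P : ℕ → E →L[ℝ] E} {R : ℕ → E → E}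

/-- Contribution of the remainder at time `n` to the solution at time `k`. -/
def solTerm (A : ℕ → E ≃L[ℝ] E) (U : ℕ → E ≃ₜ E) (R : ℕ → E → E) (k n : ℕ) (x : E) : E :=
  Ev A k (n + 1) (R n (flow U n k x))

omit [FiniteDimensional ℝ E] in
lemma solTerm_succ (k n : ℕ) (x : E) :
    solTerm A U R (k + 1) n (U k x) = A k (solTerm A U R k n x) := by
  rw [solTerm, solTerm, flow_apply_succ, Ev_succ_left]

omit [FiniteDimensional ℝ E] in
lemma apply_solTerm_self (k : ℕ) (x : E) : A k (solTerm A U R k k x) = R k x := by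
  rw [solTerm, flow_self, Ev_succ_left, Ev_self, one_apply_eq_self]

omit [FiniteDimensional ℝ E] in
lemma contDiff_solTerm (hR : ∀ n, ContDiff ℝ l (R n)) (hf : ∀ n k, ContDiff ℝ l (flow U n k))
    (k n : ℕ) : ContDiff ℝ l (solTerm A U R k n) :=
  (Ev A k (n + 1)).contDiff.comp ((hR n).comp (hf n k))

omit [FiniteDimensional ℝ E] in
lemma norm_iteratedFDeriv_solTerm_future_le (h : IsHyp A τ P N ν) (hm : Monotone τ)
    (hL : ∀ n, τ (n + 1) - τ n ≤ L) (hK : 1 ≤ K) (ha : 0 ≤ a) (hε : 0 ≤ ε)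
    (hEv : ∀ m k, ‖Ev A m k‖ ≤ K * Real.exp (a * |τ m - τ k|))
    (hU : ∀ n x, U n x = A n x + g n x) (hg : ∀ n, ContDiff ℝ l (g n))
    (hgb : ∀ n, ∀ i ≤ l, ∀ x, ‖iteratedFDeriv ℝ i (g n) x‖ ≤ ε * (τ (n + 1) - τ n))
    (hg1 : ∀ n x, ‖g n x‖ ≤ ε * (τ (n + 1) - τ n) * ‖x‖)
    (hf : ∀ n k, ContDiff ℝ l (flow U n k)) (hs : (l.factorial : ℝ) * (K * ε) ≤ 1 / 2)
    (hs' : N * ε * (1 + 2 * N) ≤ Real.exp (-(ν * L)) * (ν / 2)) (hD : 0 ≤ D)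
    (hκ : a + l * (a + 1) + 1 ≤ ν / 2 * q)
    (hR : ∀ n, ContDiff ℝ l (R n))
    (hRb : ∀ n, ∀ i ≤ l, ∀ x, ‖iteratedFDeriv ℝ i (R n) x‖ ≤ D * (τ (n + 1) - τ n) * ‖x‖ ^ q)
    (hc : ∀ n i x, iteratedFDeriv ℝ i (R n) x ≠ 0 → ‖x - P n x‖ ≤ 2 * ‖P n x‖)
    {k n i : ℕ} (hkn : k ≤ n) (hi : i ≤ l) (x : E) :
    ‖iteratedFDeriv ℝ i (solTerm A U R k n) x‖ ≤
      K * Real.exp (a * L) * l.factorial * ((1 + 2 * N) * N) ^ q *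
        (2 * (K * Real.exp (a * L))) ^ l * D *
        ((τ (n + 1) - τ n) * Real.exp (-1 * (τ n - τ k))) * ‖x‖ ^ q := by
  have hδ : ∀ n, 0 ≤ τ (n + 1) - τ n := fun n => sub_nonneg.2 (hm n.le_succ)
  have hL0 : 0 ≤ L := (hδ 0).trans (hL 0)
  have he : 1 ≤ Real.exp (a * L) := Real.one_le_exp (by positivity)
  have hN := h.one_le
  have hkn' := sub_nonneg.2 (hm hkn)
  have := norm_iteratedFDeriv_transport_le (a := a) (l := l) (m := l) (q := q) (x := x)
    (s := τ n - τ k) (D := D * (τ (n + 1) - τ n)) (c := (1 + 2 * N) * N) (κ := ν / 2)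
    (K := K * Real.exp (a * L)) (T := Ev A k (n + 1)) (hR n) (hf n k) le_rfl hkn'
    (by nlinarith) ha (mul_nonneg hD (hδ n)) (by positivity) hκ ?_ ?_ (hRb n) ?_ hi
  · refine this.trans_eq ?_
    rw [neg_one_mul]; ring
  · refine (hEv k (n + 1)).trans ?_
    rw [abs_sub_comm, abs_of_nonneg (sub_nonneg.2 (hm (by omega))), mul_assoc, ← Real.exp_add]
    gcongr
    nlinarith [hL n]
  · intro i hi1 hil
    refine (norm_iteratedFDeriv_flow_le hm hK ha hε hEv hU hg hgb hf hs hkn hi1 hil x).trans ?_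
    gcongr
    exact le_mul_of_one_le_right (by positivity) he
  · intro i hi
    have := h.norm_le_of_stable_cone (z := fun j => flow U j k x) hm hL hε hs' hg1
      (fun n => by rw [flow_succ, hU]) hkn (hc n i _ hi)
    rwa [flow_self] at this

omit [FiniteDimensional ℝ E] in
lemma norm_iteratedFDeriv_solTerm_past_le (h : IsHyp A τ P N ν) (hm : Monotone τ)
    (hL : ∀ n, τ (n + 1) - τ n ≤ L) (hK : 1 ≤ K) (ha : 0 ≤ a) (hε : 0 ≤ ε) (hl : 1 ≤ l)
    (hEv : ∀ m k, ‖Ev A m k‖ ≤ K * Real.exp (a * |τ m - τ k|))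
    (hU : ∀ n x, U n x = A n x + g n x)
    (hg2 : ∀ n x y, ‖g n x - g n y‖ ≤ ε * (τ (n + 1) - τ n) * ‖x - y‖)
    (hg1 : ∀ n x, ‖g n x‖ ≤ ε * (τ (n + 1) - τ n) * ‖x‖)
    (hf : ∀ n k, ContDiff ℝ l (flow U n k)) (hs : K * ε ≤ Real.exp (-((a + 1) * L)))
    (hs' : N * ε * (1 + 2 * N) ≤ Real.exp (-(ν * L)) * (ν / 2)) (hD : 0 ≤ D)
    (hκ : a + l * (a + 1) + 1 ≤ ν / 2 * q)
    (hR : ∀ n, ContDiff ℝ l (R n))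
    (hRb : ∀ n, ∀ i ≤ l, ∀ x, ‖iteratedFDeriv ℝ i (R n) x‖ ≤ D * (τ (n + 1) - τ n) * ‖x‖ ^ q)
    (hc : ∀ n i x, iteratedFDeriv ℝ i (R n) x ≠ 0 → ‖P n x‖ ≤ 2 * ‖x - P n x‖)
    {k n i : ℕ} (hnk : n < k) (hi : i ≤ 1) (x : E) :
    ‖iteratedFDeriv ℝ i (solTerm A U R k n) x‖ ≤
      K * l.factorial * ((1 + 2 * N) * N) ^ q * (2 * K) ^ l * D *
        ((τ (n + 1) - τ n) * Real.exp (-1 * (τ k - τ n))) * ‖x‖ ^ q := by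
  have hδ : ∀ n, 0 ≤ τ (n + 1) - τ n := fun n => sub_nonneg.2 (hm n.le_succ)
  have hN := h.one_le
  have hnk' := sub_nonneg.2 (hm hnk.le)
  have := norm_iteratedFDeriv_transport_le (a := a) (l := l) (m := 1) (q := q) (x := x)
    (s := τ k - τ n) (D := D * (τ (n + 1) - τ n)) (c := (1 + 2 * N) * N) (κ := ν / 2)
    (K := K) (T := Ev A k (n + 1)) (hR n) (hf n k) hl hnk'
    hK ha (mul_nonneg hD (hδ n)) (by positivity) hκ ?_ ?_ (hRb n) ?_ hi
  · refine this.trans_eq ?_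
    rw [neg_one_mul]; ring
  · refine (hEv k (n + 1)).trans ?_
    rw [abs_of_nonneg (sub_nonneg.2 (hm (by omega)))]
    gcongr
    exact hm n.le_succ
  · intro i hi1 hil
    obtain rfl : i = 1 := by omega
    rw [norm_iteratedFDeriv_one, pow_one]
    refine norm_fderiv_le_of_lip' ℝ (by positivity) (Eventually.of_forall fun y => ?_)
    have := norm_sub_le_backward (z := fun j => flow U j k y) (w := fun j => flow U j k x)
      hK ha hEv hm hL hε hs hg2
      (fun n => by rw [flow_succ, hU]) (fun n => by rw [flow_succ, hU]) hnk.le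
    rw [flow_self, flow_self] at this
    refine this.trans ?_
    gcongr
    linarith
  · intro i hi
    have := h.norm_le_of_unstable_cone (z := fun j => flow U j k x) hm hL hε hs' hg1
      (fun n => by rw [flow_succ, hU]) hnk.le (hc n i _ hi)
    rwa [flow_self] at this

/-- Superposition of future contributions. -/
lemma exists_future_sol (hm : Monotone τ) (hL : ∀ n, τ (n + 1) - τ n ≤ L) (hq : 2 ≤ q) (hD : 0 ≤ D)
    (hT : ∀ k n, ContDiff ℝ l (solTerm A U R k n))
    (hb : ∀ k n, k ≤ n → ∀ i ≤ l, ∀ x, ‖iteratedFDeriv ℝ i (solTerm A U R k n) x‖ ≤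
      D * ((τ (n + 1) - τ n) * Real.exp (-1 * (τ n - τ k))) * ‖x‖ ^ q) :
    ∃ (ψ : ℕ → E → E) (C : ℝ), (∀ k, IsFlat l 2 C (ψ k)) ∧ ∀ k x, ‖x‖ ≤ 1 / 2 → ‖U k x‖ ≤ 1 / 2 →
      ψ (k + 1) (U k x) = A k (ψ k x) - R k x := by
  obtain ⟨B, hB1, hB⟩ := exists_isFlat_cutoff E l
  have hδ : ∀ n, 0 ≤ τ (n + 1) - τ n := fun n => sub_nonneg.2 (hm n.le_succ)
  set w : ℕ → ℕ → ℝ := fun k j => (τ (k + j + 1) - τ (k + j)) * Real.exp (-1 * (τ (k + j) - τ k))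
    with hw
  have hw0 : ∀ k j, 0 ≤ w k j := fun k j => mul_nonneg (hδ _) (Real.exp_pos _).le
  set f : ℕ → ℕ → E → E := fun k j x => cutoff E x • solTerm A U R k (k + j) x with hfdef
  have hflat : ∀ k j, IsFlat l 2 (2 ^ l * B * (D * w k j)) (f k j) := fun k j => by
    refine IsFlat.cutoff_smul hB ⟨mul_nonneg hD (hw0 k j), hT _ _, fun i hi x hx => ?_⟩
    refine (hb k (k + j) (by omega) i hi x).trans ?_
    refine mul_le_mul_of_nonneg_left ?_ (mul_nonneg hD (hw0 k j))
    exact pow_le_pow_of_le_one (norm_nonneg _) hx (by omega)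
  have hglob : ∀ k j, ∀ i ≤ l, ∀ x, ‖iteratedFDeriv ℝ i (f k j) x‖ ≤ 2 ^ l * B * (D * w k j) :=
    fun k j i hi x => (hflat k j).norm_iteratedFDeriv_le
      (fun x hx => by rw [hfdef]; simp only [cutoff_eq_zero hx, zero_smul]) hi x
  have hsum : ∀ k, Summable fun j => 2 ^ l * B * (D * w k j) := fun k =>
    ((summable_future hm hL one_pos k).mul_left D).mul_left _
  have hsum' : ∀ k, ∑' j, 2 ^ l * B * (D * w k j) ≤ 2 ^ l * B * (D * (Real.exp (1 * L) / 1)) := by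
    intro k
    rw [tsum_mul_left, tsum_mul_left]
    have := tsum_future_le hm hL one_pos k
    gcongr
  have hcf : ∀ k j, ContDiff ℝ l (f k j) := fun k j => (hflat k j).contDiff
  refine ⟨fun k x => ∑' j, f k j x, 2 ^ l * B * (D * (Real.exp (1 * L) / 1)), fun k => ?_, ?_⟩
  · refine ⟨by positivity, ?_, fun i hi x hx => ?_⟩
    · exact contDiff_tsum (v := fun _ j => 2 ^ l * B * (D * w k j)) (hcf k) (fun _ _ => hsum k)
        fun i j x hi => hglob k j i (by exact_mod_cast hi) x
    · rw [iteratedFDeriv_tsum_apply (v := fun _ j => 2 ^ l * B * (D * w k j)) (N := l) (hcf k)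
        (fun _ _ => hsum k) (fun i j x hi => hglob k j i (by exact_mod_cast hi) x)
        (by exact_mod_cast hi)]
      refine (tsum_of_norm_bounded ((hsum k).hasSum.mul_right (‖x‖ ^ (2 - i)))
        fun j => (hflat k j).bound i hi x hx).trans ?_
      gcongr
      exact hsum' k
  · intro k x hx hUx
    have e1 : ∀ j, f (k + 1) j (U k x) = A k (f k (j + 1) x) := fun j => by
      simp only [hfdef, cutoff_eq_one hx, cutoff_eq_one hUx, one_smul]
      rw [solTerm_succ, show k + 1 + j = k + (j + 1) by omega]
    have hs : Summable fun j => f k j x := by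
      refine Summable.of_norm_bounded (hsum k) fun j => ?_
      simpa using hglob k j 0 (Nat.zero_le _) x
    have e0 : A k (f k 0 x) = R k x := by
      simp only [hfdef, cutoff_eq_one hx, one_smul, add_zero, apply_solTerm_self]
    simp only [e1]
    rw [hs.tsum_eq_zero_add, map_add, e0, add_sub_cancel_left]
    exact ((A k).map_tsum (f := fun j => f k (j + 1) x)).symm

omit [FiniteDimensional ℝ E] in
/-- Superposition of past contributions. -/
lemma exists_past_sol (hm : Monotone τ) (hq : 2 ≤ q) (hD : 0 ≤ D) (hl : 1 ≤ l)
    (hT : ∀ k n, ContDiff ℝ l (solTerm A U R k n))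
    (hb : ∀ k n, n < k → ∀ i ≤ 1, ∀ x, ‖iteratedFDeriv ℝ i (solTerm A U R k n) x‖ ≤
      D * ((τ (n + 1) - τ n) * Real.exp (-1 * (τ k - τ n))) * ‖x‖ ^ q) :
    ∃ (ψ : ℕ → E → E) (C : ℝ), (∀ k, ContDiff ℝ l (ψ k)) ∧ (∀ k, IsFlat 1 2 C (ψ k)) ∧
      ∀ k x, ψ (k + 1) (U k x) = A k (ψ k x) - R k x := by
  have hδ : ∀ n, 0 ≤ τ (n + 1) - τ n := fun n => sub_nonneg.2 (hm n.le_succ)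
  have hc : ∀ k, ContDiff ℝ l fun x => -∑ n ∈ Finset.range k, solTerm A U R k n x := fun k =>
    (ContDiff.sum fun n _ => hT k n).neg
  refine ⟨fun k x => -∑ n ∈ Finset.range k, solTerm A U R k n x, D, hc, fun k => ?_, ?_⟩
  · refine ⟨hD, (hc k).of_le (by exact_mod_cast hl), fun i hi x hx => ?_⟩
    change ‖iteratedFDeriv ℝ i (-fun x => ∑ n ∈ Finset.range k, solTerm A U R k n x) x‖ ≤ _
    rw [iteratedFDeriv_neg_apply, norm_neg, iteratedFDeriv_fun_sum_apply fun n _ =>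
      ((hT k n).of_le (by exact_mod_cast hi.trans hl)).contDiffAt]
    refine (norm_sum_le _ _).trans ?_
    calc _ ≤ ∑ n ∈ Finset.range k, D * ‖x‖ ^ q *
          ((τ (n + 1) - τ n) * Real.exp (-1 * (τ k - τ n))) :=
          Finset.sum_le_sum fun n hn => (hb k n (Finset.mem_range.1 hn) i hi x).trans_eq (by ring)
      _ ≤ D * ‖x‖ ^ q * 1 := by
          rw [← Finset.mul_sum]
          gcongr
          exact (sum_past_le one_pos k).trans_eq (by norm_num)
      _ ≤ _ := by
          rw [mul_one]
          gcongr ?_ * ?_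
          exact pow_le_pow_of_le_one (norm_nonneg _) hx (by omega)
  · intro k x
    simp only [Finset.sum_range_succ, solTerm_succ, apply_solTerm_self, map_neg, map_sum]
    abel

end Solution

section Core

variable {E : Type*} [NormedAddCommGroup E] [InnerProductSpace ℝ E] [FiniteDimensional ℝ E]
  {A : ℕ → E ≃L[ℝ] E} {τ : ℕ → ℝ} {g : ℕ → E → E} {K a ε L N ν C : ℝ} {l q t n r : ℕ}
  {P : ℕ → E →L[ℝ] E} {α β : Fin r → ℝ} {S : Fin r → ℕ → E →L[ℝ] E}

lemma IsFlat.of_smoothness_le {E F : Type*} [NormedAddCommGroup E] [NormedSpace ℝ E]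
    [NormedAddCommGroup F] [NormedSpace ℝ F] {n m p : ℕ} {C : ℝ} {f : E → F}
    (h : IsFlat n p C f) (hmn : m ≤ n) : IsFlat m p C f :=
  ⟨h.nonneg, h.contDiff_of_le hmn, fun i hi => h.bound i (hi.trans hmn)⟩

omit [FiniteDimensional ℝ E] in
lemma IsFlat.norm_sub_le {f : E → E} {p : ℕ} (hf : IsFlat n p C f) (hn : 1 ≤ n)
    (h0 : ∀ x, 1 ≤ ‖x‖ → f x = 0) (x y : E) : ‖f x - f y‖ ≤ C * ‖x - y‖ := by
  have hd : Differentiable ℝ f := hf.contDiff.differentiable (by exact_mod_cast (by omega : n ≠ 0))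
  refine convex_univ.norm_image_sub_le_of_norm_fderiv_le (fun z _ => hd z) (fun z _ => ?_)
    (mem_univ y) (mem_univ x)
  rw [← norm_iteratedFDeriv_one]
  exact hf.norm_iteratedFDeriv_le h0 hn z

omit [FiniteDimensional ℝ E] in
lemma norm_le_of_evol (hm : Monotone τ) (hL : ∀ n, τ (n + 1) - τ n ≤ L) (hK : 1 ≤ K) (ha : 0 ≤ a)
    (hEv : ∀ m k, ‖Ev A m k‖ ≤ K * Real.exp (a * |τ m - τ k|)) (n : ℕ) :
    ‖(A n : E →L[ℝ] E)‖ ≤ K * Real.exp (a * L) ∧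
      ‖((A n).symm : E →L[ℝ] E)‖ ≤ K * Real.exp (a * L) := by
  have hδ : 0 ≤ τ (n + 1) - τ n := sub_nonneg.2 (hm n.le_succ)
  have e1 : (A n : E →L[ℝ] E) = Ev A (n + 1) n := by ext x; simp [Ev_succ_self]
  have e2 : ((A n).symm : E →L[ℝ] E) = Ev A n (n + 1) := by ext x; simp [Ev_self_succ]
  have hb := mul_le_mul_of_nonneg_left (Real.exp_le_exp.2
    (mul_le_mul_of_nonneg_left (hL n) ha)) (zero_le_one.trans hK)
  constructor
  · rw [e1]
    refine (hEv _ _).trans ?_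
    rwa [abs_of_nonneg hδ]
  · rw [e2]
    refine (hEv _ _).trans ?_
    rwa [abs_sub_comm, abs_of_nonneg hδ]

/-- Linearization near the origin of a globally small perturbation. -/
lemma exists_linearization_of_small (hm : Monotone τ) (hL : ∀ n, τ (n + 1) - τ n ≤ L) (hK : 1 ≤ K)
    (ha : 0 ≤ a) (hEv : ∀ m k, ‖Ev A m k‖ ≤ K * Real.exp (a * |τ m - τ k|))
    (hS : IsSplitting A τ α β S) (h : IsHyp A τ P N ν) (hl : 1 ≤ l) (hq : 2 ≤ q)
    (hκ : a + l * (a + 1) + 1 ≤ ν / 2 * q) (ht : t + 1 = q + l) (htn : t + 1 ≤ n)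
    (hres : ∀ p, 2 ≤ p → p ≤ t → ∀ (i : Fin r) (σ : Fin p → Fin r),
      β i < ∑ s, α (σ s) ∨ ∑ s, β (σ s) < α i)
    (hε : 0 ≤ ε) (hs1 : (l.factorial : ℝ) * (K * ε) ≤ 1 / 2)
    (hs2 : K * ε ≤ Real.exp (-((a + 1) * L)))
    (hs3 : N * ε * (1 + 2 * N) ≤ Real.exp (-(ν * L)) * (ν / 2))
    (hs4 : K * Real.exp (a * L) * (ε * L) < 1)
    (hg : ∀ k, IsFlat n 2 (ε * (τ (k + 1) - τ k)) (g k)) (hg0 : ∀ k x, 1 ≤ ‖x‖ → g k x = 0) :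
    ∃ (F : ℕ → E → E) (C : ℝ), (∀ k, ContDiff ℝ l (F k)) ∧ (∀ k, IsFlat 1 2 C (F k)) ∧
      ∀ k x, ‖x‖ ≤ 1 / 2 → ‖A k x + g k x‖ ≤ 1 / 2 →
        A k x + g k x + F (k + 1) (A k x + g k x) = A k (x + F k x) := by
  have hδ : ∀ n, 0 ≤ τ (n + 1) - τ n := fun n => sub_nonneg.2 (hm n.le_succ)
  have hL0 : 0 ≤ L := (hδ 0).trans (hL 0)
  have hln : l ≤ n := by omega
  have hA := norm_le_of_evol hm hL hK ha hEv
  have : CompleteSpace E := FiniteDimensional.complete ℝ E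
  have hg2 : ∀ k x y, ‖g k x - g k y‖ ≤ ε * (τ (k + 1) - τ k) * ‖x - y‖ := fun k =>
    (hg k).norm_sub_le (hl.trans hln) (hg0 k)
  have hgz : ∀ k, g k 0 = 0 := fun k => by
    have := (hg k).bound 0 (by omega) 0 (by simp)
    simpa using this
  have hg1 : ∀ k x, ‖g k x‖ ≤ ε * (τ (k + 1) - τ k) * ‖x‖ := fun k x => by
    simpa [hgz] using hg2 k x 0
  have hgl : ∀ k, ContDiff ℝ l (g k) := fun k => (hg k).contDiff_of_le hln
  have hgb : ∀ k, ∀ i ≤ l, ∀ x, ‖iteratedFDeriv ℝ i (g k) x‖ ≤ ε * (τ (k + 1) - τ k) :=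
    fun k i hi x => (hg k).norm_iteratedFDeriv_le (hg0 k) (hi.trans hln) x
  obtain ⟨H, C₁, C₂, hC₂, hH, hR⟩ := exists_normalForm hm hL hS hε (fun n => (hA n).1) g hg t htn
    hres (by omega)
  have hUex := fun k => exists_homeomorph_add (A k) hl (hgl k) (mul_nonneg hε (hδ k)) (hg2 k) (by
    refine lt_of_le_of_lt ?_ hs4
    have := (hA k).2
    have := hL k
    have := hδ k
    gcongr)
  choose U hU hUc hUc' using hUex
  have hf : ∀ n k, ContDiff ℝ l (flow U n k) := contDiff_flow hUc hUc'
  obtain ⟨B, hB0, hB⟩ := exists_cone_splitting (E := E) l N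
  have hsplit := fun k => hB (P k)
    (by simpa using h.stable k k le_rfl) (by simpa using h.unstable k k le_rfl) _ _ q (by omega)
    (by simpa only [ht] using (hR k).of_smoothness_le hln)
  choose R₁ R₂ hR12 hR₁ hR₂ using hsplit
  have hD : 0 ≤ B * C₂ := by positivity
  have hT₁ := contDiff_solTerm (A := A) (U := U) (fun n => (hR₁ n).1) hf
  have hT₂ := contDiff_solTerm (A := A) (U := U) (fun n => (hR₂ n).1) hf
  have hN := h.one_le
  obtain ⟨ψ₁, D₁, hψ₁, hψ₁'⟩ := exists_future_sol hm hL hq (by positivity) hT₁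
    fun k n hkn i hi x => norm_iteratedFDeriv_solTerm_future_le h hm hL hK ha hε hEv hU hgl hgb hg1
      hf hs1 hs3 hD hκ (fun n => (hR₁ n).1)
      (fun n i hi x => ((hR₁ n).2.1 i hi x).trans_eq (by ring))
      (fun n i x hx => ((hR₁ n).2.2 i x hx).2) hkn hi x
  obtain ⟨ψ₂, D₂, hψ₂c, hψ₂, hψ₂'⟩ := exists_past_sol hm hq (by positivity) hl hT₂
    fun k n hkn i hi x => norm_iteratedFDeriv_solTerm_past_le h hm hL hK ha hε hl hEv hU hg2 hg1
      hf hs2 hs3 hD hκ (fun n => (hR₂ n).1)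
      (fun n i hi x => ((hR₂ n).2.1 i hi x).trans_eq (by ring))
      (fun n i x hx => ((hR₂ n).2.2 i x hx).2) hkn hi x
  refine ⟨fun k x => H k x - x + ψ₁ k x + ψ₂ k x, C₁ + D₁ + D₂, fun k => ?_, fun k => ?_, ?_⟩
  · exact (((hH k).contDiff_of_le hln).add (hψ₁ k).contDiff).add (hψ₂c k)
  · exact (((hH k).of_smoothness_le (by omega)).add ((hψ₁ k).of_smoothness_le hl)).add (hψ₂ k)
  · intro k x hx hx'
    rw [← hU] at hx' ⊢
    beta_reduce
    rw [hψ₁' k x hx hx', hψ₂' k x]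
    have := hR12 k x hx
    rw [← hU] at this
    have e : A k (x + (H k x - x + ψ₁ k x + ψ₂ k x)) =
        A k (H k x) + A k (ψ₁ k x) + A k (ψ₂ k x) := by
      rw [← map_add, ← map_add]; congr 1; abel
    rw [e]
    have e2 : H (k + 1) (U k x) = R₁ k x + R₂ k x + A k (H k x) := by rw [this]; abel
    rw [e2]; abel

/-- Localized linearization with uniform control of the linearizing maps. -/
lemma exists_local_linearization (hm : Monotone τ) (hL : ∀ n, τ (n + 1) - τ n ≤ L) (hK : 1 ≤ K)
    (ha : 0 ≤ a) (hEv : ∀ m k, ‖Ev A m k‖ ≤ K * Real.exp (a * |τ m - τ k|))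
    (hS : IsSplitting A τ α β S) (h : IsHyp A τ P N ν) (hl : 1 ≤ l) (hq : 2 ≤ q)
    (hκ : a + l * (a + 1) + 1 ≤ ν / 2 * q) (ht : t + 1 = q + l) (htn : t + 1 ≤ n)
    (hres : ∀ p, 2 ≤ p → p ≤ t → ∀ (i : Fin r) (σ : Fin p → Fin r),
      β i < ∑ s, α (σ s) ∨ ∑ s, β (σ s) < α i)
    (hC : 0 ≤ C) (hg : ∀ k, IsFlat n 2 (C * (τ (k + 1) - τ k)) (g k)) :
    ∃ (T : ℕ → E → E) (ρ : ℝ), 0 < ρ ∧ ∀ k, (ContDiff ℝ l (T k) ∧ T k 0 = 0 ∧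
      ∀ x y, ‖(T k x - x) - (T k y - y)‖ ≤ 1 / 2 * ‖x - y‖) ∧
      ∀ x, ‖x‖ < ρ → T (k + 1) (A k x + g k x) = A k (T k x) := by
  have hδ : ∀ n, 0 ≤ τ (n + 1) - τ n := fun n => sub_nonneg.2 (hm n.le_succ)
  have hL0 : 0 ≤ L := (hδ 0).trans (hL 0)
  have hN := h.one_le
  have hν := h.pos
  have hev : ∀ c b : ℝ, 0 < b → ∀ᶠ ε in 𝓝[>] (0 : ℝ), c * ε < b := fun c b hb => by
    have : Tendsto (fun ε : ℝ => c * ε) (𝓝[>] 0) (𝓝 (c * 0)) :=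
      ((continuous_const_mul c).tendsto 0).mono_left nhdsWithin_le_nhds
    rw [mul_zero] at this
    exact this.eventually_lt_const hb
  have hpos : ∀ᶠ ε in 𝓝[>] (0 : ℝ), 0 < ε := self_mem_nhdsWithin
  obtain ⟨ε, hε0, h1, h2, h3, h4⟩ := (hpos.and
    ((hev (l.factorial * K) (1 / 2) (by norm_num)).and
    ((hev K _ (Real.exp_pos (-((a + 1) * L)))).and
    ((hev (N * (1 + 2 * N)) (Real.exp (-(ν * L)) * (ν / 2)) (by positivity)).and
    (hev (K * Real.exp (a * L) * L) 1 one_pos))))).exists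
  obtain ⟨B, hB1, hB⟩ := exists_isFlat_cutoff E n
  obtain ⟨ρ, hρ, hρ1, hρs⟩ : ∃ ρ : ℝ, 0 < ρ ∧ ρ ≤ 1 ∧ 2 ^ n * B * C * ρ ≤ ε := by
    obtain ⟨ρ, hρ, h1, h2⟩ := (hpos.and
      ((hev 1 1 one_pos).and (hev (2 ^ n * B * C) ε hε0))).exists
    exact ⟨ρ, hρ, by linarith, h2.le⟩
  set g' : ℕ → E → E := fun k x => cutoff E x • ρ⁻¹ • g k (ρ • x) with hg'
  have hgf : ∀ k, IsFlat n 2 (ε * (τ (k + 1) - τ k)) (g' k) := fun k => by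
    refine (IsFlat.cutoff_smul hB ((hg k).rescale hρ hρ1)).mono ?_
    calc _ = 2 ^ n * B * C * ρ * (τ (k + 1) - τ k) := by ring
      _ ≤ _ := mul_le_mul_of_nonneg_right hρs (hδ k)
  obtain ⟨F, D, hFc, hF, hFe⟩ := exists_linearization_of_small hm hL hK ha hEv hS h hl hq hκ ht htn
    hres hε0.le (by linarith) h2.le (by linarith) (by linarith) hgf
    (fun k x hx => by simp only [hg', cutoff_eq_zero hx, zero_smul])
  obtain ⟨B', hB1', hB'⟩ := exists_isFlat_cutoff E 1
  have hD := (hF 0).nonneg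
  obtain ⟨ρ₁, hρ₁, hρ₁1, hρ₁s⟩ : ∃ ρ : ℝ, 0 < ρ ∧ ρ ≤ 1 ∧ 2 ^ 1 * B' * (D * ρ) ≤ 1 / 2 := by
    obtain ⟨ρ, hρ, h1, h2⟩ := (hpos.and
      ((hev 1 1 one_pos).and (hev (2 ^ 1 * B' * D) (1 / 2) (by norm_num)))).exists
    exact ⟨ρ, hρ, by linarith, by linarith⟩
  set φ : ℕ → E → E := fun k x => cutoff E x • ρ₁⁻¹ • F k (ρ₁ • x) with hφ
  have hφf : ∀ k, IsFlat 1 2 (1 / 2) (φ k) := fun k =>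
    (IsFlat.cutoff_smul hB' ((hF k).rescale hρ₁ hρ₁1)).mono hρ₁s
  have hφ0 : ∀ k, φ k 0 = 0 := fun k => by
    simpa using (hφf k).bound 0 (by omega) 0 (by simp)
  have hφL : ∀ k x y, ‖φ k x - φ k y‖ ≤ 1 / 2 * ‖x - y‖ := fun k => (hφf k).norm_sub_le le_rfl
    fun x hx => by simp only [hφ, cutoff_eq_zero hx, zero_smul]
  have hφc : ∀ k, ContDiff ℝ l (φ k) := fun k =>
    (cutoff E).contDiff.smul (((hFc k).comp (contDiff_const_smul ρ₁)).const_smul _)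
  set s := ρ * ρ₁ with hs
  have hs0 : 0 < s := by positivity
  have hA := fun k => (norm_le_of_evol hm hL hK ha hEv k).1
  set b := K * Real.exp (a * L) + C * L with hb
  have hb0 : 0 ≤ b := by positivity
  have hgn : ∀ k x, ‖x‖ ≤ 1 → ‖A k x + g k x‖ ≤ b * ‖x‖ := fun k x hx => by
    have h0 := (hg k).bound 0 (by omega) x hx
    rw [norm_iteratedFDeriv_zero] at h0
    have h1 : ‖x‖ ^ (2 - 0) ≤ ‖x‖ :=
      pow_le_of_le_one (norm_nonneg x) hx (by norm_num)
    have h2 := hL k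
    have h3 := hδ k
    calc _ ≤ K * Real.exp (a * L) * ‖x‖ + C * L * ‖x‖ :=
          (norm_add_le _ _).trans (add_le_add ((A k : E →L[ℝ] E).le_of_opNorm_le (hA k) x)
            (h0.trans (by gcongr)))
      _ = b * ‖x‖ := by rw [hb]; ring
  refine ⟨fun k x => x + s • φ k (s⁻¹ • x), s / 2 / (1 + b), by positivity, fun k =>
    ⟨⟨?_, ?_, ?_⟩, ?_⟩⟩
  · exact contDiff_id.add (((hφc k).comp (contDiff_const_smul _)).const_smul _)
  · simp [hφ0]
  · intro x y
    rw [add_sub_cancel_left, add_sub_cancel_left, ← smul_sub, norm_smul, Real.norm_eq_abs,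
      abs_of_pos hs0]
    calc _ ≤ s * (1 / 2 * ‖s⁻¹ • x - s⁻¹ • y‖) := by
          have := hφL k (s⁻¹ • x) (s⁻¹ • y)
          gcongr
      _ = _ := by
          rw [← smul_sub, norm_smul, Real.norm_eq_abs, abs_of_pos (by positivity)]
          field_simp
  · intro x hx
    have hx1 : ‖x‖ * (1 + b) < s / 2 := (lt_div_iff₀ (by positivity)).1 hx
    have hxs : ‖x‖ ≤ s / 2 := by nlinarith [norm_nonneg x]
    have hs1 : s ≤ 1 := by rw [hs]; nlinarith
    have hsρ : s ≤ ρ := by rw [hs]; nlinarith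
    set y := A k x + g k x with hy
    have hys : ‖y‖ ≤ s / 2 := (hgn k x (by linarith)).trans (by nlinarith [norm_nonneg x])
    have hsc : ∀ c : ℝ, s ≤ c → ∀ z : E, ‖z‖ ≤ s / 2 → ‖c⁻¹ • z‖ ≤ 1 / 2 := fun c hc z hz => by
      have hc0 : 0 < c := hs0.trans_le hc
      rw [norm_smul, Real.norm_eq_abs, abs_of_pos (by positivity), inv_mul_le_iff₀ hc0]
      linarith
    have hφe : ∀ j (z : E), ‖z‖ ≤ s / 2 → s • φ j (s⁻¹ • z) = ρ • F j (ρ⁻¹ • z) := fun j z hz => by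
      simp only [hφ]
      rw [cutoff_eq_one (hsc s le_rfl z hz), one_smul, smul_smul, smul_smul]
      congr 2
      · rw [hs]; field_simp
      · congr 1; rw [hs]; field_simp
    beta_reduce
    rw [hφe _ _ hxs, hφe _ _ hys]
    have e : A k (ρ⁻¹ • x) + g' k (ρ⁻¹ • x) = ρ⁻¹ • y := by
      simp only [hg']
      rw [cutoff_eq_one (hsc ρ hsρ x hxs), one_smul, smul_smul, mul_inv_cancel₀ hρ.ne', one_smul,
        map_smul, ← smul_add]
    have := hFe k (ρ⁻¹ • x) (hsc ρ hsρ x hxs) (by rw [e]; exact hsc ρ hsρ y hys)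
    rw [e] at this
    have h5 := congrArg (fun z => ρ • z) this
    simp only [smul_add, map_add, map_smul, smul_smul, mul_inv_cancel₀ hρ.ne', one_smul] at h5
    rw [h5, map_add, map_smul]

end Core

section Interface

lemma exists_isHyp_of_muDichotomy {μ : ℕ → ℝ} (hpos : ∀ n, 0 < μ n) {A : ℕ → X ≃L[ℝ] X}
    (h : MuDichotomyNormsE μ A fun _ x => ‖x‖) :
    ∃ P N ν, IsHyp (fun n => A (n + 1)) (fun n => Real.log (μ (n + 1))) P N ν := by
  obtain ⟨P, hP, hc, -, N, ν, hN, hν, h1, h2⟩ := h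
  refine ⟨fun n => P (n + 1), N, ν, fun k => hP (k + 1) (by omega), fun k => hc (k + 1) (by omega),
    hN, hν, fun m k hkm => ?_, fun m k hmk => ?_⟩
  · refine ContinuousLinearMap.opNorm_le_bound _ (by positivity) fun x => ?_
    have := h1 (k + 1) (m + 1) (by omega) (by omega) x
    rw [evolE_succ_succ, mu_rpow hpos, neg_mul] at this
    exact this
  · refine ContinuousLinearMap.opNorm_le_bound _ (by positivity) fun x => ?_
    have := h2 (m + 1) (k + 1) (by omega) (by omega) x
    rw [evolE_succ_succ, mu_rpow hpos, neg_mul] at this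
    exact this

lemma norm_Ev_le_of_evolE {μ : ℕ → ℝ} (hpos : ∀ n, 0 < μ n) (hm : Monotone μ) {A : ℕ → X ≃L[ℝ] X}
    {K a : ℝ} (hfwd : ∀ k m : ℕ, 1 ≤ k → k ≤ m → ‖evolE A m k‖ ≤ K * (μ m / μ k) ^ a)
    (hbwd : ∀ m k : ℕ, 1 ≤ m → m ≤ k → ‖evolE A m k‖ ≤ K * (μ k / μ m) ^ a) (m k : ℕ) :
    ‖Ev (fun n => A (n + 1)) m k‖ ≤
      max K 1 * Real.exp (a * |Real.log (μ (m + 1)) - Real.log (μ (k + 1))|) := by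
  have hlog : ∀ i j, i ≤ j → Real.log (μ (i + 1)) ≤ Real.log (μ (j + 1)) := fun i j hij =>
    Real.log_le_log (hpos _) (hm (by omega))
  rw [← evolE_succ_succ]
  refine le_trans ?_ (mul_le_mul_of_nonneg_right (le_max_left K 1) (Real.exp_pos _).le)
  rcases le_total k m with h | h
  · rw [abs_of_nonneg (sub_nonneg.2 (hlog k m h)), ← mu_rpow hpos]
    exact hfwd _ _ (by omega) (by omega)
  · rw [abs_sub_comm, abs_of_nonneg (sub_nonneg.2 (hlog m k h)), ← mu_rpow hpos]
    exact hbwd _ _ (by omega) (by omega)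

lemma sum_mul_card_fiber {p r : ℕ} (σ : Fin p → Fin r) (c : ℕ → ℝ) :
    ∑ j ∈ Finset.Icc 1 r, c j * ((Finset.univ.filter fun s => (σ s : ℕ) + 1 = j).card : ℝ) =
      ∑ s, c (σ s + 1) := by
  rw [← Finset.sum_fiberwise_of_maps_to (s := Finset.univ) (t := Finset.Icc 1 r)
    (g := fun s => (σ s : ℕ) + 1) fun s _ => Finset.mem_Icc.2 ⟨by omega, (σ s).isLt⟩]
  refine Finset.sum_congr rfl fun j _ => ?_
  rw [Finset.sum_congr rfl fun s hs => by rw [(Finset.mem_filter.1 hs).2], Finset.sum_const,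
    nsmul_eq_mul, mul_comm]

lemma nonresonant_of_Icc_inter_eq_empty {r t : ℕ} {aa bb : ℕ → ℝ}
    (hab : ∀ i, 1 ≤ i → i ≤ r → aa i ≤ bb i)
    (hres : ∀ i, 1 ≤ i → i ≤ r → ∀ q : ℕ → ℕ,
      2 ≤ ∑ j ∈ Finset.Icc 1 r, q j → ∑ j ∈ Finset.Icc 1 r, q j ≤ t →
      Icc (aa i) (bb i) ∩ Icc (∑ j ∈ Finset.Icc 1 r, aa j * q j)
        (∑ j ∈ Finset.Icc 1 r, bb j * q j) = ∅)
    {p : ℕ} (hp : 2 ≤ p) (hpt : p ≤ t) (i : Fin r) (σ : Fin p → Fin r) :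
    bb (i + 1) < ∑ s, aa (σ s + 1) ∨ ∑ s, bb (σ s + 1) < aa (i + 1) := by
  have hcard : ∑ j ∈ Finset.Icc 1 r,
      (Finset.univ.filter fun s => (σ s : ℕ) + 1 = j).card = p := by
    have := sum_mul_card_fiber σ fun _ => 1
    simp only [one_mul, Finset.sum_const, Finset.card_univ, Fintype.card_fin, nsmul_eq_mul,
      mul_one] at this
    exact_mod_cast this
  have h := hres (i + 1) (by omega) i.isLt
    (fun j => (Finset.univ.filter fun s => (σ s : ℕ) + 1 = j).card) (hp.trans_eq hcard.symm)
    (hcard.le.trans hpt)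
  rw [sum_mul_card_fiber, sum_mul_card_fiber] at h
  by_contra! hcon
  have h1 := hab (i + 1) (by omega) i.isLt
  have h2 : ∑ s, aa (σ s + 1) ≤ ∑ s, bb (σ s + 1) :=
    Finset.sum_le_sum fun s _ => hab _ (by omega) (σ s).isLt
  refine eq_empty_iff_forall_notMem.1 h (max (aa (i + 1)) (∑ s, aa (σ s + 1)))
    ⟨⟨le_max_left _ _, max_le h1 hcon.1⟩, le_max_right _ _, max_le hcon.2 h2⟩

lemma log_sub_log_le {μ : ℕ → ℝ} (hpos : ∀ n, 0 < μ n) {θ : ℝ} (hμr : ∀ n, μ (n + 1) / μ n ≤ θ)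
    (n : ℕ) : Real.log (μ (n + 1)) - Real.log (μ n) ≤ Real.log θ := by
  rw [← Real.log_div (hpos _).ne' (hpos _).ne']
  exact Real.log_le_log (div_pos (hpos _) (hpos _)) (hμr n)

lemma sub_div_le_mul_log_sub_log {μ : ℕ → ℝ} (hpos : ∀ n, 0 < μ n) (hm : Monotone μ) {θ : ℝ}
    (hμr : ∀ n, μ (n + 1) / μ n ≤ θ) (n : ℕ) :
    (μ (n + 1) - μ n) / μ n ≤ θ * (Real.log (μ (n + 1)) - Real.log (μ n)) := by
  have h0 := hpos n
  have h1 := hpos (n + 1)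
  have h2 := Real.one_sub_inv_le_log_of_pos (div_pos h1 h0)
  rw [Real.log_div h1.ne' h0.ne'] at h2
  have h3 : 0 ≤ Real.log (μ (n + 1)) - Real.log (μ n) :=
    sub_nonneg.2 (Real.log_le_log h0 (hm n.le_succ))
  calc (μ (n + 1) - μ n) / μ n = μ (n + 1) / μ n * (1 - (μ (n + 1) / μ n)⁻¹) := by
        field_simp
    _ ≤ μ (n + 1) / μ n * (Real.log (μ (n + 1)) - Real.log (μ n)) := by gcongr
    _ ≤ _ := by gcongr; exact hμr n

lemma InOmegaMu.isFlat {μ : ℕ → ℝ} (hpos : ∀ n, 0 < μ n) (hm : Monotone μ) {θ M : ℝ}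
    (hθ : 0 ≤ θ) (hμr : ∀ n, μ (n + 1) / μ n ≤ θ) (hM : 0 ≤ M) {n : ℕ} (hn : 2 ≤ n)
    {g : ℕ → X → X} (hg : InOmegaMu μ n g M) (k : ℕ) :
    IsFlat n 2 (M * θ * (Real.log (μ (k + 1 + 1)) - Real.log (μ (k + 1)))) (g (k + 1)) := by
  obtain ⟨hc, h0, h1, hb⟩ := hg
  have hδ : 0 ≤ Real.log (μ (k + 1 + 1)) - Real.log (μ (k + 1)) :=
    sub_nonneg.2 (Real.log_le_log (hpos _) (hm (Nat.le_succ _)))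
  refine IsFlat.of_iteratedFDeriv_zero (by positivity) (by exact_mod_cast hc (k + 1)) hn
    (fun i hi x _ => (hb (k + 1) (by omega) x i hi).trans ?_) fun i hi => ?_
  · rw [mul_div_assoc, mul_assoc]
    exact mul_le_mul_of_nonneg_left (sub_div_le_mul_log_sub_log hpos hm hμr _) hM
  · rw [← norm_eq_zero]
    interval_cases i
    · rw [norm_iteratedFDeriv_zero, h0, norm_zero]
    · rw [norm_iteratedFDeriv_one, h1, norm_zero]

end Interface

section Conjugacy

variable {E : Type*} [NormedAddCommGroup E] [NormedSpace ℝ E] {l : ℕ}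

lemma exists_homeomorph_of_near_id [FiniteDimensional ℝ E] (hl : 1 ≤ l) {T : E → E}
    (hT : ContDiff ℝ l T) (h0 : T 0 = 0)
    (hlip : ∀ x y, ‖(T x - x) - (T y - y)‖ ≤ 1 / 2 * ‖x - y‖) :
    ∃ U : E ≃ₜ E, (∀ x, U x = T x) ∧ (ContDiff ℝ l U ∧ ContDiff ℝ l U.symm) ∧
      (∀ x, ‖U x‖ ≤ 3 / 2 * ‖x‖) ∧ ∀ x, ‖U.symm x‖ ≤ 2 * ‖x‖ := by
  obtain ⟨U, hU, h1, h2⟩ := exists_homeomorph_add (ContinuousLinearEquiv.refl ℝ E) hl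
    (f := fun x => T x - x) (hT.sub contDiff_id) (c := 1 / 2) (by norm_num) hlip (by
      have : ‖((ContinuousLinearEquiv.refl ℝ E).symm : E →L[ℝ] E)‖ ≤ 1 :=
        ContinuousLinearMap.norm_id_le
      linarith)
  have hU' : ∀ x, U x = T x := fun x => by rw [hU]; simp
  have hx : ∀ x, ‖T x - x‖ ≤ 1 / 2 * ‖x‖ := fun x => by simpa [h0] using hlip x 0
  refine ⟨U, hU', ⟨h1, h2⟩, fun x => ?_, fun x => ?_⟩
  · rw [hU']
    have := norm_add_le (T x - x) x
    rw [sub_add_cancel] at this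
    linarith [hx x]
  · have h3 := hx (U.symm x)
    rw [← hU', U.apply_symm_apply] at h3
    have := norm_sub_norm_le (U.symm x) x
    rw [norm_sub_rev] at h3
    linarith

lemma exists_conjugacy_pair [FiniteDimensional ℝ E] (hl : 1 ≤ l) {A : ℕ → E ≃L[ℝ] E}
    {C : ℕ → ℝ} (hC : ∀ k, 0 ≤ C k) {n : ℕ} {g : ℕ → E → E} (hg : ∀ k, IsFlat n 2 (C k) (g k))
    (hloc : ∀ f : ℕ → E → E, (∀ k, IsFlat n 2 (C k) (f k)) →
      ∃ (T : ℕ → E → E) (ρ : ℝ), 0 < ρ ∧ ∀ k, (ContDiff ℝ l (T k) ∧ T k 0 = 0 ∧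
        ∀ x y, ‖(T k x - x) - (T k y - y)‖ ≤ 1 / 2 * ‖x - y‖) ∧
        ∀ x, ‖x‖ < ρ → T (k + 1) (A k x + f k x) = A k (T k x)) :
    ∃ (Y Z : ℕ → E ≃ₜ E) (ρ : ℝ), 0 < ρ ∧
      (∀ k, ((ContDiff ℝ l (Y k) ∧ ContDiff ℝ l (Y k).symm) ∧
        (∀ x, ‖Y k x‖ ≤ 3 / 2 * ‖x‖) ∧ ∀ x, ‖(Y k).symm x‖ ≤ 2 * ‖x‖) ∧
        (ContDiff ℝ l (Z k) ∧ ContDiff ℝ l (Z k).symm) ∧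
        (∀ x, ‖Z k x‖ ≤ 3 / 2 * ‖x‖) ∧ ∀ x, ‖(Z k).symm x‖ ≤ 2 * ‖x‖) ∧
      ∀ k x, ‖x‖ < ρ → Z (k + 1) (A k x + g k x) = A k (Y k x) ∧
        Y (k + 1) (A k x) = A k (Z k x) := by
  have hzero : ∀ k, IsFlat n 2 (C k) (fun _ : E => (0 : E)) := fun k =>
    ⟨hC k, contDiff_const, fun i _ x _ => by
      have : iteratedFDeriv ℝ i (fun _ : E => (0 : E)) x = 0 := by
        have := iteratedFDeriv_fun_zero (𝕜 := ℝ) (E := E) (F := E) (n := i)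
        exact congrFun this x
      rw [this, norm_zero]
      have := hC k
      positivity⟩
  have hloc' : ∀ f : ℕ → E → E, (∀ k, IsFlat n 2 (C k) (f k)) →
      ∃ (U : ℕ → E ≃ₜ E) (ρ : ℝ), 0 < ρ ∧ (∀ k, (ContDiff ℝ l (U k) ∧ ContDiff ℝ l (U k).symm) ∧
        (∀ x, ‖U k x‖ ≤ 3 / 2 * ‖x‖) ∧ ∀ x, ‖(U k).symm x‖ ≤ 2 * ‖x‖) ∧
        ∀ k x, ‖x‖ < ρ → U (k + 1) (A k x + f k x) = A k (U k x) := fun f hf => by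
    obtain ⟨T, ρ, hρ, hT⟩ := hloc f hf
    choose U hU hU' using fun k =>
      exists_homeomorph_of_near_id hl (hT k).1.1 (hT k).1.2.1 (hT k).1.2.2
    exact ⟨U, ρ, hρ, hU', fun k x hx => by rw [hU, hU]; exact (hT k).2 x hx⟩
  obtain ⟨U, ρ, hρ, hU, hUe⟩ := hloc' (fun k => if Even k then g k else fun _ => 0) fun k => by
    split_ifs
    exacts [hg k, hzero k]
  obtain ⟨V, ρ', hρ', hV, hVe⟩ := hloc' (fun k => if Even k then fun _ => 0 else g k) fun k => by
    split_ifs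
    exacts [hzero k, hg k]
  refine ⟨fun k => if Even k then U k else V k, fun k => if Even k then V k else U k, min ρ ρ',
    lt_min hρ hρ', fun k => ?_, fun k x hx => ?_⟩
  · by_cases hk : Even k
    · simp only [hk, if_true]; exact ⟨hU k, hV k⟩
    · simp only [hk, if_false]; exact ⟨hV k, hU k⟩
  · have h1 := hUe k x (hx.trans_le (min_le_left _ _))
    have h2 := hVe k x (hx.trans_le (min_le_right _ _))
    by_cases hk : Even k
    · have hk' : ¬ Even (k + 1) := by rwa [Nat.even_add_one, not_not]
      simp only [hk, hk', if_true, if_false, add_zero] at h1 h2 ⊢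
      exact ⟨h1, h2⟩
    · have hk' : Even (k + 1) := Nat.even_add_one.2 hk
      simp only [hk, hk', if_true, if_false, add_zero] at h1 h2 ⊢
      exact ⟨h2, h1⟩

lemma contDiffOn_invFunOn [Nonempty E] (H : E ≃ₜ E) (hH : ContDiff ℝ l H.symm) (s : Set E) :
    ContDiffOn ℝ l (Function.invFunOn H s) (H '' s) := by
  refine hH.contDiffOn.congr ?_
  rintro _ ⟨x, hx, rfl⟩
  rw [H.injective.injOn.leftInvOn_invFunOn hx, H.symm_apply_apply]

end Conjugacy

/-- Theorem 6.1 (`Sieg`), a Sternberg-type smooth linearization theorem. -/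
theorem sternberg_linearization {d : ℕ}
    (μ : ℕ → ℝ) (hμ : IsGrowthRate μ) (θ : ℝ) (hθ : 1 ≤ θ)
    (hμr : ∀ n, μ (n + 1) / μ n ≤ θ)
    (A : ℕ → EuclideanSpace ℝ (Fin d) ≃L[ℝ] EuclideanSpace ℝ (Fin d))
    (hdich : MuDichotomyNormsE μ A fun _ x => ‖x‖)
    (K a : ℝ) (hK : 0 < K) (ha : 0 < a)
    (hfwd : ∀ k m : ℕ, 1 ≤ k → k ≤ m → ‖evolE A m k‖ ≤ K * (μ m / μ k) ^ a)
    (hbwd : ∀ m k : ℕ, 1 ≤ m → m ≤ k → ‖evolE A m k‖ ≤ K * (μ k / μ m) ^ a)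
    (r : ℕ) (hr1 : 1 ≤ r) (hrd : r ≤ d) (aa bb : ℕ → ℝ)
    (hab : ∀ i, 1 ≤ i → i ≤ r → aa i ≤ bb i)
    (hord : ∀ i, 1 ≤ i → i < r → bb i < aa (i + 1))
    (hspec : muSpectrum μ A = ⋃ i ∈ Finset.Icc 1 r, Set.Icc (aa i) (bb i)) :
    ∀ l : ℕ, 1 ≤ l → ∃ t : ℕ, l ≤ t ∧
      ∀ (g : ℕ → EuclideanSpace ℝ (Fin d) → EuclideanSpace ℝ (Fin d)) (M : ℝ), 0 < M →
        (∀ i, 1 ≤ i → i ≤ r → ∀ q : ℕ → ℕ,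
          2 ≤ ∑ j ∈ Finset.Icc 1 r, q j → ∑ j ∈ Finset.Icc 1 r, q j ≤ t →
          Set.Icc (aa i) (bb i) ∩
            Set.Icc (∑ j ∈ Finset.Icc 1 r, aa j * q j)
              (∑ j ∈ Finset.Icc 1 r, bb j * q j) = ∅) →
        InOmegaMu μ (t + 2) g M →
        (∀ n, 1 ≤ n → IsHomeoOf (pert A g n)) →
        ∃ p pt rr rt : ℝ, 0 < p ∧ 0 < pt ∧ 0 < rr ∧ rr < p ∧ 0 < rt ∧ rt < pt ∧
          ∃ h hb : ℕ → EuclideanSpace ℝ (Fin d) → EuclideanSpace ℝ (Fin d),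
            (∀ k, 1 ≤ k →
              ContDiffOn ℝ (l : ℕ∞) (h k) (Metric.ball 0 rr) ∧
              Set.MapsTo (h k) (Metric.ball 0 rr) (Metric.ball 0 pt) ∧
              Set.InjOn (h k) (Metric.ball 0 rr) ∧
              ContDiffOn ℝ (l : ℕ∞) (Function.invFunOn (h k) (Metric.ball 0 rr))
                (h k '' Metric.ball 0 rr)) ∧
            (∀ k, 1 ≤ k →
              ContDiffOn ℝ (l : ℕ∞) (hb k) (Metric.ball 0 rt) ∧
              Set.MapsTo (hb k) (Metric.ball 0 rt) (Metric.ball 0 p) ∧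
              Set.InjOn (hb k) (Metric.ball 0 rt) ∧
              ContDiffOn ℝ (l : ℕ∞) (Function.invFunOn (hb k) (Metric.ball 0 rt))
                (hb k '' Metric.ball 0 rt)) ∧
            (∀ k, 1 ≤ k → ∀ x ∈ Metric.ball (0 : EuclideanSpace ℝ (Fin d)) rr,
              h k x ∈ Metric.ball (0 : EuclideanSpace ℝ (Fin d)) rt → hb k (h k x) = x) ∧
            (∀ k, 1 ≤ k → ∀ x ∈ Metric.ball (0 : EuclideanSpace ℝ (Fin d)) rt,
              hb k x ∈ Metric.ball (0 : EuclideanSpace ℝ (Fin d)) rr → h k (hb k x) = x) ∧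
            (∀ k, 1 ≤ k → ∀ x ∈ Metric.ball (0 : EuclideanSpace ℝ (Fin d)) rr,
              A k x + g k x ∈ Metric.ball (0 : EuclideanSpace ℝ (Fin d)) rt →
              hb (k + 1) (A k x + g k x) = A k (h k x)) ∧
            (∀ ε : ℝ, 0 < ε → ∃ δ : ℝ, 0 < δ ∧ ∀ k, 1 ≤ k →
              (∀ x ∈ Metric.ball (0 : EuclideanSpace ℝ (Fin d)) rr,
                ‖x‖ < δ → ‖h k x‖ < ε) ∧
              (∀ x ∈ Metric.ball (0 : EuclideanSpace ℝ (Fin d)) rt,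
                ‖x‖ < δ → ‖hb k x‖ < ε)) := by
  intro l hl
  have hpos := hμ.pos
  have hm : Monotone μ := hμ.1.monotone
  obtain ⟨P, N, ν, hyp⟩ := exists_isHyp_of_muDichotomy hpos hdich
  have hν : 0 < ν := hyp.pos
  have hτm : Monotone fun n => Real.log (μ (n + 1)) := fun i j hij =>
    Real.log_le_log (hpos _) (hm (by omega))
  have hEv := norm_Ev_le_of_evolE hpos hm hfwd hbwd
  obtain ⟨S, hS⟩ := exists_isSplitting (A := fun n => A (n + 1))
    (τ := fun n => Real.log (μ (n + 1)))
    (Real.tendsto_log_atTop.comp ((tendsto_add_atTop_iff_nat 1).2 hμ.2.2)) hτm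
    (le_max_right K 1) hEv hr1 hab hord fun lam hlam => by
      refine isDich_of_muDichotomy hpos ?_
      by_contra hcon
      have hmem : lam ∈ muSpectrum μ A := hcon
      rw [hspec] at hmem
      simp only [mem_iUnion, Finset.mem_Icc] at hmem
      obtain ⟨i, hi, hi'⟩ := hmem
      exact hlam i hi.1 hi.2 hi'
  set κ := a + l * (a + 1) + 1 with hκ
  set q := max 2 ⌈2 * κ / ν⌉₊ with hq
  have hq2 : 2 ≤ q := le_max_left _ _
  have hκq : κ ≤ ν / 2 * q := by
    have h1 : 2 * κ / ν ≤ q := (Nat.le_ceil _).trans (by exact_mod_cast le_max_right _ _)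
    rw [div_le_iff₀ hν] at h1
    linarith
  refine ⟨q + l - 1, by omega, fun g M hM hres hg _ => ?_⟩
  have hMθ : 0 ≤ M * θ := by positivity
  obtain ⟨Y, Z, ρ, hρ, hYZ, hconj⟩ := exists_conjugacy_pair hl (A := fun n => A (n + 1))
    (C := fun k => M * θ * (Real.log (μ (k + 1 + 1)) - Real.log (μ (k + 1))))
    (n := q + l - 1 + 2) (g := fun k => g (k + 1))
    (fun k => mul_nonneg hMθ (sub_nonneg.2 (hτm k.le_succ)))
    (hg.isFlat hpos hm (by positivity) hμr hM.le (by omega))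
    fun f hf => exists_local_linearization hτm (fun n => log_sub_log_le hpos hμr (n + 1))
      (le_max_right K 1) ha.le hEv hS hyp hl hq2 hκq (t := q + l - 1) (by omega) (by omega)
      (fun p hp hpt i σ => nonresonant_of_Icc_inter_eq_empty hab hres hp hpt i σ) hMθ hf
  set h : ℕ → EuclideanSpace ℝ (Fin d) ≃ₜ EuclideanSpace ℝ (Fin d) :=
    fun k => (Y (k - 1)).trans (Z (k - 1)).symm with h_def
  have hh : ∀ k x, ‖h k x‖ ≤ 3 * ‖x‖ := fun k x =>
    ((hYZ (k - 1)).2.2.2 (Y (k - 1) x)).trans (by linarith [(hYZ (k - 1)).1.2.1 x])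
  have hb : ∀ k x, ‖(h k).symm x‖ ≤ 3 * ‖x‖ := fun k x =>
    ((hYZ (k - 1)).1.2.2 (Z (k - 1) x)).trans (by linarith [(hYZ (k - 1)).2.2.1 x])
  have hc : ∀ k, ContDiff ℝ l (h k) := fun k => (hYZ (k - 1)).2.1.2.comp (hYZ (k - 1)).1.1.1
  have hc' : ∀ k, ContDiff ℝ l (h k).symm := fun k =>
    (hYZ (k - 1)).1.1.2.comp (hYZ (k - 1)).2.1.1
  have hmaps : ∀ {f : EuclideanSpace ℝ (Fin d) → EuclideanSpace ℝ (Fin d)},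
      (∀ x, ‖f x‖ ≤ 3 * ‖x‖) → MapsTo f (ball 0 (ρ / 4)) (ball 0 ρ) := fun hf x hx => by
    rw [mem_ball_zero_iff] at hx ⊢
    linarith [hf x]
  have hloc : ∀ (H : EuclideanSpace ℝ (Fin d) ≃ₜ EuclideanSpace ℝ (Fin d)),
      ContDiff ℝ l H → ContDiff ℝ l H.symm → (∀ x, ‖H x‖ ≤ 3 * ‖x‖) →
      ContDiffOn ℝ (l : ℕ∞) H (ball 0 (ρ / 4)) ∧ MapsTo H (ball 0 (ρ / 4)) (ball 0 ρ) ∧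
        InjOn H (ball 0 (ρ / 4)) ∧ ContDiffOn ℝ (l : ℕ∞)
          (Function.invFunOn H (ball 0 (ρ / 4))) (H '' ball 0 (ρ / 4)) :=
    fun H h1 h2 h3 => ⟨by exact_mod_cast h1.contDiffOn, hmaps h3, H.injective.injOn,
      by exact_mod_cast contDiffOn_invFunOn H h2 _⟩
  refine ⟨ρ, ρ, ρ / 4, ρ / 4, hρ, hρ, by linarith, by linarith, by linarith, by linarith,
    fun k => h k, fun k => (h k).symm, fun k _ => hloc (h k) (hc k) (hc' k) (hh k),
    fun k _ => hloc (h k).symm (hc' k) (hc k) (hb k),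
    fun k _ x _ _ => (h k).symm_apply_apply x, fun k _ x _ _ => (h k).apply_symm_apply x,
    fun k hk x hx _ => ?_, fun ε hε => ⟨ε / 3, by linarith, fun k _ =>
      ⟨fun x _ hxε => by linarith [hh k x], fun x _ hxε => by linarith [hb k x]⟩⟩⟩
  obtain ⟨n, rfl⟩ : ∃ n, k = n + 1 := ⟨k - 1, by omega⟩
  have hz := hmaps (hh (n + 1)) hx
  rw [mem_ball_zero_iff] at hx hz
  have hYh : Y n x = Z n (h (n + 1) x) := ((Z n).apply_symm_apply (Y n x)).symm
  refine (h (n + 1 + 1)).injective ?_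
  rw [(h (n + 1 + 1)).apply_symm_apply]
  refine (Z (n + 1)).injective ?_
  have h1 := (hconj n x (by linarith)).1
  have h2 := (hconj n _ hz).2
  rw [h1, hYh, ← h2]
  exact ((Z (n + 1)).apply_symm_apply _).symm

end
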